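/- There exist constants C, c, γ > 0 depending only on Ω such that for all ε ∈ (0, 1/2]: sup_{λ ∈ [λ_min, λ_max]} sup_{θ⋆ ∈ D} P( ∃ θ ∈ ℝ^N with W₂(μ̂_{(θ, θ⋆)}, μ⋆_λ)² ≥ ε and 𝓛_λ(θ) ≤ min 𝓛_λ + γε ) ≤ C ε^{−max(1,a)} exp(−c N ε² ε^a (log ε)^{−2}), where a = 1/2 + 1/p. -/

import Mathlib

open MeasureTheory ProbabilityTheory
open scoped ENNReal NNReal

noncomputable section

/-- Standard Gaussian density φ. -/
def gphi (x : ℝ) : ℝ := Real.exp (-x ^ 2 / 2) / Real.sqrt (2 * Real.pi)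

/-- Standard Gaussian CDF Φ. -/
def gPhi (x : ℝ) : ℝ := ∫ t in Set.Iic x, gphi t

/-- Soft thresholding η(x; b) = sign(x)(|x| − b)₊. -/
def eta (x b : ℝ) : ℝ := Real.sign x * max (|x| - b) 0

/-- Derivative in x of soft thresholding: η′(x; b) = 1_{|x| > b}. -/
def eta' (x b : ℝ) : ℝ := if b < |x| then 1 else 0

/-- The ℓ_p ball F_p(ξ) = {x : (1/N) ∑ |xᵢ|^p ≤ ξ^p}. -/
def Fball (N : ℕ) (p ξ : ℝ) : Set (Fin N → ℝ) :=
  {x | (1 / (N : ℝ)) * ∑ i, |x i| ^ p ≤ ξ ^ p}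

/-- Number of nonzero entries ‖x‖₀. -/
def l0 {N : ℕ} (x : Fin N → ℝ) : ℕ := (Finset.univ.filter fun i => x i ≠ 0).card

/-- The ℓ₀ ball F_0(s) = {x : ‖x‖₀ ≤ sN}. -/
def F0ball (N : ℕ) (s : ℝ) : Set (Fin N → ℝ) := {x | (l0 x : ℝ) ≤ s * N}

/-- The critical sparsity s_max(δ). -/
def smax (δ : ℝ) : ℝ :=
  δ * sSup ((fun α : ℝ =>
      (1 - (2 / δ) * ((1 + α ^ 2) * gPhi (-α) - α * gphi α)) /
      (1 + α ^ 2 - 2 * ((1 + α ^ 2) * gPhi (-α) - α * gphi α))) '' Set.Ici 0)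

/-- Empirical distribution of the entries of a vector. -/
def empDist {N : ℕ} (θ : Fin N → ℝ) : Measure ℝ :=
  ((N : ℝ≥0∞))⁻¹ • ∑ i : Fin N, Measure.dirac (θ i)

/-- Empirical distribution of pairs of entries of two vectors. -/
def empDist2 {N : ℕ} (u v : Fin N → ℝ) : Measure (ℝ × ℝ) :=
  ((N : ℝ≥0∞))⁻¹ • ∑ i : Fin N, Measure.dirac (u i, v i)

/-- Squared order-2 Wasserstein distance between measures on ℝ². -/
def W2sq (μ ν : Measure (ℝ × ℝ)) : ℝ :=
  sInf {r : ℝ | ∃ γ : Measure ((ℝ × ℝ) × (ℝ × ℝ)),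
    γ.map Prod.fst = μ ∧ γ.map Prod.snd = ν ∧
    r = ∫ q, ((q.1.1 - q.2.1) ^ 2 + (q.1.2 - q.2.2) ^ 2) ∂γ}

/-- Order-2 Wasserstein distance. -/
def W2 (μ ν : Measure (ℝ × ℝ)) : ℝ := Real.sqrt (W2sq μ ν)

/-- Standard Gaussian measure on ℝ. -/
def stdG : Measure ℝ := gaussianReal 0 1

/-- The state-evolution fixed point equations (for (Θ,Z) ∼ μ ⊗ N(0,1)),
together with positivity of (β, τ). -/
def StateEvo (δ σ : ℝ) (μ : Measure ℝ) (lam β τ : ℝ) : Prop :=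
  0 < β ∧ 0 < τ ∧
  τ ^ 2 = σ ^ 2 + (1 / δ) *
    ∫ q : ℝ × ℝ, (eta (q.1 + τ * q.2) (τ * lam / β) - q.1) ^ 2 ∂(μ.prod stdG) ∧
  β = τ * (1 - (1 / δ) *
    ∫ q : ℝ × ℝ, eta' (q.1 + τ * q.2) (τ * lam / β) ∂(μ.prod stdG))

/-- s⋆ = P(|Θ + τZ| ≥ ατ) for (Θ,Z) ∼ μ ⊗ N(0,1). -/
def sStar (μ : Measure ℝ) (τ α : ℝ) : ℝ :=
  ((μ.prod stdG) {q : ℝ × ℝ | α * τ ≤ |q.1 + τ * q.2|}).toReal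

/-- The limit law μ⋆: law of (η(Θ + τZ; ατ), Θ) for (Θ,Z) ∼ μ ⊗ N(0,1). -/
def muStar (μ : Measure ℝ) (τ α : ℝ) : Measure (ℝ × ℝ) :=
  (μ.prod stdG).map (fun q => (eta (q.1 + τ * q.2) (α * τ), q.1))

/-- The limit law for the debiased Lasso: law of (Θ + τZ, Θ). -/
def muStarD (μ : Measure ℝ) (τ : ℝ) : Measure (ℝ × ℝ) :=
  (μ.prod stdG).map (fun q => (q.1 + τ * q.2, q.1))

/-- Law of the design matrix: i.i.d. N(0, 1/n) entries. -/
def PX (n N : ℕ) : Measure (Fin n → Fin N → ℝ) :=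
  Measure.pi fun _ => Measure.pi fun _ => gaussianReal 0 ((n : ℝ≥0))⁻¹

/-- Law of the noise: i.i.d. standard Gaussian entries. -/
def Pz (n : ℕ) : Measure (Fin n → ℝ) :=
  Measure.pi fun _ => gaussianReal 0 1

/-- Joint law of (X, z). -/
def Pmodel (n N : ℕ) : Measure ((Fin n → Fin N → ℝ) × (Fin n → ℝ)) :=
  (PX n N).prod (Pz n)

/-- The response y = Xθ⋆ + σz. -/
def yvec {n N : ℕ} (σ : ℝ) (θstar : Fin N → ℝ) (X : Fin n → Fin N → ℝ)
    (z : Fin n → ℝ) : Fin n → ℝ :=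
  fun i => (∑ j, X i j * θstar j) + σ * z i

/-- The Lasso cost (1/(2n))‖y − Xθ‖² + (λ/n)‖θ‖₁. -/
def lassoCost {n N : ℕ} (X : Fin n → Fin N → ℝ) (y : Fin n → ℝ) (lam : ℝ)
    (θ : Fin N → ℝ) : ℝ :=
  (1 / (2 * (n : ℝ))) * ∑ i, (y i - ∑ j, X i j * θ j) ^ 2
    + (lam / (n : ℝ)) * ∑ j, |θ j|

/-- The uniformity class: D is either an ℓ_p ball F_p(ξ) or an ℓ₀ ball F_0(s) with
s below the critical sparsity, with the corresponding exponent q. -/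
def DFamSpec (δ : ℝ) (Dfam : (M : ℕ) → Set (Fin M → ℝ)) (q : ℝ) : Prop :=
  (∃ p ξ : ℝ, 0 < p ∧ 0 < ξ ∧ (∀ M, Dfam M = Fball M p ξ) ∧ q = max (1 / p - 1) 0) ∨
  (∃ s : ℝ, 0 ≤ s ∧ s < smax δ ∧ (∀ M, Dfam M = F0ball M s) ∧ q = 0)

/-- The standard Gaussian measure on `ι → ℝ`. -/
def stdPi (ι : Type*) [Fintype ι] : Measure (ι → ℝ) := Measure.pi fun _ => gaussianReal 0 1

instance (ι : Type*) [Fintype ι] : IsProbabilityMeasure (stdPi ι) := by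
  unfold stdPi; infer_instance

lemma measurePreserving_update_stdPi {ι : Type*} [Fintype ι] [DecidableEq ι] (i : ι) :
    MeasurePreserving (fun p : (ι → ℝ) × ℝ => Function.update p.1 i p.2)
      ((stdPi ι).prod (gaussianReal 0 1)) (stdPi ι) := by
  have hm : Measurable (fun p : (ι → ℝ) × ℝ => Function.update p.1 i p.2) := by
    rw [measurable_pi_iff]
    intro j
    by_cases h : j = i
    · subst h; simpa using measurable_snd
    · simp only [Function.update_of_ne h]
      exact (measurable_pi_apply j).comp measurable_fst
  refine ⟨hm, ?_⟩
  symm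
  refine Measure.pi_eq fun s hs => ?_
  rw [Measure.map_apply hm (MeasurableSet.univ_pi hs)]
  have : (fun p : (ι → ℝ) × ℝ => Function.update p.1 i p.2) ⁻¹' (Set.pi Set.univ s)
      = (Set.pi Set.univ (Function.update s i Set.univ)) ×ˢ (s i) := by
    ext ⟨x, t⟩
    simp only [Set.mem_preimage, Set.mem_pi, Set.mem_univ, Set.mem_prod]
    constructor
    · intro h
      refine ⟨fun j => ?_, by simpa using h i⟩
      by_cases hj : j = i
      · subst hj; simp
      · simpa [Function.update_of_ne hj] using h j
    · rintro ⟨h1, h2⟩ j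
      by_cases hj : j = i
      · subst hj; simpa using h2
      · simpa [Function.update_of_ne hj] using h1 j
  rw [this, Measure.prod_prod, stdPi, Measure.pi_pi, ← Finset.prod_erase_mul _ _ (Finset.mem_univ i),
    ← Finset.prod_erase_mul _ (fun j => gaussianReal 0 1 (s j)) (Finset.mem_univ i)]
  simp only [Function.update_self, measure_univ, mul_one]
  congr 1
  refine Finset.prod_congr rfl fun j hj => ?_
  rw [Function.update_of_ne (Finset.ne_of_mem_erase hj)]

lemma integrable_id_gaussian : Integrable (fun x : ℝ => x) (gaussianReal 0 1) :=
  (memLp_id_gaussianReal 1).integrable le_rfl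

lemma integrable_sq_gaussian : Integrable (fun x : ℝ => x ^ 2) (gaussianReal 0 1) :=
  (memLp_id_gaussianReal 2).integrable_sq

lemma gaussianPDFReal_std (x : ℝ) :
    gaussianPDFReal 0 1 x = (√(2 * Real.pi))⁻¹ * Real.exp (-x ^ 2 / 2) := by
  simp [gaussianPDFReal]

lemma hasDerivAt_gaussianPDFReal (x : ℝ) :
    HasDerivAt (gaussianPDFReal 0 1) (-x * gaussianPDFReal 0 1 x) x := by
  have h : HasDerivAt (fun x : ℝ => (√(2 * Real.pi))⁻¹ * Real.exp (-x ^ 2 / 2))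
      ((√(2 * Real.pi))⁻¹ * (Real.exp (-x ^ 2 / 2) * (-(2 * x) / 2))) x := by
    have h1 : HasDerivAt (fun x : ℝ => -x ^ 2 / 2) (-(2 * x) / 2) x := by
      have := ((hasDerivAt_pow 2 x).neg.div_const 2)
      simpa using this
    exact (h1.exp).const_mul _
  have e : gaussianPDFReal 0 1 = fun x : ℝ => (√(2 * Real.pi))⁻¹ * Real.exp (-x ^ 2 / 2) :=
    funext gaussianPDFReal_std
  rw [e]
  convert h using 1
  ring

lemma integrable_gaussian_iff (f : ℝ → ℝ) :
    Integrable f (gaussianReal 0 1) ↔ Integrable (fun x => gaussianPDFReal 0 1 x * f x) := by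
  rw [gaussianReal_of_var_ne_zero _ one_ne_zero,
    integrable_withDensity_iff_integrable_smul' (measurable_gaussianPDF 0 1)
      (by simp [gaussianPDF_lt_top])]
  simp [toReal_gaussianPDF]

lemma integral_gaussian_eq (f : ℝ → ℝ) :
    ∫ x, f x ∂(gaussianReal 0 1) = ∫ x, gaussianPDFReal 0 1 x * f x := by
  rw [integral_gaussianReal_eq_integral_smul one_ne_zero]; simp

lemma integrable_of_bounded {α : Type*} [MeasurableSpace α] {μ : Measure α} [IsFiniteMeasure μ]
    {f : α → ℝ} (hf : AEStronglyMeasurable f μ) {C : ℝ} (hC : ∀ x, |f x| ≤ C) : Integrable f μ :=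
  Integrable.of_bound hf C (Filter.Eventually.of_forall hC)

lemma integral_comp_measurePreserving {α β : Type*} [MeasurableSpace α] [MeasurableSpace β]
    {μ : Measure α} {ν : Measure β} {f : α → β} (hf : MeasurePreserving f μ ν) {g : β → ℝ}
    (hg : AEStronglyMeasurable g ν) : ∫ x, g (f x) ∂μ = ∫ y, g y ∂ν := by
  have h := integral_map (μ := μ) hf.measurable.aemeasurable (f := g) (by rwa [hf.map_eq])
  rw [← h, hf.map_eq]

/-- One-dimensional Gaussian integration by parts. -/
lemma gaussian_ibp {f f' : ℝ → ℝ} (hd : ∀ x, HasDerivAt f (f' x) x) (hf' : Measurable f')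
    {C : ℝ} (hC : ∀ x, |f x| ≤ C) (hC' : ∀ x, |f' x| ≤ C) :
    ∫ x, x * f x ∂(gaussianReal 0 1) = ∫ x, f' x ∂(gaussianReal 0 1) := by
  have hfc : Continuous f := continuous_iff_continuousAt.2 fun x => (hd x).continuousAt
  have i0 : Integrable f (gaussianReal 0 1) := integrable_of_bounded hfc.aestronglyMeasurable hC
  have i1 : Integrable f' (gaussianReal 0 1) := integrable_of_bounded hf'.aestronglyMeasurable hC'
  have i2 : Integrable (fun x => x * f x) (gaussianReal 0 1) :=
    integrable_id_gaussian.mul_bdd hfc.aestronglyMeasurable (Filter.Eventually.of_forall hC)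
  rw [integrable_gaussian_iff] at i0 i1 i2
  rw [integral_gaussian_eq, integral_gaussian_eq]
  have := integral_mul_deriv_eq_deriv_mul_of_integrable (u := gaussianPDFReal 0 1) (v := f)
    (u' := fun x => -x * gaussianPDFReal 0 1 x) (v' := f')
    (fun x _ => hasDerivAt_gaussianPDFReal x) (fun x _ => hd x) i1
    (by convert i2.neg using 1; ext x; simp; ring) i0
  rw [this, ← integral_neg]
  congr 1; ext x; ring

/-- Gaussian integration by parts in one coordinate of a product. -/
lemma stdPi_ibp {ι : Type*} [Fintype ι] [DecidableEq ι] (i : ι) {H H' : (ι → ℝ) → ℝ}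
    (hd : ∀ x, HasDerivAt (fun s => H (Function.update x i s)) (H' x) (x i))
    (hH : Measurable H) (hH' : Measurable H')
    {C : ℝ} (hC : ∀ x, |H x| ≤ C) (hC' : ∀ x, |H' x| ≤ C) :
    ∫ x, x i * H x ∂(stdPi ι) = ∫ x, H' x ∂(stdPi ι) := by
  have mp := measurePreserving_update_stdPi i
  have h1 : Integrable (fun x : ι → ℝ => x i) (stdPi ι) :=
    (measurePreserving_eval (fun _ : ι => gaussianReal 0 1) i).integrable_comp_of_integrable
      integrable_id_gaussian
  have h2 : Integrable (fun x : ι → ℝ => x i * H x) (stdPi ι) :=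
    h1.mul_bdd hH.aestronglyMeasurable (Filter.Eventually.of_forall hC)
  have h3 : Integrable H' (stdPi ι) := integrable_of_bounded hH'.aestronglyMeasurable hC'
  have e1 : ∫ x, x i * H x ∂(stdPi ι) = ∫ p : (ι → ℝ) × ℝ, (p.2 * H (Function.update p.1 i p.2))
      ∂((stdPi ι).prod (gaussianReal 0 1)) := by
    rw [← integral_comp_measurePreserving mp h2.aestronglyMeasurable]
    simp
  have e2 : ∫ x, H' x ∂(stdPi ι) = ∫ p : (ι → ℝ) × ℝ, (H' (Function.update p.1 i p.2))
      ∂((stdPi ι).prod (gaussianReal 0 1)) :=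
    (integral_comp_measurePreserving mp h3.aestronglyMeasurable).symm
  have j2 := mp.integrable_comp_of_integrable h2
  have j3 := mp.integrable_comp_of_integrable h3
  simp only [Function.comp_def, Function.update_self] at j2 j3
  rw [e1, e2, integral_prod _ j2, integral_prod _ j3]
  congr 1
  ext x
  refine gaussian_ibp (C := C) (fun s => ?_) ?_ (fun _ => hC _) (fun _ => hC' _)
  · simpa using hd (Function.update x i s)
  · exact hH'.comp (measurable_update x)

lemma integrable_coord {ι : Type*} [Fintype ι] (i : ι) :
    Integrable (fun x : ι → ℝ => x i) (stdPi ι) :=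
  (measurePreserving_eval (fun _ : ι => gaussianReal 0 1) i).integrable_comp_of_integrable
      integrable_id_gaussian

/-- The linear map with rows `C k`. -/
def linApp {K ι : Type*} [Fintype ι] (C : K → ι → ℝ) (x : ι → ℝ) : K → ℝ :=
  fun k => ∑ i, C k i * x i

/-- The linear form with coefficients `v`. -/
def gradForm {K : Type*} [Fintype K] (v : K → ℝ) : (K → ℝ) →L[ℝ] ℝ :=
  ∑ k, v k • ContinuousLinearMap.proj (R := ℝ) (φ := fun _ : K => ℝ) k

lemma gradForm_apply {K : Type*} [Fintype K] (v y : K → ℝ) : gradForm v y = ∑ k, v k * y k := by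
  simp [gradForm]

lemma continuous_linApp {K ι : Type*} [Fintype ι] (C : K → ι → ℝ) : Continuous (linApp C) := by
  unfold linApp; fun_prop

lemma linear_ibp {K ι : Type*} [Fintype K] [Fintype ι] [DecidableEq ι]
    (C : K → ι → ℝ) (v : ι → ℝ) {φ : (K → ℝ) → ℝ} {φ' : K → (K → ℝ) → ℝ}
    (hφ : ∀ y, HasFDerivAt φ (gradForm fun k => φ' k y) y) (hc : ∀ k, Continuous (φ' k))
    {B : ℝ} (hB : ∀ y, |φ y| ≤ B) (hB' : ∀ k y, |φ' k y| ≤ B) :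
    ∫ x, (∑ i, v i * x i) * φ (linApp C x) ∂(stdPi ι)
      = ∑ k, (∑ i, v i * C k i) * ∫ x, φ' k (linApp C x) ∂(stdPi ι) := by
  have hφc : Continuous φ := continuous_iff_continuousAt.2 fun y => (hφ y).continuousAt
  have cl := continuous_linApp C
  have hint : ∀ k, Integrable (fun x => φ' k (linApp C x)) (stdPi ι) := fun k =>
    integrable_of_bounded ((hc k).comp cl).aestronglyMeasurable (fun x => hB' k _)
  have key : ∀ i, ∫ x, x i * φ (linApp C x) ∂(stdPi ι)
      = ∑ k, C k i * ∫ x, φ' k (linApp C x) ∂(stdPi ι) := by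
    intro i
    have := stdPi_ibp i (H := fun x => φ (linApp C x))
      (H' := fun x => ∑ k, C k i * φ' k (linApp C x)) (C := max B (∑ k, |C k i| * B)) ?_
      (hφc.comp cl).measurable
      (continuous_finsetSum _ fun k _ => continuous_const.mul ((hc k).comp cl)).measurable
      (fun x => (hB _).trans (le_max_left _ _))
      (fun x => le_trans ?_ (le_max_right _ _))
    · rw [this, integral_finsetSum _ fun k _ => (hint k).const_mul _]
      exact Finset.sum_congr rfl fun k _ => integral_const_mul _ _
    · intro x
      have h1 : HasDerivAt (fun s => linApp C (Function.update x i s)) (fun k => C k i) (x i) := by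
        rw [hasDerivAt_pi]
        intro k
        have e : (fun s => linApp C (Function.update x i s) k)
            = fun s => C k i * s + ∑ j ∈ Finset.univ.erase i, C k j * x j := by
          ext s
          rw [linApp, ← Finset.add_sum_erase _ _ (Finset.mem_univ i), Function.update_self]
          congr 1
          exact Finset.sum_congr rfl fun j hj => by
            rw [Function.update_of_ne (Finset.ne_of_mem_erase hj)]
        rw [e]
        simpa using ((hasDerivAt_id (x i)).const_mul (C k i)).add_const (∑ j ∈ Finset.univ.erase i, C k j * x j)
      have h2 := hφ (linApp C (Function.update x i (x i)))
      have h3 := h2.comp_hasDerivAt (x i) h1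
      simp only [Function.update_eq_self, gradForm_apply] at h3
      exact h3.congr_deriv (Finset.sum_congr rfl fun k _ => mul_comm _ _)
    · refine (Finset.abs_sum_le_sum_abs _ _).trans (Finset.sum_le_sum fun k _ => ?_)
      rw [abs_mul]
      exact mul_le_mul_of_nonneg_left (hB' k _) (abs_nonneg _)
  have hi : ∀ i, Integrable (fun x : ι → ℝ => x i * φ (linApp C x)) (stdPi ι) := fun i =>
    (integrable_coord i).mul_bdd (hφc.comp cl).aestronglyMeasurable
      (Filter.Eventually.of_forall fun x => hB _)
  calc ∫ x, (∑ i, v i * x i) * φ (linApp C x) ∂(stdPi ι)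
      = ∫ x, ∑ i, v i * (x i * φ (linApp C x)) ∂(stdPi ι) := by
        congr 1; ext x; rw [Finset.sum_mul]; exact Finset.sum_congr rfl fun i _ => by ring
    _ = ∑ i, v i * ∑ k, C k i * ∫ x, φ' k (linApp C x) ∂(stdPi ι) := by
        rw [integral_finsetSum _ fun i _ => (hi i).const_mul _]
        exact Finset.sum_congr rfl fun i _ => by rw [integral_const_mul, key]
    _ = _ := by
        simp_rw [Finset.mul_sum, Finset.sum_mul]
        rw [Finset.sum_comm]
        exact Finset.sum_congr rfl fun k _ => Finset.sum_congr rfl fun i _ => by ring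

/-- Gaussian interpolation: comparison of the expectations of a smooth function of two Gaussian
vectors in terms of their covariances. -/
lemma gaussian_comparison {K ι : Type*} [Fintype K] [Fintype ι] [DecidableEq ι]
    (a b : K → ι → ℝ) {f : (K → ℝ) → ℝ} {f1 : K → (K → ℝ) → ℝ} {f2 : K → K → (K → ℝ) → ℝ}
    (hf : ∀ y, HasFDerivAt f (gradForm fun k => f1 k y) y)
    (hf1 : ∀ k y, HasFDerivAt (f1 k) (gradForm fun l => f2 k l y) y)
    (hc : ∀ k l, Continuous (f2 k l))
    {B : ℝ} (hB : ∀ y, |f y| ≤ B) (hB1 : ∀ k y, |f1 k y| ≤ B) (hB2 : ∀ k l y, |f2 k l y| ≤ B)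
    (hab : ∀ k l, ∑ i, a k i * b l i = 0)
    (hcov : ∀ k l y, ((∑ i, b k i * b l i) - ∑ i, a k i * a l i) * f2 k l y ≤ 0) :
    ∫ x, f (linApp b x) ∂(stdPi ι) ≤ ∫ x, f (linApp a x) ∂(stdPi ι) := by
  have hfc : Continuous f := continuous_iff_continuousAt.2 fun y => (hf y).continuousAt
  have hf1c : ∀ k, Continuous (f1 k) :=
    fun k => continuous_iff_continuousAt.2 fun y => (hf1 k y).continuousAt
  set c : ℝ → K → ι → ℝ := fun t k i => Real.cos t * a k i + Real.sin t * b k i with hcdef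
  set c' : ℝ → K → ι → ℝ := fun t k i => -Real.sin t * a k i + Real.cos t * b k i with hcdef'
  have hB0 : 0 ≤ B := (abs_nonneg _).trans (hB 0)
  set F : ℝ → ℝ := fun t => ∫ x, f (linApp (c t) x) ∂(stdPi ι) with hF
  have hder : ∀ t, HasDerivAt F
      (∫ x, (∑ k, (∑ i, c' t k i * x i) * f1 k (linApp (c t) x)) ∂(stdPi ι)) t := by
    intro t
    refine (hasDerivAt_integral_of_dominated_loc_of_deriv_le (𝕜 := ℝ) (s := Set.univ)
      (F := fun t x => f (linApp (c t) x)) (μ := stdPi ι)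
      (F' := fun t x => ∑ k, (∑ i, c' t k i * x i) * f1 k (linApp (c t) x))
      (bound := fun x => ∑ k, (∑ i, (|a k i| + |b k i|) * |x i|) * B) Filter.univ_mem
      (Filter.Eventually.of_forall fun t =>
        (hfc.comp (continuous_linApp _)).aestronglyMeasurable) ?_ ?_ ?_ ?_ ?_).2
    · exact integrable_of_bounded (hfc.comp (continuous_linApp _)).aestronglyMeasurable
        fun x => hB _
    · refine Continuous.aestronglyMeasurable ?_
      refine continuous_finsetSum _ fun k _ => Continuous.mul (by fun_prop) ?_
      exact (hf1c k).comp (continuous_linApp _)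
    · refine Filter.Eventually.of_forall fun x s _ => ?_
      rw [Real.norm_eq_abs]
      refine (Finset.abs_sum_le_sum_abs _ _).trans (Finset.sum_le_sum fun k _ => ?_)
      rw [abs_mul]
      refine mul_le_mul ?_ (hB1 k _) (abs_nonneg _) (Finset.sum_nonneg fun i _ => by positivity)
      refine (Finset.abs_sum_le_sum_abs _ _).trans (Finset.sum_le_sum fun i _ => ?_)
      rw [abs_mul]
      refine mul_le_mul_of_nonneg_right ?_ (abs_nonneg _)
      refine (abs_add_le _ _).trans (add_le_add ?_ ?_)
      · rw [abs_mul, abs_neg]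
        exact mul_le_of_le_one_left (abs_nonneg _) (Real.abs_sin_le_one s)
      · rw [abs_mul]
        exact mul_le_of_le_one_left (abs_nonneg _) (Real.abs_cos_le_one s)
    · refine integrable_finsetSum _ fun k _ => Integrable.mul_const ?_ _
      exact integrable_finsetSum _ fun i _ => (integrable_coord i).abs.const_mul _
    · refine Filter.Eventually.of_forall fun x s _ => ?_
      have h1 : HasDerivAt (fun s => linApp (c s) x) (fun k => ∑ i, c' s k i * x i) s := by
        rw [hasDerivAt_pi]
        intro k
        refine HasDerivAt.fun_sum fun i _ => HasDerivAt.mul_const ?_ _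
        exact ((Real.hasDerivAt_cos s).mul_const _).add ((Real.hasDerivAt_sin s).mul_const _)
      have h3 := (hf (linApp (c s) x)).comp_hasDerivAt s h1
      rw [gradForm_apply] at h3
      exact h3.congr_deriv (Finset.sum_congr rfl fun k _ => mul_comm _ _)
  have hval : ∀ t, (∫ x, (∑ k, (∑ i, c' t k i * x i) * f1 k (linApp (c t) x)) ∂(stdPi ι))
      = Real.sin t * Real.cos t * ∫ x, (∑ k, ∑ l, ((∑ i, b k i * b l i) - ∑ i, a k i * a l i)
          * f2 k l (linApp (c t) x)) ∂(stdPi ι) := by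
    intro t
    have hi2 : ∀ k l, Integrable (fun x => f2 k l (linApp (c t) x)) (stdPi ι) := fun k l =>
      integrable_of_bounded ((hc k l).comp (continuous_linApp _)).aestronglyMeasurable
        (fun x => hB2 k l _)
    rw [integral_finsetSum, integral_finsetSum, Finset.mul_sum]
    · refine Finset.sum_congr rfl fun k _ => ?_
      rw [linear_ibp (c t) (c' t k) (hf1 k) (hc k) (hB1 k) (hB2 k), integral_finsetSum,
        Finset.mul_sum]
      · refine Finset.sum_congr rfl fun l _ => ?_
        rw [integral_const_mul, ← mul_assoc]
        congr 1
        have e : ∀ i, c' t k i * c t l i = Real.sin t * Real.cos t * (b k i * b l i)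
            - Real.sin t * Real.cos t * (a k i * a l i) - Real.sin t ^ 2 * (a k i * b l i)
            + Real.cos t ^ 2 * (a l i * b k i) := fun i => by simp only [hcdef, hcdef']; ring
        simp_rw [e]
        rw [Finset.sum_add_distrib, Finset.sum_sub_distrib, Finset.sum_sub_distrib,
          ← Finset.mul_sum, ← Finset.mul_sum, ← Finset.mul_sum, ← Finset.mul_sum, hab, hab]
        ring
      · exact fun l _ => (hi2 k l).const_mul _
    · exact fun k _ => integrable_finsetSum _ fun l _ => (hi2 k l).const_mul _
    · intro k _
      refine Integrable.mul_bdd (c := B) ?_ ((hf1c k).comp (continuous_linApp _)).aestronglyMeasurable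
        (Filter.Eventually.of_forall fun x => hB1 k _)
      exact integrable_finsetSum _ fun i _ => (integrable_coord i).const_mul _
  have hanti : AntitoneOn F (Set.Icc 0 (Real.pi / 2)) := by
    refine antitoneOn_of_deriv_nonpos (convex_Icc _ _)
      (fun t _ => (hder t).continuousAt.continuousWithinAt)
      (fun t _ => (hder t).differentiableAt.differentiableWithinAt) fun t ht => ?_
    rw [(hder t).deriv, hval]
    rw [interior_Icc] at ht
    refine mul_nonpos_of_nonneg_of_nonpos (mul_nonneg ?_ ?_) ?_
    · exact Real.sin_nonneg_of_nonneg_of_le_pi ht.1.le (by linarith [ht.2, Real.pi_pos])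
    · exact Real.cos_nonneg_of_neg_pi_div_two_le_of_le (by linarith [ht.1, Real.pi_pos]) ht.2.le
    · exact integral_nonpos fun x => Finset.sum_nonpos fun k _ => Finset.sum_nonpos fun l _ =>
        hcov k l _
  have h := hanti (Set.left_mem_Icc.2 (by positivity)) (Set.right_mem_Icc.2 (by positivity))
    (by positivity : (0 : ℝ) ≤ Real.pi / 2)
  have e0 : c 0 = a := by ext k i; simp [hcdef]
  have e1 : c (Real.pi / 2) = b := by ext k i; simp [hcdef]
  simpa only [hF, e0, e1] using h

/-- `f` is twice continuously differentiable with gradient `f1` and Hessian `f2`, all bounded. -/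
structure SmoothBdd {K : Type*} [Fintype K] (f : (K → ℝ) → ℝ) (f1 : K → (K → ℝ) → ℝ)
    (f2 : K → K → (K → ℝ) → ℝ) : Prop where
  hf : ∀ y, HasFDerivAt f (gradForm fun k => f1 k y) y
  hf1 : ∀ k y, HasFDerivAt (f1 k) (gradForm fun l => f2 k l y) y
  hc : ∀ k l, Continuous (f2 k l)
  hB : ∃ B : ℝ, 0 ≤ B ∧ (∀ y, |f y| ≤ B) ∧ (∀ k y, |f1 k y| ≤ B) ∧ ∀ k l y, |f2 k l y| ≤ B

lemma gradForm_smul_add {K : Type*} [Fintype K] (a b : ℝ) (v w : K → ℝ) :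
    a • gradForm v + b • gradForm w = gradForm fun k => a * v k + b * w k := by
  ext y
  simp [gradForm_apply, Finset.mul_sum, ← Finset.sum_add_distrib, add_mul, mul_assoc]

lemma SmoothBdd.mul {K : Type*} [Fintype K] {f g : (K → ℝ) → ℝ} {f1 g1 : K → (K → ℝ) → ℝ}
    {f2 g2 : K → K → (K → ℝ) → ℝ} (F : SmoothBdd f f1 f2) (G : SmoothBdd g g1 g2) :
    SmoothBdd (fun y => f y * g y) (fun k y => f y * g1 k y + g y * f1 k y)
      (fun k l y => (f y * g2 k l y + g1 k y * f1 l y) + (g y * f2 k l y + f1 k y * g1 l y)) := by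
  have cf : Continuous f := continuous_iff_continuousAt.2 fun y => (F.hf y).continuousAt
  have cg : Continuous g := continuous_iff_continuousAt.2 fun y => (G.hf y).continuousAt
  have cf1 : ∀ k, Continuous (f1 k) :=
    fun k => continuous_iff_continuousAt.2 fun y => (F.hf1 k y).continuousAt
  have cg1 : ∀ k, Continuous (g1 k) :=
    fun k => continuous_iff_continuousAt.2 fun y => (G.hf1 k y).continuousAt
  have cf2 := F.hc
  have cg2 := G.hc
  refine ⟨fun y => ?_, fun k y => ?_, fun k l => ?_, ?_⟩
  · rw [← gradForm_smul_add]
    exact (F.hf y).mul (G.hf y)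
  · have h1 := (F.hf y).mul (G.hf1 k y)
    have h2 := (G.hf y).mul (F.hf1 k y)
    rw [gradForm_smul_add] at h1 h2
    have h3 := h1.add h2
    have e := gradForm_smul_add 1 1 (fun l => f y * g2 k l y + g1 k y * f1 l y)
      (fun l => g y * f2 k l y + f1 k y * g1 l y)
    simp only [one_smul, one_mul] at e
    rw [e] at h3
    exact h3
  · fun_prop
  · obtain ⟨B, b0, b1, b2, b3⟩ := F.hB
    obtain ⟨D, d0, d1, d2, d3⟩ := G.hB
    have key : ∀ a b : ℝ, |a| ≤ B → |b| ≤ D → |a * b| ≤ B * D := fun a b ha hb => by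
      rw [abs_mul]; exact mul_le_mul ha hb (abs_nonneg _) b0
    have key' : ∀ a b : ℝ, |a| ≤ D → |b| ≤ B → |a * b| ≤ B * D := fun a b ha hb => by
      rw [mul_comm]; exact key _ _ hb ha
    have h0 : 0 ≤ B * D := mul_nonneg b0 d0
    refine ⟨4 * (B * D), by positivity, fun y => ?_, fun k y => ?_, fun k l y => ?_⟩
    · linarith [key _ _ (b1 y) (d1 y)]
    · linarith [abs_add_le (f y * g1 k y) (g y * f1 k y), key _ _ (b1 y) (d2 k y),
        key' _ _ (d1 y) (b2 k y)]
    · linarith [abs_add_le (f y * g2 k l y + g1 k y * f1 l y) (g y * f2 k l y + f1 k y * g1 l y),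
        abs_add_le (f y * g2 k l y) (g1 k y * f1 l y),
        abs_add_le (g y * f2 k l y) (f1 k y * g1 l y), key _ _ (b1 y) (d3 k l y),
        key' _ _ (d2 k y) (b2 l y), key' _ _ (d1 y) (b3 k l y), key _ _ (b2 k y) (d2 l y)]

lemma SmoothBdd.const {K : Type*} [Fintype K] (c : ℝ) :
    SmoothBdd (K := K) (fun _ => c) (fun _ _ => 0) (fun _ _ _ => 0) := by
  have e : gradForm (fun _ : K => (0 : ℝ)) = 0 := by ext; simp [gradForm_apply]
  refine ⟨fun y => ?_, fun k y => ?_, fun _ _ => continuous_const, |c|, abs_nonneg _, ?_⟩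
  · rw [e]; exact hasFDerivAt_const _ _
  · rw [e]; exact hasFDerivAt_const _ _
  · simp

lemma SmoothBdd.one_sub {K : Type*} [Fintype K] {f : (K → ℝ) → ℝ} {f1 : K → (K → ℝ) → ℝ}
    {f2 : K → K → (K → ℝ) → ℝ} (F : SmoothBdd f f1 f2) :
    SmoothBdd (fun y => 1 - f y) (fun k y => -f1 k y) (fun k l y => -f2 k l y) := by
  have e : ∀ v : K → ℝ, gradForm (fun k => -v k) = -gradForm v := fun v => by
    ext; simp [gradForm_apply]
  refine ⟨fun y => ?_, fun k y => ?_, fun k l => (F.hc k l).neg, ?_⟩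
  · rw [e]; exact (F.hf y).const_sub 1
  · rw [e]; exact (F.hf1 k y).neg
  · obtain ⟨B, b0, b1, b2, b3⟩ := F.hB
    refine ⟨1 + B, by positivity, fun y => ?_, fun k y => ?_, fun k l y => ?_⟩
    · refine (abs_sub _ _).trans ?_
      simpa using b1 y
    · rw [abs_neg]; linarith [b2 k y]
    · rw [abs_neg]; linarith [b3 k l y]

lemma exists_smooth_step : ∃ q q1 q2 : ℝ → ℝ, (∀ x, HasDerivAt q (q1 x) x) ∧
    (∀ x, HasDerivAt q1 (q2 x) x) ∧ Continuous q2 ∧ (∀ x, q1 x ≤ 0) ∧ (∀ x, 0 ≤ q x) ∧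
    (∀ x, q x ≤ 1) ∧ (∀ x ≤ 0, q x = 1) ∧ (∀ x ≥ 1, q x = 0) ∧
    ∃ B, 0 ≤ B ∧ (∀ x, |q1 x| ≤ B) ∧ ∀ x, |q2 x| ≤ B := by
  have h2 : ContDiff ℝ 2 Real.smoothTransition := by
    exact_mod_cast Real.smoothTransition.contDiff (n := 2)
  have d1 : ∀ x, HasDerivAt Real.smoothTransition (deriv Real.smoothTransition x) x :=
    fun x => (h2.differentiable (by norm_num) x).hasDerivAt
  have h3 : ContDiff ℝ 1 (deriv Real.smoothTransition) := by
    have : ContDiff ℝ (1 + 1) Real.smoothTransition := by norm_num; exact h2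
    exact (contDiff_succ_iff_deriv.1 this).2.2
  have d2 : ∀ x, HasDerivAt (deriv Real.smoothTransition) (deriv (deriv Real.smoothTransition) x) x :=
    fun x => (h3.differentiable (by norm_num) x).hasDerivAt
  have c1 : Continuous (deriv Real.smoothTransition) := h3.continuous
  have c2 : Continuous (deriv (deriv Real.smoothTransition)) := h3.continuous_deriv le_rfl
  have z1 : ∀ x ∉ Set.Icc (0:ℝ) 1, deriv Real.smoothTransition =ᶠ[nhds x] fun _ => 0 := by
    intro x hx
    rw [Set.mem_Icc, not_and_or, not_le, not_le] at hx
    rcases hx with hx | hx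
    · filter_upwards [eventually_lt_nhds hx] with y hy
      have : Real.smoothTransition =ᶠ[nhds y] fun _ => 0 := by
        filter_upwards [eventually_lt_nhds hy] with z hz
        exact Real.smoothTransition.zero_of_nonpos hz.le
      rw [this.deriv_eq]; simp
    · filter_upwards [eventually_gt_nhds hx] with y hy
      have : Real.smoothTransition =ᶠ[nhds y] fun _ => 1 := by
        filter_upwards [eventually_gt_nhds hy] with z hz
        exact Real.smoothTransition.one_of_one_le hz.le
      rw [this.deriv_eq]; simp
  obtain ⟨B1, hB1⟩ := (isCompact_Icc (a := (0:ℝ)) (b := 1)).exists_bound_of_continuousOn c1.continuousOn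
  obtain ⟨B2, hB2⟩ := (isCompact_Icc (a := (0:ℝ)) (b := 1)).exists_bound_of_continuousOn c2.continuousOn
  refine ⟨fun x => 1 - Real.smoothTransition x, fun x => -deriv Real.smoothTransition x,
    fun x => -deriv (deriv Real.smoothTransition) x, fun x => (d1 x).const_sub 1,
    fun x => (d2 x).neg, c2.neg, fun x => ?_, fun x => ?_, fun x => ?_, fun x hx => ?_,
    fun x hx => ?_, max 0 (max B1 B2), le_max_left _ _, fun x => ?_, fun x => ?_⟩
  · exact neg_nonpos.2 (Real.smoothTransition.monotone.deriv_nonneg)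
  · linarith [Real.smoothTransition.le_one x]
  · linarith [Real.smoothTransition.nonneg x]
  · simp [Real.smoothTransition.zero_of_nonpos hx]
  · simp [Real.smoothTransition.one_of_one_le hx]
  · by_cases h : x ∈ Set.Icc (0:ℝ) 1
    · have := hB1 x h
      rw [Real.norm_eq_abs] at this
      rw [abs_neg]; simp [this]
    · simp [(z1 x h).eq_of_nhds]
  · by_cases h : x ∈ Set.Icc (0:ℝ) 1
    · have := hB2 x h
      rw [Real.norm_eq_abs] at this
      rw [abs_neg]; simp [this]
    · simp [(z1 x h).deriv_eq]

lemma gradForm_single {K : Type*} [Fintype K] [DecidableEq K] (k : K) (c : ℝ) :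
    gradForm (fun l => if l = k then c else 0)
      = c • ContinuousLinearMap.proj (R := ℝ) (φ := fun _ : K => ℝ) k := by
  ext y; simp [gradForm_apply]

/-- The composition of a coordinate with a scaled smooth step. -/
lemma SmoothBdd.coord {K : Type*} [Fintype K] [DecidableEq K] {q q1 q2 : ℝ → ℝ}
    (h1 : ∀ x, HasDerivAt q (q1 x) x) (h2 : ∀ x, HasDerivAt q1 (q2 x) x) (hc : Continuous q2)
    {B : ℝ} (hB0 : ∀ x, |q x| ≤ B) (hB1 : ∀ x, |q1 x| ≤ B) (hB2 : ∀ x, |q2 x| ≤ B)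
    (k : K) (m c : ℝ) :
    SmoothBdd (fun y : K → ℝ => q (m * (y k - c)))
      (fun l y => if l = k then m * q1 (m * (y k - c)) else 0)
      (fun l l' y => if l' = k then (if l = k then m * (m * q2 (m * (y k - c))) else 0) else 0) := by
  have hB : 0 ≤ B := (abs_nonneg _).trans (hB0 0)
  have hp : ∀ y : K → ℝ, HasFDerivAt (fun y : K → ℝ => m * (y k - c))
      (m • ContinuousLinearMap.proj (R := ℝ) (φ := fun _ : K => ℝ) k) y := fun y =>
    (((ContinuousLinearMap.proj (R := ℝ) (φ := fun _ : K => ℝ) k).hasFDerivAt).sub_const c).const_mul m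
  refine ⟨fun y => ?_, fun l y => ?_, fun l l' => ?_, ?_⟩
  · rw [gradForm_single]
    have := (h1 (m * (y k - c))).comp_hasFDerivAt y (hp y)
    rw [smul_smul, mul_comm] at this
    exact this
  · rw [gradForm_single]
    by_cases h : l = k
    · simp only [h, if_true]
      have := ((h2 (m * (y k - c))).comp_hasFDerivAt y (hp y)).const_mul m
      rw [smul_smul, smul_smul] at this
      rw [mul_assoc, mul_comm (q2 _) m] at this
      exact this
    · simp only [h, if_false, zero_smul]
      exact hasFDerivAt_const _ _
  · split_ifs <;> fun_prop
  · refine ⟨B + |m| * B + |m| * (|m| * B), by positivity, fun y => ?_, fun l y => ?_, fun l l' y => ?_⟩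
    · exact (hB0 _).trans (by nlinarith [abs_nonneg m, mul_nonneg (abs_nonneg m) hB, mul_nonneg (abs_nonneg m) (mul_nonneg (abs_nonneg m) hB)])
    · have : |m * q1 (m * (y k - c))| ≤ |m| * B := by
        rw [abs_mul]; exact mul_le_mul_of_nonneg_left (hB1 _) (abs_nonneg _)
      split_ifs
      · exact this.trans (by nlinarith [mul_nonneg (abs_nonneg m) (mul_nonneg (abs_nonneg m) hB)])
      · rw [abs_zero]; positivity
    · have : |m * (m * q2 (m * (y k - c)))| ≤ |m| * (|m| * B) := by
        rw [abs_mul, abs_mul]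
        exact mul_le_mul_of_nonneg_left (mul_le_mul_of_nonneg_left (hB2 _) (abs_nonneg _))
          (abs_nonneg _)
      split_ifs
      · exact this.trans (by nlinarith [mul_nonneg (abs_nonneg m) hB])
      · rw [abs_zero]; positivity
      · rw [abs_zero]; positivity

section rows
variable {I J : Type*} [Fintype I] [Fintype J] [DecidableEq I] [DecidableEq J]

lemma exists_smooth_row {q q1 q2 : ℝ → ℝ}
    (h1 : ∀ x, HasDerivAt q (q1 x) x) (h2 : ∀ x, HasDerivAt q1 (q2 x) x) (hc : Continuous q2)
    {B : ℝ} (hB1 : ∀ x, |q1 x| ≤ B) (hB2 : ∀ x, |q2 x| ≤ B)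
    (hq1 : ∀ x, q1 x ≤ 0) (hq : ∀ x, 0 ≤ q x) (hq' : ∀ x, q x ≤ 1)
    (m : ℝ) (hm : 0 ≤ m) (lam : I × J → ℝ) (i : I) (s : Finset J) :
    ∃ f1 f2, SmoothBdd (fun y : I × J → ℝ => ∏ j ∈ s, q (m * (y (i, j) - lam (i, j)))) f1 f2 ∧
      (∀ k y, f1 k y ≤ 0) ∧ (∀ k y, k.1 ≠ i → f1 k y = 0) ∧
      ∀ k l y, k.1 ≠ l.1 → f2 k l y = 0 := by
  induction s using Finset.induction_on with
  | empty => exact ⟨_, _, by simpa using SmoothBdd.const 1, by simp, by simp, by simp⟩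
  | insert j s hj ih =>
    obtain ⟨f1, f2, hS, p1, p2, p3⟩ := ih
    have hq0 : ∀ x, |q x| ≤ max 1 B := fun x => by
      rw [abs_of_nonneg (hq x)]; exact (hq' x).trans (le_max_left _ _)
    have hC := SmoothBdd.coord h1 h2 hc hq0 (fun x => (hB1 x).trans (le_max_right _ _))
      (fun x => (hB2 x).trans (le_max_right _ _)) (i, j) m (lam (i, j))
    have hM := hC.mul hS
    simp only [Finset.prod_insert hj]
    refine ⟨_, _, hM, fun k y => ?_, fun k y hk => ?_, fun k l y hkl => ?_⟩
    · have hP : 0 ≤ ∏ j ∈ s, q (m * (y (i, j) - lam (i, j))) :=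
        Finset.prod_nonneg fun j _ => hq _
      refine add_nonpos (mul_nonpos_of_nonneg_of_nonpos (hq _) (p1 _ _))
        (mul_nonpos_of_nonneg_of_nonpos hP ?_)
      split_ifs
      · exact mul_nonpos_of_nonneg_of_nonpos hm (hq1 _)
      · exact le_rfl
    · have : k ≠ (i, j) := fun h => hk (by rw [h])
      simp [this, p2 k y hk]
    · rw [p3 k l y hkl]
      have hz : ∀ a b : I × J, a.1 ≠ b.1 → f1 a y = 0 ∨ b ≠ (i, j) := by
        intro a b hab
        by_cases hb : b = (i, j)
        · left; refine p2 a y fun h => hab ?_; rw [h, hb]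
        · exact Or.inr hb
      have hz' : ¬ (l = (i, j) ∧ k = (i, j)) := fun h => hkl (by rw [h.1, h.2])
      rcases hz k l hkl with h | h <;> rcases hz l k hkl.symm with h' | h' <;> simp_all

/-- A smooth approximation of the indicator of `∀ i, ∃ j, lam (i, j) < y (i, j)` whose second
derivatives across rows are nonnegative. -/
lemma exists_smooth_minmax {q q1 q2 : ℝ → ℝ}
    (h1 : ∀ x, HasDerivAt q (q1 x) x) (h2 : ∀ x, HasDerivAt q1 (q2 x) x) (hc : Continuous q2)
    {B : ℝ} (hB1 : ∀ x, |q1 x| ≤ B) (hB2 : ∀ x, |q2 x| ≤ B)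
    (hq1 : ∀ x, q1 x ≤ 0) (hq : ∀ x, 0 ≤ q x) (hq' : ∀ x, q x ≤ 1)
    (m : ℝ) (hm : 0 ≤ m) (lam : I × J → ℝ) (t : Finset I) :
    ∃ f1 f2, SmoothBdd
      (fun y : I × J → ℝ => ∏ i ∈ t, (1 - ∏ j, q (m * (y (i, j) - lam (i, j))))) f1 f2 ∧
      (∀ k y, 0 ≤ f1 k y) ∧ ∀ k l y, k.1 ≠ l.1 → 0 ≤ f2 k l y := by
  have hle : ∀ (y : I × J → ℝ) i, 0 ≤ 1 - ∏ j, q (m * (y (i, j) - lam (i, j))) := fun y i =>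
    sub_nonneg.2 (Finset.prod_le_one (fun j _ => hq _) fun j _ => hq' _)
  induction t using Finset.induction_on with
  | empty => exact ⟨_, _, by simpa using SmoothBdd.const 1, by simp, by simp⟩
  | insert i t hi ih =>
    obtain ⟨f1, f2, hS, p1, p2⟩ := ih
    obtain ⟨g1, g2, hG, r1, r2, r3⟩ :=
      exists_smooth_row h1 h2 hc hB1 hB2 hq1 hq hq' m hm lam i Finset.univ
    have hM := hG.one_sub.mul hS
    simp only [Finset.prod_insert hi]
    have hP : ∀ y : I × J → ℝ, 0 ≤ ∏ i ∈ t, (1 - ∏ j, q (m * (y (i, j) - lam (i, j)))) :=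
      fun y => Finset.prod_nonneg fun i _ => hle y i
    refine ⟨_, _, hM, fun k y => ?_, fun k l y hkl => ?_⟩
    · exact add_nonneg (mul_nonneg (hle _ _) (p1 _ _))
        (mul_nonneg (hP y) (neg_nonneg.2 (r1 _ _)))
    · have a1 := mul_nonneg (hle y i) (p2 k l y hkl)
      have a2 := mul_nonneg (p1 k y) (neg_nonneg.2 (r1 l y))
      have a3 := mul_nonneg (neg_nonneg.2 (r1 k y)) (p1 l y)
      have a4 : -g2 k l y = 0 := by rw [r3 k l y hkl, neg_zero]
      rw [a4, mul_zero]
      linarith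

/-- Gordon's comparison inequality for finite families of Gaussian linear forms. -/
lemma gordon_finite {ι : Type*} [Fintype ι] [DecidableEq ι] (a b : I × J → ι → ℝ)
    (lam : I × J → ℝ) (hab : ∀ k l, ∑ i, a k i * b l i = 0)
    (hrow : ∀ i j j', ∑ r, b (i, j) r * b (i, j') r = ∑ r, a (i, j) r * a (i, j') r)
    (hcov : ∀ k l, ∑ r, b k r * b l r ≤ ∑ r, a k r * a l r) :
    (stdPi ι) {x | ∀ i, ∃ j, lam (i, j) < linApp b x (i, j)}
      ≤ (stdPi ι) {x | ∀ i, ∃ j, lam (i, j) < linApp a x (i, j)} := by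
  obtain ⟨q, q1, q2, h1, h2, hc, hq1, hq, hq', z1, z2, B, hB, hB1, hB2⟩ := exists_smooth_step
  have hqc : Continuous q := continuous_iff_continuousAt.2 fun y => (h1 y).continuousAt
  set f : ℕ → (I × J → ℝ) → ℝ :=
    fun m y => ∏ i, (1 - ∏ j, q ((m : ℝ) * (y (i, j) - lam (i, j)))) with hf
  have hfc : ∀ m, Continuous (f m) := fun m => by fun_prop
  have hle : ∀ (m : ℕ) (y : I × J → ℝ), 0 ≤ f m y ∧ f m y ≤ 1 := by
    intro m y
    have h0 : ∀ i, 0 ≤ ∏ j, q ((m : ℝ) * (y (i, j) - lam (i, j))) := fun i =>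
      Finset.prod_nonneg fun j _ => hq _
    have h0' : ∀ i, ∏ j, q ((m : ℝ) * (y (i, j) - lam (i, j))) ≤ 1 := fun i =>
      Finset.prod_le_one (fun j _ => hq _) fun j _ => hq' _
    exact ⟨Finset.prod_nonneg fun i _ => by linarith [h0' i],
      Finset.prod_le_one (fun i _ => by linarith [h0' i]) fun i _ => by linarith [h0 i]⟩
  have hcomp : ∀ m, ∫ x, f m (linApp b x) ∂(stdPi ι) ≤ ∫ x, f m (linApp a x) ∂(stdPi ι) := by
    intro m
    obtain ⟨f1, f2, hS, p1, p2⟩ := exists_smooth_minmax h1 h2 hc hB1 hB2 hq1 hq hq' m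
      (Nat.cast_nonneg m) lam Finset.univ
    obtain ⟨D, d0, d1, d2, d3⟩ := hS.hB
    refine gaussian_comparison a b hS.hf hS.hf1 hS.hc d1 d2 d3 hab fun k l y => ?_
    by_cases hkl : k.1 = l.1
    · obtain ⟨i, j⟩ := k
      obtain ⟨i', j'⟩ := l
      obtain rfl : i = i' := hkl
      rw [hrow, sub_self, zero_mul]
    · exact mul_nonpos_of_nonpos_of_nonneg (sub_nonpos.2 (hcov k l)) (p2 k l y hkl)
  have hlim : ∀ y : I × J → ℝ, Filter.Tendsto (fun m => f m y) Filter.atTop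
      (nhds (Set.indicator {y : I × J → ℝ | ∀ i, ∃ j, lam (i, j) < y (i, j)} (fun _ => (1:ℝ)) y)) := by
    intro y
    by_cases hy : ∀ i, ∃ j, lam (i, j) < y (i, j)
    · rw [Set.indicator_of_mem (by simpa using hy)]
      choose j hj using hy
      refine tendsto_const_nhds.congr' ?_
      have : ∀ᶠ m : ℕ in Filter.atTop, ∀ i, 1 ≤ (m : ℝ) * (y (i, j i) - lam (i, j i)) := by
        rw [Filter.eventually_all]
        intro i
        have : Filter.Tendsto (fun m : ℕ => (m : ℝ) * (y (i, j i) - lam (i, j i)))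
            Filter.atTop Filter.atTop :=
          tendsto_natCast_atTop_atTop.atTop_mul_const (sub_pos.2 (hj i))
        exact this.eventually_ge_atTop 1
      filter_upwards [this] with m hm
      symm
      refine Finset.prod_eq_one fun i _ => ?_
      rw [Finset.prod_eq_zero (Finset.mem_univ (j i)) (z2 _ (hm i)), sub_zero]
    · rw [Set.indicator_of_notMem (by simpa using hy)]
      push Not at hy
      obtain ⟨i, hi⟩ := hy
      refine tendsto_const_nhds.congr fun m => ?_
      symm
      refine Finset.prod_eq_zero (Finset.mem_univ i) ?_
      rw [Finset.prod_eq_one fun j _ => z1 _ ?_, sub_self]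
      exact mul_nonpos_of_nonneg_of_nonpos (Nat.cast_nonneg m) (sub_nonpos.2 (hi j))
  have hopen : IsOpen {y : I × J → ℝ | ∀ i, ∃ j, lam (i, j) < y (i, j)} := by
    simp only [Set.ofPred_forall, Set.ofPred_exists]
    exact isOpen_iInter_of_finite fun i => isOpen_iUnion fun j =>
      isOpen_lt continuous_const (continuous_apply _)
  have hlimI : ∀ c : I × J → ι → ℝ, Filter.Tendsto (fun m => ∫ x, f m (linApp c x) ∂(stdPi ι))
      Filter.atTop (nhds ((stdPi ι).real {x | ∀ i, ∃ j, lam (i, j) < linApp c x (i, j)})) := by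
    intro c
    have hms : MeasurableSet {x : ι → ℝ | ∀ i, ∃ j, lam (i, j) < linApp c x (i, j)} :=
      (hopen.preimage (continuous_linApp c)).measurableSet
    have e : (stdPi ι).real {x | ∀ i, ∃ j, lam (i, j) < linApp c x (i, j)}
        = ∫ x, Set.indicator {y : I × J → ℝ | ∀ i, ∃ j, lam (i, j) < y (i, j)} (fun _ => (1:ℝ))
          (linApp c x) ∂(stdPi ι) := by
      rw [← integral_indicator_one hms]
      rfl
    rw [e]
    refine tendsto_integral_of_dominated_convergence (fun _ => (1:ℝ))
      (fun m => ((hfc m).comp (continuous_linApp c)).aestronglyMeasurable) (integrable_const _)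
      (fun m => Filter.Eventually.of_forall fun x => ?_)
      (Filter.Eventually.of_forall fun x => hlim _)
    rw [Real.norm_eq_abs, abs_of_nonneg (hle m _).1]
    exact (hle m _).2
  have := le_of_tendsto_of_tendsto' (hlimI b) (hlimI a) hcomp
  rwa [measureReal_def, measureReal_def, ENNReal.toReal_le_toReal (measure_ne_top _ _)
    (measure_ne_top _ _)] at this

end rows

/-- Euclidean norm. -/
def nrm {ι : Type*} [Fintype ι] (u : ι → ℝ) : ℝ := √(∑ i, u i ^ 2)

/-- The Gaussian process of the Lasso min-max problem. -/
def valX {n N : ℕ} (σ : ℝ) (ω : (Fin n → Fin N → ℝ) × (Fin n → ℝ)) (u : Fin n → ℝ)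
    (w : Fin N → ℝ) : ℝ := ∑ i, u i * (σ * ω.2 i - ∑ j, ω.1 i j * w j)

/-- Gordon's decoupled process. -/
def valG {n N : ℕ} (σ : ℝ) (ω : (Fin n → ℝ) × (Fin N → ℝ) × ℝ) (u : Fin n → ℝ)
    (w : Fin N → ℝ) : ℝ :=
  √((∑ j, w j ^ 2) / n + σ ^ 2) * (∑ i, ω.1 i * u i)
    + nrm u * (σ * ω.2.2 - (∑ j, ω.2.1 j * w j) / √n)

/-- The law of `(g, h, h₀)` in Gordon's comparison. -/
def GW (n N : ℕ) : Measure ((Fin n → ℝ) × (Fin N → ℝ) × ℝ) :=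
  (stdPi (Fin n)).prod ((stdPi (Fin N)).prod (gaussianReal 0 1))

instance (n N : ℕ) : IsProbabilityMeasure (GW n N) := by unfold GW; infer_instance

instance (n N : ℕ) : IsProbabilityMeasure (PX n N) := by unfold PX; infer_instance

instance (n : ℕ) : IsProbabilityMeasure (Pz n) := by unfold Pz; infer_instance

instance (n N : ℕ) : IsProbabilityMeasure (Pmodel n N) := by unfold Pmodel; infer_instance

/-- The index type of all Gaussian coordinates in Gordon's comparison. -/
abbrev GIdx (n N : ℕ) := (((Fin n × Fin N) ⊕ Fin n) ⊕ Unit) ⊕ (Fin n ⊕ (Fin N ⊕ Unit))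

/-- All Gaussian coordinates, normalized to unit variance. -/
def allCoords {n N : ℕ} (y : (((Fin n → Fin N → ℝ) × (Fin n → ℝ)) × ℝ) ×
    ((Fin n → ℝ) × (Fin N → ℝ) × ℝ)) : GIdx n N → ℝ :=
  Sum.elim (Sum.elim (Sum.elim (fun p => √n * y.1.1.1 p.1 p.2) y.1.1.2) fun _ => y.1.2)
    (Sum.elim y.2.1 (Sum.elim y.2.2.1 fun _ => y.2.2.2))

lemma gaussian_scale {n : ℕ} (hn : 0 < n) (s : Set ℝ) (hs : MeasurableSet s) :
    gaussianReal 0 ((n : ℝ≥0))⁻¹ {x | √n * x ∈ s} = gaussianReal 0 1 s := by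
  have h := gaussianReal_map_const_mul (μ := 0) (v := ((n : ℝ≥0))⁻¹) (√n)
  have e : (NNReal.mk (√n ^ 2) (sq_nonneg _)) * ((n : ℝ≥0))⁻¹ = 1 := by
    have hn' : (n : ℝ≥0) ≠ 0 := by exact_mod_cast hn.ne'
    have : (NNReal.mk (√n ^ 2) (sq_nonneg _)) = n := by
      ext; simp
    rw [this, mul_inv_cancel₀ hn']
  rw [e, mul_zero] at h
  rw [← h, Measure.map_apply (by fun_prop) hs]
  rfl

lemma measurePreserving_allCoords {n N : ℕ} (hn : 0 < n) :
    MeasurePreserving (allCoords (n := n) (N := N))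
      (((Pmodel n N).prod (gaussianReal 0 1)).prod (GW n N)) (stdPi (GIdx n N)) := by
  have hm : Measurable (allCoords (n := n) (N := N)) := by
    rw [measurable_pi_iff]
    rintro (((⟨i, j⟩ | i) | i) | (i | (j | i))) <;> simp only [allCoords, Sum.elim_inl, Sum.elim_inr] <;>
      fun_prop
  refine ⟨hm, ?_⟩
  symm
  refine Measure.pi_eq fun s hs => ?_
  rw [Measure.map_apply hm (MeasurableSet.univ_pi hs)]
  have : (allCoords (n := n) (N := N)) ⁻¹' (Set.pi Set.univ s)
      = ((((Set.pi Set.univ fun i => Set.pi Set.univ fun j =>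
          {x | √n * x ∈ s (Sum.inl (Sum.inl (Sum.inl (i, j))))}) ×ˢ
        (Set.pi Set.univ fun i => s (Sum.inl (Sum.inl (Sum.inr i))))) ×ˢ
        (s (Sum.inl (Sum.inr ())))) ×ˢ
        ((Set.pi Set.univ fun i => s (Sum.inr (Sum.inl i))) ×ˢ
        ((Set.pi Set.univ fun i => s (Sum.inr (Sum.inr (Sum.inl i)))) ×ˢ
          (s (Sum.inr (Sum.inr (Sum.inr ()))))))) := by
    ext y
    simp only [allCoords, Set.mem_preimage, Set.mem_pi, Set.mem_univ, Set.mem_prod, Unique.forall_iff, PUnit.default_eq_unit,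
      Sum.forall, Prod.forall, Sum.elim_inl, Sum.elim_inr, Set.mem_ofPred_eq, forall_const]
  rw [this, Measure.prod_prod, Measure.prod_prod, GW, Measure.prod_prod, Measure.prod_prod,
    Pmodel, Measure.prod_prod, PX, Measure.pi_pi, Pz, Measure.pi_pi, stdPi, Measure.pi_pi, stdPi,
    Measure.pi_pi, Fintype.prod_sum_type, Fintype.prod_sum_type, Fintype.prod_sum_type,
    Fintype.prod_sum_type, Fintype.prod_sum_type, Fintype.prod_prod_type]
  simp only [Measure.pi_pi, gaussian_scale hn _ (hs _)]
  simp

lemma nrm_sq {ι : Type*} [Fintype ι] (u : ι → ℝ) : nrm u ^ 2 = ∑ i, u i ^ 2 :=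
  Real.sq_sqrt (Finset.sum_nonneg fun _ _ => sq_nonneg _)

lemma nrm_nonneg {ι : Type*} [Fintype ι] (u : ι → ℝ) : 0 ≤ nrm u := Real.sqrt_nonneg _

lemma inner_le_nrm {ι : Type*} [Fintype ι] (u v : ι → ℝ) : ∑ i, u i * v i ≤ nrm u * nrm v :=
  Real.sum_mul_le_sqrt_mul_sqrt _ _ _

/-- Gordon's comparison between `valX` and `valG`, for finite families and up to a common sign. -/
lemma gordon_model {n N : ℕ} (hn : 0 < n) {R C : Type*} [Fintype R] [Fintype C] [DecidableEq R]
    [DecidableEq C] (σ : ℝ) (s : ℝ) (hs : s ^ 2 = 1) (w : R × C → Fin N → ℝ) (u : R × C → Fin n → ℝ)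
    (lam : R × C → ℝ) (hrow : ∀ r c c', w (r, c) = w (r, c') ∨ u (r, c) = u (r, c')) :
    Pmodel n N {ω | ∃ r, ∀ c, s * valX σ ω (u (r, c)) (w (r, c)) ≤ lam (r, c)}
      ≤ 2 * GW n N {ω | ∃ r, ∀ c, s * valG σ ω (u (r, c)) (w (r, c)) ≤ lam (r, c)} := by
  have hn' : (0:ℝ) < n := by exact_mod_cast hn
  have hsn : √(n:ℝ) ≠ 0 := (Real.sqrt_pos.2 hn').ne'
  set T : R × C → ℝ := fun k => √((∑ j, w k j ^ 2) / n + σ ^ 2) with hT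
  have hT0 : ∀ k, 0 ≤ T k := fun k => Real.sqrt_nonneg _
  have hTsq : ∀ k, T k ^ 2 = (∑ j, w k j ^ 2) / n + σ ^ 2 := fun k =>
    Real.sq_sqrt (add_nonneg (div_nonneg (Finset.sum_nonneg fun _ _ => sq_nonneg _) hn'.le)
      (sq_nonneg _))
  set a : R × C → GIdx n N → ℝ := fun k => Sum.elim
    (Sum.elim (Sum.elim (fun p => s * (-(u k p.1 * w k p.2) / √n)) fun i => s * (σ * u k i))
      fun _ => nrm (u k) * T k) (fun _ => 0) with ha
  set b : R × C → GIdx n N → ℝ := fun k => Sum.elim (fun _ => 0)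
    (Sum.elim (fun i => s * (T k * u k i))
      (Sum.elim (fun j => s * (-(nrm (u k) * w k j) / √n)) fun _ => s * (nrm (u k) * σ))) with hb
  have hab : ∀ k l, ∑ r, a k r * b l r = 0 := by
    intro k l
    simp [ha, hb, Fintype.sum_sum_type]
  have haa : ∀ k l, ∑ r, a k r * a l r = (∑ i, u k i * u l i) * ((∑ j, w k j * w l j) / n + σ ^ 2)
      + (nrm (u k) * nrm (u l)) * (T k * T l) := by
    intro k l
    simp only [ha, Fintype.sum_sum_type, Sum.elim_inl, Sum.elim_inr, Fintype.sum_prod_type,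
      mul_zero, Finset.sum_const_zero, add_zero, Finset.univ_unique, Finset.sum_singleton]
    have e1 : ∀ i j, s * (-(u k i * w k j) / √n) * (s * (-(u l i * w l j) / √n))
        = u k i * u l i * (w k j * w l j / n) := by
      intro i j
      calc _ = s ^ 2 * (u k i * u l i * (w k j * w l j)) / (√n) ^ 2 := by field_simp
        _ = _ := by rw [hs, Real.sq_sqrt hn'.le]; ring
    have e2 : ∀ i, s * (σ * u k i) * (s * (σ * u l i)) = u k i * u l i * σ ^ 2 := by
      intro i
      calc _ = s ^ 2 * (u k i * u l i * σ ^ 2) := by ring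
        _ = _ := by rw [hs]; ring
    simp only [e1, e2]
    simp_rw [← Finset.mul_sum]
    rw [← Finset.sum_mul, ← Finset.sum_mul, ← Finset.sum_div]
    ring
  have hbb : ∀ k l, ∑ r, b k r * b l r = (∑ i, u k i * u l i) * (T k * T l)
      + (nrm (u k) * nrm (u l)) * ((∑ j, w k j * w l j) / n + σ ^ 2) := by
    intro k l
    simp only [hb, Fintype.sum_sum_type, Sum.elim_inl, Sum.elim_inr,
      mul_zero, Finset.sum_const_zero, zero_add, Finset.univ_unique, Finset.sum_singleton]
    have e1 : ∀ j, s * (-(nrm (u k) * w k j) / √n) * (s * (-(nrm (u l) * w l j) / √n))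
        = (nrm (u k) * nrm (u l) / n) * (w k j * w l j) := by
      intro j
      calc _ = s ^ 2 * (nrm (u k) * nrm (u l) * (w k j * w l j)) / (√n) ^ 2 := by field_simp
        _ = _ := by rw [hs, Real.sq_sqrt hn'.le]; ring
    have e2 : ∀ i, s * (T k * u k i) * (s * (T l * u l i)) = T k * T l * (u k i * u l i) := by
      intro i
      calc _ = s ^ 2 * (T k * T l * (u k i * u l i)) := by ring
        _ = _ := by rw [hs]; ring
    have e3 : s * (nrm (u k) * σ) * (s * (nrm (u l) * σ)) = nrm (u k) * nrm (u l) * σ ^ 2 := by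
      calc _ = s ^ 2 * (nrm (u k) * nrm (u l) * σ ^ 2) := by ring
        _ = _ := by rw [hs]; ring
    simp only [e1, e2, e3]
    simp_rw [← Finset.mul_sum]
    ring
  have hdiff : ∀ k l, ∑ r, a k r * a l r - ∑ r, b k r * b l r
      = (nrm (u k) * nrm (u l) - ∑ i, u k i * u l i)
        * (T k * T l - ((∑ j, w k j * w l j) / n + σ ^ 2)) := by
    intro k l; rw [haa, hbb]; ring
  have hw : ∀ k l, (∑ j, w k j * w l j) / n + σ ^ 2 ≤ T k * T l := by
    intro k l
    refine abs_le_of_sq_le_sq' ?_ (mul_nonneg (hT0 _) (hT0 _)) |>.2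
    rw [mul_pow, hTsq, hTsq]
    have h1 := Finset.sum_mul_sq_le_sq_mul_sq Finset.univ (w k) (w l)
    set p := ∑ j, w k j ^ 2
    set q := ∑ j, w l j ^ 2
    set r := ∑ j, w k j * w l j
    have hp : 0 ≤ p := Finset.sum_nonneg fun _ _ => sq_nonneg _
    have hq : 0 ≤ q := Finset.sum_nonneg fun _ _ => sq_nonneg _
    have h2 : 2 * r ≤ p + q := by
      by_contra hcon
      nlinarith [sq_nonneg (p - q)]
    have h3 : (r / n) ^ 2 ≤ p / n * (q / n) := by
      rw [div_pow, div_mul_div_comm, ← sq]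
      exact div_le_div_of_nonneg_right h1 (sq_nonneg _)
    have h4 : 2 * (r / n) ≤ p / n + q / n := by
      rw [← mul_div_assoc, ← add_div]; exact div_le_div_of_nonneg_right h2 hn'.le
    nlinarith [sq_nonneg σ]
  have hcov : ∀ k l, ∑ r, b k r * b l r ≤ ∑ r, a k r * a l r := fun k l => by
    rw [← sub_nonneg, hdiff]
    exact mul_nonneg (sub_nonneg.2 (inner_le_nrm _ _)) (sub_nonneg.2 (hw _ _))
  have hrow' : ∀ r c c', ∑ x, b (r, c) x * b (r, c') x = ∑ x, a (r, c) x * a (r, c') x := by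
    intro r c c'
    rw [eq_comm, ← sub_eq_zero, hdiff]
    rcases hrow r c c' with h | h
    · have : T (r, c) = T (r, c') := by simp only [hT, h]
      rw [h, this, ← sq, hTsq]
      simp only [← sq, sub_self, mul_zero]
    · rw [h, ← sq, nrm_sq]
      simp only [← sq, sub_self, zero_mul]
  have main := gordon_finite a b lam hab hrow' hcov
  have mp := measurePreserving_allCoords (n := n) (N := N) hn
  have hla : ∀ y k, linApp a (allCoords y) k
      = s * valX σ y.1.1 (u k) (w k) + nrm (u k) * T k * y.1.2 := by
    intro y k
    simp only [linApp, ha, allCoords, valX, Fintype.sum_sum_type, Sum.elim_inl, Sum.elim_inr,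
      Fintype.sum_prod_type, zero_mul, Finset.sum_const_zero, add_zero, Finset.univ_unique,
      Finset.sum_singleton]
    congr 1
    rw [← Finset.sum_add_distrib, Finset.mul_sum]
    refine Finset.sum_congr rfl fun i _ => ?_
    rw [mul_sub, mul_sub, sub_eq_add_neg, add_comm, Finset.mul_sum, Finset.mul_sum,
      ← Finset.sum_neg_distrib]
    congr 1
    · ring
    · refine Finset.sum_congr rfl fun j _ => ?_
      field_simp
  have hlb : ∀ y k, linApp b (allCoords y) k = s * valG σ y.2 (u k) (w k) := by
    intro y k
    simp only [linApp, hb, allCoords, valG, Fintype.sum_sum_type, Sum.elim_inl, Sum.elim_inr,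
      zero_mul, Finset.sum_const_zero, zero_add, Finset.univ_unique, Finset.sum_singleton]
    rw [mul_add]
    congr 1
    · rw [Finset.mul_sum, Finset.mul_sum]
      exact Finset.sum_congr rfl fun i _ => by ring
    · rw [mul_sub, mul_sub, sub_eq_add_neg, add_comm, Finset.sum_div, Finset.mul_sum,
        Finset.mul_sum, ← Finset.sum_neg_distrib]
      congr 1
      · ring
      · exact Finset.sum_congr rfl fun i _ => by ring
  have hopen : ∀ c : R × C → GIdx n N → ℝ,
      MeasurableSet {x : GIdx n N → ℝ | ∀ i, ∃ j, lam (i, j) < linApp c x (i, j)} := by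
    intro c
    have := continuous_linApp c
    simp only [Set.ofPred_forall, Set.ofPred_exists]
    exact (isOpen_iInter_of_finite fun i => isOpen_iUnion fun j =>
      isOpen_lt continuous_const (by fun_prop)).measurableSet
  have main' : (stdPi (GIdx n N)) {x | ∀ i, ∃ j, lam (i, j) < linApp a x (i, j)}ᶜ
      ≤ (stdPi (GIdx n N)) {x | ∀ i, ∃ j, lam (i, j) < linApp b x (i, j)}ᶜ := by
    rw [prob_compl_eq_one_sub (hopen a), prob_compl_eq_one_sub (hopen b)]
    exact tsub_le_tsub_left main 1
  rw [← mp.measure_preimage (hopen a).compl.nullMeasurableSet,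
    ← mp.measure_preimage (hopen b).compl.nullMeasurableSet] at main'
  have hB : allCoords ⁻¹' {x | ∀ i, ∃ j, lam (i, j) < linApp b x (i, j)}ᶜ
      = Set.univ ×ˢ {ω : (Fin n → ℝ) × (Fin N → ℝ) × ℝ |
        ∃ r, ∀ c, s * valG σ ω (u (r, c)) (w (r, c)) ≤ lam (r, c)} := by
    ext y
    simp [hlb]
  have hA : ({ω : (Fin n → Fin N → ℝ) × (Fin n → ℝ) |
        ∃ r, ∀ c, s * valX σ ω (u (r, c)) (w (r, c)) ≤ lam (r, c)} ×ˢ (Set.Iic (0:ℝ))) ×ˢ Set.univ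
      ⊆ allCoords ⁻¹' {x | ∀ i, ∃ j, lam (i, j) < linApp a x (i, j)}ᶜ := by
    rintro y ⟨⟨⟨r, hr⟩, h0⟩, -⟩
    simp only [Set.mem_preimage, Set.mem_compl_iff, Set.mem_ofPred_eq, hla]
    push Not
    refine ⟨r, fun c => ?_⟩
    have := mul_nonpos_of_nonneg_of_nonpos (mul_nonneg (nrm_nonneg (u (r, c))) (hT0 (r, c))) h0
    linarith [hr c]
  rw [hB, Measure.prod_prod, measure_univ, one_mul] at main'
  have m2 := (measure_mono hA).trans main'
  rw [Measure.prod_prod, Measure.prod_prod, measure_univ, mul_one] at m2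
  have hhalf : (1:ℝ≥0∞) ≤ 2 * gaussianReal 0 1 (Set.Iic (0:ℝ)) := by
    have e : gaussianReal 0 1 (Set.Ici (0:ℝ)) = gaussianReal 0 1 (Set.Iic (0:ℝ)) := by
      have h := gaussianReal_map_neg (μ := 0) (v := 1)
      rw [neg_zero] at h
      conv_rhs => rw [← h]
      rw [Measure.map_apply measurable_neg measurableSet_Iic]
      congr 1
      ext x; simp
    calc (1:ℝ≥0∞) = gaussianReal 0 1 (Set.univ : Set ℝ) := measure_univ.symm
      _ ≤ gaussianReal 0 1 (Set.Iic (0:ℝ)) + gaussianReal 0 1 (Set.Ici (0:ℝ)) := by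
        rw [← Set.Iic_union_Ici (a := (0:ℝ))]; exact measure_union_le _ _
      _ = _ := by rw [e, two_mul]
  calc _ ≤ Pmodel n N _ * (2 * gaussianReal 0 1 (Set.Iic (0:ℝ))) := le_mul_of_one_le_right' hhalf
    _ = 2 * (Pmodel n N _ * gaussianReal 0 1 (Set.Iic (0:ℝ))) := by ring
    _ ≤ _ := mul_le_mul_right m2 2

lemma continuous_nrm {ι : Type*} [Fintype ι] : Continuous (nrm : (ι → ℝ) → ℝ) := by
  unfold nrm; fun_prop

lemma continuous_valG_left {n N : ℕ} (σ : ℝ) (u : Fin n → ℝ) (w : Fin N → ℝ) :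
    Continuous fun ω => valG σ ω u w := by
  unfold valG; fun_prop

lemma continuous_valG_mid {n N : ℕ} (σ : ℝ) (ω : (Fin n → ℝ) × (Fin N → ℝ) × ℝ)
    (w : Fin N → ℝ) : Continuous fun u => valG σ ω u w := by
  have := continuous_nrm (ι := Fin n)
  unfold valG; fun_prop

lemma continuous_valX_mid {n N : ℕ} (σ : ℝ) (ω : (Fin n → Fin N → ℝ) × (Fin n → ℝ))
    (w : Fin N → ℝ) : Continuous fun u => valX σ ω u w := by
  unfold valX; fun_prop

/-- The unpenalized residual cost. -/
def resCost {n N : ℕ} (σ : ℝ) (ω : (Fin n → Fin N → ℝ) × (Fin n → ℝ)) (w : Fin N → ℝ) : ℝ :=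
  (∑ i, (σ * ω.2 i - ∑ j, ω.1 i j * w j) ^ 2) / 2

lemma valX_le_resCost {n N : ℕ} (σ : ℝ) (ω : (Fin n → Fin N → ℝ) × (Fin n → ℝ)) (u : Fin n → ℝ)
    (w : Fin N → ℝ) : valX σ ω u w ≤ resCost σ ω w + nrm u ^ 2 / 2 := by
  rw [valX, resCost, nrm_sq, ← add_div, ← Finset.sum_add_distrib, Finset.sum_div]
  refine Finset.sum_le_sum fun i _ => ?_
  nlinarith [sq_nonneg (u i - (σ * ω.2 i - ∑ j, ω.1 i j * w j))]

lemma continuous_resCost {n N : ℕ} (σ : ℝ) (ω : (Fin n → Fin N → ℝ) × (Fin n → ℝ)) :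
    Continuous (resCost σ ω) := by
  unfold resCost; fun_prop

/-- Gordon's inequality for the lower tail of the infimum over a set. -/
lemma gordon_low {n N : ℕ} (hn : 0 < n) (σ : ℝ) (S : Set (Fin N → ℝ)) (A : (Fin N → ℝ) → ℝ)
    (hA : Continuous A) (t : ℝ) :
    Pmodel n N {ω | ∃ w ∈ S, resCost σ ω w + A w < t}
      ≤ 2 * GW n N {ω | ∃ w ∈ S, ∀ u, valG σ ω u w - nrm u ^ 2 / 2 + A w ≤ t} := by
  obtain ⟨D, hDS, hDc, hSD⟩ : ∃ D ⊆ S, D.Countable ∧ S ⊆ closure D :=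
    (TopologicalSpace.IsSeparable.of_separableSpace S).exists_countable_dense_subset
  rcases D.eq_empty_or_nonempty with rfl | hDne
  · have : S = ∅ := by simpa [Set.subset_empty_iff] using hSD
    simp [this]
  obtain ⟨w, rfl⟩ := hDc.exists_eq_range hDne
  set v := TopologicalSpace.denseSeq (Fin n → ℝ)
  set lam : ℕ → ℕ → ℝ := fun k j => t + nrm (v j) ^ 2 / 2 - A (w k) with hlam
  have hfin : ∀ m r : ℕ, Pmodel n N {ω | ∃ k ≤ m, resCost σ ω (w k) + A (w k) < t}
      ≤ 2 * GW n N {ω | ∃ k : Fin (m + 1), ∀ j : Fin (r + 1),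
        valG σ ω (v j) (w k) ≤ lam k j} := by
    intro m r
    have h := gordon_model hn (R := Fin (m + 1)) (C := Fin (r + 1)) σ 1 (by norm_num)
      (fun p => w p.1) (fun p => v p.2) (fun p => lam p.1 p.2) (fun _ _ _ => Or.inl rfl)
    simp only [one_mul] at h
    refine (measure_mono ?_).trans h
    rintro ω ⟨k, hk, hω⟩
    refine ⟨⟨k, Nat.lt_succ_of_le hk⟩, fun j => ?_⟩
    have := valX_le_resCost σ ω (v j) (w k)
    simp only [hlam]
    linarith
  have hlim : ∀ m : ℕ, Pmodel n N {ω | ∃ k ≤ m, resCost σ ω (w k) + A (w k) < t}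
      ≤ 2 * GW n N {ω | ∃ w ∈ S, ∀ u, valG σ ω u w - nrm u ^ 2 / 2 + A w ≤ t} := by
    intro m
    set B : ℕ → Set ((Fin n → ℝ) × (Fin N → ℝ) × ℝ) := fun r =>
      {ω | ∃ k : Fin (m + 1), ∀ j : Fin (r + 1), valG σ ω (v j) (w k) ≤ lam k j} with hB
    have hBm : ∀ r, MeasurableSet (B r) := by
      intro r
      simp only [hB, Set.ofPred_forall, Set.ofPred_exists]
      exact (isClosed_iUnion_of_finite fun k => isClosed_iInter fun j =>
        isClosed_le (continuous_valG_left σ _ _) continuous_const).measurableSet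
    have hBa : Antitone B := by
      intro r r' hrr ω
      rintro ⟨k, hk⟩
      exact ⟨k, fun j => hk ⟨j, by omega⟩⟩
    have hle : Pmodel n N {ω | ∃ k ≤ m, resCost σ ω (w k) + A (w k) < t}
        ≤ 2 * GW n N (⋂ r, B r) := by
      have ht := (tendsto_measure_iInter_atTop (μ := GW n N) (fun r => (hBm r).nullMeasurableSet)
        hBa ⟨0, measure_ne_top _ _⟩)
      have ht2 := ENNReal.Tendsto.const_mul (a := 2) ht (Or.inr (by norm_num))
      exact ge_of_tendsto' ht2 (fun r => hfin m r)
    refine hle.trans (mul_le_mul_right (measure_mono ?_) 2)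
    intro ω hω
    rw [Set.mem_iInter] at hω
    obtain ⟨k, hk⟩ : ∃ k : Fin (m + 1), ∀ j, valG σ ω (v j) (w k) ≤ lam k j := by
      by_contra hcon
      push Not at hcon
      choose j hj using hcon
      obtain ⟨k, hk⟩ := hω (Finset.univ.sup j)
      have := hk ⟨j k, Nat.lt_succ_of_le (Finset.le_sup (Finset.mem_univ k))⟩
      exact absurd this (not_le.2 (hj k))
    refine ⟨w k, hDS ⟨k, rfl⟩, fun u => ?_⟩
    have hcl : IsClosed {u : Fin n → ℝ | valG σ ω u (w k) - nrm u ^ 2 / 2 + A (w k) ≤ t} := by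
      refine isClosed_le ?_ continuous_const
      exact (((continuous_valG_mid σ ω (w k)).sub ((continuous_nrm.pow 2).div_const 2)).add
        continuous_const)
    have hsub : Set.range v ⊆ {u : Fin n → ℝ | valG σ ω u (w k) - nrm u ^ 2 / 2 + A (w k) ≤ t} := by
      rintro _ ⟨j, rfl⟩
      have := hk j
      simp only [hlam] at this
      simp only [Set.mem_ofPred_eq]
      linarith
    have := closure_minimal hsub hcl
    rw [(TopologicalSpace.denseRange_denseSeq (Fin n → ℝ)).closure_range] at this
    exact this (Set.mem_univ u)
  have hmono : Monotone fun m : ℕ =>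
      {ω : (Fin n → Fin N → ℝ) × (Fin n → ℝ) | ∃ k ≤ m, resCost σ ω (w k) + A (w k) < t} := by
    intro m m' hm ω
    rintro ⟨k, hk, h⟩
    exact ⟨k, hk.trans hm, h⟩
  refine (measure_mono ?_).trans ((hmono.measure_iUnion).le.trans (iSup_le hlim))
  rintro ω ⟨w0, hw0, hω⟩
  have ho : IsOpen {w | resCost σ ω w + A w < t} :=
    isOpen_lt ((continuous_resCost σ ω).add hA) continuous_const
  obtain ⟨_, h1, ⟨k, rfl⟩⟩ := mem_closure_iff.1 (hSD hw0) _ ho hω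
  exact Set.mem_iUnion.2 ⟨k, k, le_rfl, h1⟩

/-- A minimizer of the penalized cost yields a dual vector. -/
lemma exists_dual {n N : ℕ} (σ : ℝ) (ω : (Fin n → Fin N → ℝ) × (Fin n → ℝ))
    (A : (Fin N → ℝ) → ℝ) (hA : Continuous A) (hconv : ConvexOn ℝ Set.univ A)
    (hcoer : Filter.Tendsto A (Filter.cocompact _) Filter.atTop) {t : ℝ}
    (ht : ∀ w, t < resCost σ ω w + A w) :
    ∃ t' u, t < t' ∧ ∀ w, t' ≤ valX σ ω u w - nrm u ^ 2 / 2 + A w := by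
  have hr0 : ∀ w, 0 ≤ resCost σ ω w := fun w =>
    div_nonneg (Finset.sum_nonneg fun _ _ => sq_nonneg _) two_pos.le
  obtain ⟨w0, hw0⟩ := ((continuous_resCost σ ω).add hA).exists_forall_le
    (Filter.tendsto_atTop_mono (fun w => by simpa using hr0 w) hcoer)
  set u : Fin n → ℝ := fun i => σ * ω.2 i - ∑ j, ω.1 i j * w0 j with hu
  have hu2 : resCost σ ω w0 = nrm u ^ 2 / 2 := by rw [nrm_sq, resCost]
  refine ⟨resCost σ ω w0 + A w0, u, ht w0, fun w => ?_⟩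
  set d : Fin n → ℝ := fun i => ∑ j, ω.1 i j * (w j - w0 j) with hd
  have hval : valX σ ω u w = nrm u ^ 2 - ∑ i, u i * d i := by
    rw [nrm_sq, valX, ← Finset.sum_sub_distrib]
    refine Finset.sum_congr rfl fun i _ => ?_
    have : d i = ∑ j, ω.1 i j * w j - ∑ j, ω.1 i j * w0 j := by
      simp only [hd, mul_sub, Finset.sum_sub_distrib]
    rw [this]; simp only [hu]; ring
  have hs : ∀ s : ℝ, 0 < s → s ≤ 1 →
      ∑ i, u i * d i ≤ s * ((∑ i, d i ^ 2) / 2) + (A w - A w0) := by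
    intro s hs0 hs1
    have h1 := hw0 (w0 + s • (w - w0))
    have h2 : A (w0 + s • (w - w0)) ≤ (1 - s) * A w0 + s * A w := by
      have := hconv.2 (Set.mem_univ w0) (Set.mem_univ w) (sub_nonneg.2 hs1) hs0.le (by ring)
      simp only [smul_eq_mul] at this
      refine le_trans (le_of_eq ?_) this
      congr 1
      module
    have h3 : resCost σ ω (w0 + s • (w - w0))
        = nrm u ^ 2 / 2 - s * (∑ i, u i * d i) + s ^ 2 * ((∑ i, d i ^ 2) / 2) := by
      rw [nrm_sq, resCost, Finset.mul_sum, Finset.sum_div, Finset.sum_div, Finset.sum_div,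
        Finset.mul_sum, ← Finset.sum_sub_distrib, ← Finset.sum_add_distrib]
      refine Finset.sum_congr rfl fun i _ => ?_
      have : ∑ j, ω.1 i j * (w0 + s • (w - w0)) j = ∑ j, ω.1 i j * w0 j + s * d i := by
        simp only [hd, Finset.mul_sum, ← Finset.sum_add_distrib]
        exact Finset.sum_congr rfl fun j _ => by
          simp only [Pi.add_apply, Pi.smul_apply, Pi.sub_apply, smul_eq_mul]; ring
      rw [this]; simp only [hu]; ring
    rw [Pi.add_apply, Pi.add_apply, h3, hu2] at h1
    have h4 : 0 ≤ s * (s * ((∑ i, d i ^ 2) / 2) + (A w - A w0) - ∑ i, u i * d i) := by nlinarith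
    have := nonneg_of_mul_nonneg_right h4 hs0
    linarith
  have hlim : ∑ i, u i * d i ≤ A w - A w0 := by
    have ht : Filter.Tendsto (fun s : ℝ => s * ((∑ i, d i ^ 2) / 2) + (A w - A w0))
        (nhdsWithin 0 (Set.Ioi 0)) (nhds (0 * ((∑ i, d i ^ 2) / 2) + (A w - A w0))) := by
      refine Filter.Tendsto.mono_left ?_ nhdsWithin_le_nhds
      exact (Continuous.tendsto (by fun_prop) 0)
    rw [zero_mul, zero_add] at ht
    refine ge_of_tendsto ht ?_
    filter_upwards [Ioo_mem_nhdsGT (zero_lt_one' ℝ)] with s hs'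
    exact hs s hs'.1 hs'.2.le
  rw [hval, hu2]
  linarith

lemma valG_le {n N : ℕ} (σ : ℝ) (ω : (Fin n → ℝ) × (Fin N → ℝ) × ℝ) (u : Fin n → ℝ)
    (w : Fin N → ℝ) : valG σ ω u w - nrm u ^ 2 / 2 ≤
      (max 0 (√((∑ j, w j ^ 2) / n + σ ^ 2) * nrm ω.1
        + (σ * ω.2.2 - (∑ j, ω.2.1 j * w j) / √n))) ^ 2 / 2 := by
  set T := √((∑ j, w j ^ 2) / n + σ ^ 2)
  set H := σ * ω.2.2 - (∑ j, ω.2.1 j * w j) / √n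
  have h1 : valG σ ω u w ≤ nrm u * (T * nrm ω.1 + H) := by
    have := mul_le_mul_of_nonneg_left (inner_le_nrm ω.1 u) (Real.sqrt_nonneg _ : 0 ≤ T)
    rw [valG]
    nlinarith
  have h2 : nrm u * (T * nrm ω.1 + H) ≤ nrm u * max 0 (T * nrm ω.1 + H) :=
    mul_le_mul_of_nonneg_left (le_max_right _ _) (nrm_nonneg _)
  nlinarith [sq_nonneg (nrm u - max 0 (T * nrm ω.1 + H))]

/-- Gordon's inequality for the upper tail of the infimum. -/
lemma gordon_up {n N : ℕ} (hn : 0 < n) (σ : ℝ) (A : (Fin N → ℝ) → ℝ)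
    (hA : Continuous A) (hconv : ConvexOn ℝ Set.univ A)
    (hcoer : Filter.Tendsto A (Filter.cocompact _) Filter.atTop) (t : ℝ) :
    Pmodel n N {ω | ∀ w, t < resCost σ ω w + A w}
      ≤ 2 * GW n N {ω | ∀ w, t ≤ (max 0 (√((∑ j, w j ^ 2) / n + σ ^ 2) * nrm ω.1
        + (σ * ω.2.2 - (∑ j, ω.2.1 j * w j) / √n))) ^ 2 / 2 + A w} := by
  set v := TopologicalSpace.denseSeq (Fin n → ℝ)
  set w := TopologicalSpace.denseSeq (Fin N → ℝ)
  set G : ((Fin n → ℝ) × (Fin N → ℝ) × ℝ) → (Fin N → ℝ) → ℝ := fun ω w =>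
    (max 0 (√((∑ j, w j ^ 2) / n + σ ^ 2) * nrm ω.1
        + (σ * ω.2.2 - (∑ j, ω.2.1 j * w j) / √n))) ^ 2 / 2 + A w with hG
  have hGc1 : ∀ w, Continuous fun ω => G ω w := by
    intro w
    have := continuous_nrm (ι := Fin n)
    simp only [hG]; fun_prop
  have hGc2 : ∀ ω, Continuous fun w => G ω w := by
    intro w
    simp only [hG]; fun_prop
  set lam : ℕ → ℕ → ℝ := fun j k => t + nrm (v j) ^ 2 / 2 - A (w k) with hlam
  have hfin : ∀ m r : ℕ,
      Pmodel n N {ω | ∃ j ≤ r, ∀ k ≤ m, lam j k ≤ valX σ ω (v j) (w k)}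
      ≤ 2 * GW n N {ω | ∀ k ≤ m, t ≤ G ω (w k)} := by
    intro m r
    have h := gordon_model hn (R := Fin (r + 1)) (C := Fin (m + 1)) σ (-1) (by norm_num)
      (fun p => w p.2) (fun p => v p.1) (fun p => -lam p.1 p.2) (fun _ _ _ => Or.inr rfl)
    simp only [neg_mul, one_mul, neg_le_neg_iff] at h
    refine (measure_mono ?_).trans (h.trans (mul_le_mul_right (measure_mono ?_) 2))
    · rintro ω ⟨j, hj, hω⟩
      exact ⟨⟨j, Nat.lt_succ_of_le hj⟩, fun k => hω k (Nat.le_of_lt_succ k.2)⟩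
    · rintro ω ⟨j, hj⟩ k hk
      have h1 := hj ⟨k, Nat.lt_succ_of_le hk⟩
      have h2 := valG_le σ ω (v j) (w k)
      simp only [hlam] at h1
      simp only [hG]
      linarith
  have hstep : ∀ m : ℕ, Pmodel n N {ω | ∀ w, t < resCost σ ω w + A w}
      ≤ 2 * GW n N {ω | ∀ k ≤ m, t ≤ G ω (w k)} := by
    intro m
    have hmono : Monotone fun r : ℕ => {ω : (Fin n → Fin N → ℝ) × (Fin n → ℝ) |
        ∃ j ≤ r, ∀ k ≤ m, lam j k ≤ valX σ ω (v j) (w k)} := by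
      intro r r' hr ω
      rintro ⟨j, hj, h⟩
      exact ⟨j, hj.trans hr, h⟩
    refine (measure_mono ?_).trans ((hmono.measure_iUnion).le.trans (iSup_le (hfin m)))
    intro ω hω
    obtain ⟨t', u, htt, hu⟩ := exists_dual σ ω A hA hconv hcoer hω
    have ho : IsOpen {u : Fin n → ℝ | ∀ k : Fin (m + 1),
        t < valX σ ω u (w k) - nrm u ^ 2 / 2 + A (w k)} := by
      simp only [Set.ofPred_forall]
      refine isOpen_iInter_of_finite fun k => isOpen_lt continuous_const ?_
      exact (((continuous_valX_mid σ ω (w k)).sub ((continuous_nrm.pow 2).div_const 2)).add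
        continuous_const)
    obtain ⟨j, hj⟩ := (TopologicalSpace.denseRange_denseSeq (Fin n → ℝ)).exists_mem_open ho
      ⟨u, fun k => htt.trans_le (hu _)⟩
    refine Set.mem_iUnion.2 ⟨j, j, le_rfl, fun k hk => ?_⟩
    have := hj ⟨k, Nat.lt_succ_of_le hk⟩
    simp only [hlam]
    linarith
  set B : ℕ → Set ((Fin n → ℝ) × (Fin N → ℝ) × ℝ) := fun m => {ω | ∀ k ≤ m, t ≤ G ω (w k)} with hB
  have hBm : ∀ m, MeasurableSet (B m) := by
    intro m
    simp only [hB, Set.ofPred_forall]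
    exact (isClosed_iInter fun k => isClosed_iInter fun _ =>
      isClosed_le continuous_const (hGc1 _)).measurableSet
  have hBa : Antitone B := fun r r' hrr ω h k hk => h k (hk.trans hrr)
  have ht := (tendsto_measure_iInter_atTop (μ := GW n N) (fun r => (hBm r).nullMeasurableSet)
        hBa ⟨0, measure_ne_top _ _⟩)
  have ht2 := ENNReal.Tendsto.const_mul (a := 2) ht (Or.inr (by norm_num))
  refine (ge_of_tendsto' ht2 hstep).trans (mul_le_mul_right (measure_mono ?_) 2)
  intro ω hω
  rw [Set.mem_iInter] at hω
  have hcl : IsClosed {x | t ≤ G ω x} := isClosed_le continuous_const (hGc2 ω)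
  have hsub : Set.range w ⊆ {x | t ≤ G ω x} := by
    rintro _ ⟨k, rfl⟩
    exact hω k k le_rfl
  have := closure_minimal hsub hcl
  rw [(TopologicalSpace.denseRange_denseSeq (Fin N → ℝ)).closure_range] at this
  exact fun x => this (Set.mem_univ x)

lemma integrable_exp_sq_gaussian :
    Integrable (fun x : ℝ => Real.exp (x ^ 2 / 4)) (gaussianReal 0 1) := by
  rw [integrable_gaussian_iff]
  have h := (integrable_exp_neg_mul_sq (b := 1 / 4) (by norm_num)).const_mul (√(2 * Real.pi))⁻¹
  refine h.congr (Filter.Eventually.of_forall fun x => ?_)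
  simp only [gaussianPDFReal_std]
  rw [mul_assoc, ← Real.exp_add]
  congr 2
  ring

/-- The exponential square moment `E exp(Z²/4)` of a standard Gaussian. -/
def gaussExpSq : ℝ := ∫ x, Real.exp (x ^ 2 / 4) ∂(gaussianReal 0 1)

lemma one_le_gaussExpSq : 1 ≤ gaussExpSq := by
  have h : ∫ _x : ℝ, (1 : ℝ) ∂(gaussianReal 0 1) ≤ gaussExpSq :=
    integral_mono (integrable_const _) integrable_exp_sq_gaussian
      fun x => Real.one_le_exp (by positivity)
  simpa using h

lemma integral_id_std : ∫ x : ℝ, x ∂(gaussianReal 0 1) = 0 := integral_id_gaussianReal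

lemma integral_sq_std : ∫ x : ℝ, x ^ 2 ∂(gaussianReal 0 1) = 1 := by
  have h := variance_eq_sub (μ := gaussianReal 0 1) (memLp_id_gaussianReal (μ := 0) (v := 1) 2)
  rw [variance_id_gaussianReal] at h
  simp only [Pi.pow_apply, id, integral_id_gaussianReal] at h
  simpa using h.symm

lemma integral_abs_std_le : ∫ x : ℝ, |x| ∂(gaussianReal 0 1) ≤ 1 := by
  have h : ∫ x : ℝ, |x| ∂(gaussianReal 0 1) ≤ ∫ x : ℝ, (1 + x ^ 2) / 2 ∂(gaussianReal 0 1) := by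
    refine integral_mono integrable_id_gaussian.abs
      (((integrable_const 1).add integrable_sq_gaussian).div_const 2) fun x => ?_
    have := sq_nonneg (|x| - 1)
    have h2 := sq_abs x
    dsimp only
    nlinarith
  rw [integral_div, integral_add (integrable_const 1) integrable_sq_gaussian, integral_sq_std] at h
  simpa [one_add_one_eq_two] using h

lemma exp_le_quadratic (y : ℝ) : Real.exp y ≤ 1 + y + y ^ 2 * Real.exp |y| := by
  have h := Complex.norm_exp_sub_sum_le_norm_mul_exp (y : ℂ) 2
  have h2 : Complex.exp (y : ℂ) - ∑ m ∈ Finset.range 2, (y : ℂ) ^ m / (m.factorial : ℂ)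
      = ((Real.exp y - (1 + y) : ℝ) : ℂ) := by
    simp [Finset.sum_range_succ]
  rw [h2, Complex.norm_real, Complex.norm_real, Real.norm_eq_abs, Real.norm_eq_abs, sq_abs] at h
  have := (abs_le.1 h).2
  linarith

lemma integrable_of_quad {f : ℝ → ℝ} (hf : Measurable f) {K : ℝ}
    (hK : ∀ x, |f x| ≤ K * (1 + x ^ 2)) : Integrable f (gaussianReal 0 1) :=
  Integrable.mono' (((integrable_const 1).add integrable_sq_gaussian).const_mul K)
    hf.aestronglyMeasurable (Filter.Eventually.of_forall fun x => by simpa using hK x)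

lemma abs_integral_le_of_quad {f : ℝ → ℝ} {K : ℝ}
    (hK : ∀ x, |f x| ≤ K * (1 + x ^ 2)) : |∫ x, f x ∂(gaussianReal 0 1)| ≤ 2 * K := by
  have h := norm_integral_le_of_norm_le (μ := gaussianReal 0 1) (f := f)
    (((integrable_const 1).add integrable_sq_gaussian).const_mul K)
    (Filter.Eventually.of_forall fun x => by simpa using hK x)
  rw [integral_const_mul, Pi.add_def,
    integral_add (integrable_const 1) integrable_sq_gaussian, integral_sq_std] at h
  simp only [integral_const, probReal_univ, smul_eq_mul, mul_one, Real.norm_eq_abs] at h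
  linarith

lemma mgf_quad_bound {K : ℝ} (hK0 : 0 < K) :
    ∃ C : ℝ, 0 < C ∧ ∀ f : ℝ → ℝ, Measurable f → (∀ x, |f x| ≤ K * (1 + x ^ 2)) →
      ∀ s : ℝ, |s| ≤ 1 / (8 * K) →
        Integrable (fun x => Real.exp (s * (f x - ∫ y, f y ∂(gaussianReal 0 1))))
          (gaussianReal 0 1) ∧
        ∫ x, Real.exp (s * (f x - ∫ y, f y ∂(gaussianReal 0 1))) ∂(gaussianReal 0 1)
          ≤ Real.exp (C * s ^ 2) := by
  have hM := one_le_gaussExpSq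
  refine ⟨2 * (8 * K) ^ 2 * Real.exp (3 / 4) * gaussExpSq, by positivity, ?_⟩
  intro f hf hfK s hs
  set m := ∫ y, f y ∂(gaussianReal 0 1) with hm
  have hmK : |m| ≤ 2 * K := abs_integral_le_of_quad hfK
  have hint := integrable_of_quad hf hfK
  have hZ : ∀ x, |f x - m| ≤ K * (3 + x ^ 2) := fun x => by
    have := abs_sub (f x) m
    have := hfK x
    linarith
  have key : ∀ x, Real.exp (s * (f x - m)) ≤ 1 + s * (f x - m)
      + s ^ 2 * (2 * (8 * K) ^ 2 * Real.exp (3 / 4)) * Real.exp (x ^ 2 / 4) := by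
    intro x
    refine (exp_le_quadratic _).trans ?_
    have h1 : |s * (f x - m)| ≤ 1 / (8 * K) * |f x - m| := by
      rw [abs_mul]; gcongr
    set a := |f x - m| with ha
    have ha0 : 0 ≤ a := abs_nonneg _
    set y := 1 / (8 * K) * a with hy
    have hy0 : 0 ≤ y := by positivity
    have h2 : y ^ 2 ≤ 2 * Real.exp y := by
      have := Real.quadratic_le_exp_of_nonneg hy0
      nlinarith
    have h3 : y ≤ (3 + x ^ 2) / 8 := by
      rw [hy]
      calc 1 / (8 * K) * a ≤ 1 / (8 * K) * (K * (3 + x ^ 2)) := by gcongr; exact hZ x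
        _ = _ := by field_simp
    have h4 : (f x - m) ^ 2 = (8 * K) ^ 2 * y ^ 2 := by
      rw [← sq_abs, ← ha, hy]; field_simp
    have h5 : Real.exp y * Real.exp y ≤ Real.exp (3 / 4) * Real.exp (x ^ 2 / 4) := by
      rw [← Real.exp_add, ← Real.exp_add]
      apply Real.exp_le_exp.2
      linarith
    have : (s * (f x - m)) ^ 2 * Real.exp |s * (f x - m)| ≤
        s ^ 2 * (2 * (8 * K) ^ 2 * Real.exp (3 / 4)) * Real.exp (x ^ 2 / 4) := by
      calc (s * (f x - m)) ^ 2 * Real.exp |s * (f x - m)|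
          ≤ s ^ 2 * ((8 * K) ^ 2 * (2 * Real.exp y)) * Real.exp y := by
            rw [mul_pow, h4]; gcongr
        _ = s ^ 2 * (2 * (8 * K) ^ 2) * (Real.exp y * Real.exp y) := by ring
        _ ≤ s ^ 2 * (2 * (8 * K) ^ 2) * (Real.exp (3 / 4) * Real.exp (x ^ 2 / 4)) := by gcongr
        _ = _ := by ring
    linarith
  have hlin : Integrable (fun x => s * (f x - m)) (gaussianReal 0 1) :=
    (hint.sub (integrable_const m)).const_mul s
  have h1lin : Integrable (fun x => 1 + s * (f x - m)) (gaussianReal 0 1) :=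
    (integrable_const 1).add hlin
  have hrhs : Integrable (fun x => 1 + s * (f x - m)
      + s ^ 2 * (2 * (8 * K) ^ 2 * Real.exp (3 / 4)) * Real.exp (x ^ 2 / 4)) (gaussianReal 0 1) :=
    h1lin.add (integrable_exp_sq_gaussian.const_mul _)
  have hI : Integrable (fun x => Real.exp (s * (f x - m))) (gaussianReal 0 1) := by
    refine hrhs.mono' (by fun_prop) (Filter.Eventually.of_forall fun x => ?_)
    rw [Real.norm_eq_abs, Real.abs_exp]
    exact key x
  refine ⟨hI, (integral_mono hI hrhs key).trans ?_⟩
  rw [integral_add h1lin (integrable_exp_sq_gaussian.const_mul _),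
    integral_add (integrable_const 1) hlin, integral_const_mul, integral_const_mul,
    integral_sub hint (integrable_const m)]
  simp only [integral_const, probReal_univ, smul_eq_mul, one_mul, ← hm, sub_self, mul_zero,
    add_zero]
  have := Real.add_one_le_exp (2 * (8 * K) ^ 2 * Real.exp (3 / 4) * gaussExpSq * s ^ 2)
  have e : ∫ x, Real.exp (x ^ 2 / 4) ∂(gaussianReal 0 1) = gaussExpSq := rfl
  rw [e]
  linarith

lemma chernoff {α : Type*} [MeasurableSpace α] {μ : Measure α} [IsProbabilityMeasure μ]
    {f : α → ℝ} (hf : Integrable (fun x => Real.exp (f x)) μ) (t : ℝ) :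
    μ {x | t ≤ f x} ≤ ENNReal.ofReal (Real.exp (-t) * ∫ x, Real.exp (f x) ∂μ) := by
  have h := mul_meas_ge_le_integral_of_nonneg (μ := μ)
    (Filter.Eventually.of_forall fun x => (Real.exp_pos (f x)).le) hf (Real.exp t)
  simp only [Real.exp_le_exp] at h
  rw [← ofReal_measureReal]
  apply ENNReal.ofReal_le_ofReal
  rw [Real.exp_neg, inv_mul_eq_div, le_div_iff₀ (Real.exp_pos t), mul_comm]
  exact h

lemma integrable_exp_sum {ι : Type*} [Fintype ι] {f : ι → ℝ → ℝ}
    (hf : ∀ j, Integrable (fun x => Real.exp (f j x)) (gaussianReal 0 1)) :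
    Integrable (fun h : ι → ℝ => Real.exp (∑ j, f j (h j))) (stdPi ι) := by
  simp only [Real.exp_sum]
  exact Integrable.fintype_prod (f := fun j x => Real.exp (f j x)) hf

lemma integral_exp_sum {ι : Type*} [Fintype ι] (f : ι → ℝ → ℝ) :
    ∫ h : ι → ℝ, Real.exp (∑ j, f j (h j)) ∂(stdPi ι)
      = ∏ j, ∫ x, Real.exp (f j x) ∂(gaussianReal 0 1) := by
  simp only [Real.exp_sum]
  exact integral_fintype_prod_eq_prod (fun j x => Real.exp (f j x))

lemma chernoff_sum {ι : Type*} [Fintype ι] {f : ι → ℝ → ℝ} {B : ι → ℝ}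
    (hf : ∀ j, Integrable (fun x => Real.exp (f j x)) (gaussianReal 0 1))
    (hB : ∀ j, ∫ x, Real.exp (f j x) ∂(gaussianReal 0 1) ≤ Real.exp (B j)) (t : ℝ) :
    stdPi ι {h | t ≤ ∑ j, f j (h j)} ≤ ENNReal.ofReal (Real.exp (-t + ∑ j, B j)) := by
  refine (chernoff (integrable_exp_sum hf) t).trans (ENNReal.ofReal_le_ofReal ?_)
  rw [integral_exp_sum, Real.exp_add, Real.exp_sum]
  refine mul_le_mul_of_nonneg_left (Finset.prod_le_prod (fun j _ => ?_) fun j _ => hB j)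
    (Real.exp_pos _).le
  exact integral_nonneg fun x => (Real.exp_pos _).le

/-- Bernstein inequality for sums of independent functions of Gaussians of quadratic growth. -/
lemma gaussian_bernstein {K : ℝ} (hK0 : 0 < K) :
    ∃ c : ℝ, 0 < c ∧ ∀ (N : ℕ) (f : Fin N → ℝ → ℝ), (∀ j, Measurable (f j)) →
      (∀ j x, |f j x| ≤ K * (1 + x ^ 2)) → ∀ t : ℝ, 0 ≤ t → t ≤ 1 →
      stdPi (Fin N) {h | t * N ≤ |∑ j, f j (h j) - ∑ j, ∫ x, f j x ∂(gaussianReal 0 1)|}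
        ≤ ENNReal.ofReal (2 * Real.exp (-c * N * t ^ 2)) := by
  obtain ⟨C, hC, hmgf⟩ := mgf_quad_bound hK0
  set a := min (1 / (8 * K)) (1 / (2 * C)) with ha
  have ha0 : 0 < a := by positivity
  have ha1 : a ≤ 1 / (8 * K) := min_le_left _ _
  have ha2 : C * a ≤ 1 / 2 := by
    have : a ≤ 1 / (2 * C) := min_le_right _ _
    rw [le_div_iff₀ (by positivity)] at this
    linarith
  refine ⟨a / 2, by positivity, fun N f hf hfK t ht0 ht1 => ?_⟩
  set m : Fin N → ℝ := fun j => ∫ x, f j x ∂(gaussianReal 0 1) with hm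
  have oneside : ∀ s : ℝ, |s| = t * a →
      stdPi (Fin N) {h | |s| * (t * N) ≤ ∑ j, s * (f j (h j) - m j)}
        ≤ ENNReal.ofReal (Real.exp (-(a / 2) * N * t ^ 2)) := by
    intro s hs
    have hs' : |s| ≤ 1 / (8 * K) := by
      rw [hs]; exact (mul_le_of_le_one_left ha0.le ht1).trans ha1
    refine (chernoff_sum (f := fun j x => s * (f j x - m j)) (B := fun _ => C * s ^ 2)
      (fun j => (hmgf (f j) (hf j) (hfK j) s hs').1)
      (fun j => (hmgf (f j) (hf j) (hfK j) s hs').2) _).trans ?_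
    apply ENNReal.ofReal_le_ofReal
    apply Real.exp_le_exp.2
    rw [← sq_abs, hs]
    simp only [Finset.sum_const, Finset.card_univ, Fintype.card_fin, nsmul_eq_mul]
    have hN : (0 : ℝ) ≤ N := Nat.cast_nonneg N
    have h1 : 0 ≤ (1 / 2 - C * a) * (N * t ^ 2 * a) :=
      mul_nonneg (by linarith) (by positivity)
    nlinarith
  have hta : 0 ≤ t * a := by positivity
  by_cases hta0 : t = 0
  · subst hta0
    refine prob_le_one.trans ?_
    norm_num
  have htp : 0 < t * a := by positivity
  have h1 := oneside (t * a) (abs_of_nonneg hta)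
  have h2 := oneside (-(t * a)) (by rw [abs_neg, abs_of_nonneg hta])
  have hsub : {h : Fin N → ℝ | t * N ≤ |∑ j, f j (h j) - ∑ j, m j|} ⊆
      {h | |t * a| * (t * N) ≤ ∑ j, (t * a) * (f j (h j) - m j)} ∪
      {h | |-(t * a)| * (t * N) ≤ ∑ j, (-(t * a)) * (f j (h j) - m j)} := by
    intro h hh
    have hh' : t * N ≤ |∑ j, f j (h j) - ∑ j, m j| := hh
    rw [← Finset.sum_sub_distrib] at hh'
    rcases le_abs.1 hh' with h3 | h3
    · left
      have : |t * a| * (t * N) ≤ ∑ j, (t * a) * (f j (h j) - m j) := by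
        rw [abs_of_nonneg hta, ← Finset.mul_sum]; gcongr
      simpa using this
    · right
      have : |-(t * a)| * (t * N) ≤ ∑ j, (-(t * a)) * (f j (h j) - m j) := by
        rw [abs_neg, abs_of_nonneg hta, ← Finset.mul_sum, neg_mul, ← mul_neg]; gcongr
      simpa using this
  refine (measure_mono hsub).trans ((measure_union_le _ _).trans ((add_le_add h1 h2).trans ?_))
  rw [← ENNReal.ofReal_add (Real.exp_pos _).le (Real.exp_pos _).le]
  apply ENNReal.ofReal_le_ofReal
  linarith

/-- Gaussian tail bound. -/
lemma gaussian_tail (t : ℝ) (ht : 0 ≤ t) :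
    gaussianReal 0 1 {x : ℝ | t ≤ |x|}
      ≤ ENNReal.ofReal (gaussExpSq * Real.exp (-t ^ 2 / 4)) := by
  have h := chernoff integrable_exp_sq_gaussian (t ^ 2 / 4)
  have hs : {x : ℝ | t ≤ |x|} ⊆ {x : ℝ | t ^ 2 / 4 ≤ x ^ 2 / 4} := by
    intro x hx
    have hx' : t ≤ |x| := hx
    have : t ^ 2 / 4 ≤ x ^ 2 / 4 := by
      rw [← sq_abs x]; gcongr
    simpa using this
  refine (measure_mono hs).trans (h.trans (le_of_eq ?_))
  rw [mul_comm, gaussExpSq, neg_div]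

/-- Truncation of `x` to `[-b, b]`. -/
def clp (b x : ℝ) : ℝ := max (-b) (min x b)

lemma continuous_clp (b : ℝ) : Continuous (clp b) := by unfold clp; fun_prop

lemma eta_eq {b : ℝ} (hb : 0 ≤ b) (x : ℝ) : eta x b = x - clp b x := by
  unfold eta clp
  rcases lt_trichotomy x 0 with h | h | h
  · rw [Real.sign_of_neg h, abs_of_neg h, min_eq_left (by linarith)]
    rcases le_total (-x - b) 0 with h1 | h1
    · rw [max_eq_right h1, max_eq_right (by linarith)]; ring
    · rw [max_eq_left h1, max_eq_left (by linarith)]; ring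
  · subst h; simp [hb]
  · rw [Real.sign_of_pos h, abs_of_pos h, max_eq_right (a := -b) (le_min (by linarith) (by linarith))]
    rcases le_total (x - b) 0 with h1 | h1
    · rw [max_eq_right h1, min_eq_left (by linarith)]; ring
    · rw [max_eq_left h1, min_eq_right (by linarith)]; ring

lemma continuous_eta {b : ℝ} (hb : 0 ≤ b) : Continuous fun x => eta x b := by
  rw [funext (eta_eq hb)]
  exact continuous_id.sub (continuous_clp b)

lemma abs_clp_le {b : ℝ} (hb : 0 ≤ b) (x : ℝ) : |clp b x| ≤ b := by
  unfold clp
  exact abs_le.2 ⟨le_max_left _ _, max_le (by linarith) (min_le_right _ _)⟩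

lemma clp_of_le {b x : ℝ} (h : |x| ≤ b) : clp b x = x := by
  have := abs_le.1 h
  rw [clp, min_eq_left this.2, max_eq_right this.1]

lemma clp_of_ge {b x : ℝ} (hb : 0 ≤ b) (h : b ≤ x) : clp b x = b := by
  rw [clp, min_eq_right h, max_eq_right (by linarith)]

lemma clp_of_le_neg {b x : ℝ} (hb : 0 ≤ b) (h : x ≤ -b) : clp b x = -b := by
  rw [clp, min_eq_left (by linarith), max_eq_left h]

lemma eta_eq_relu {b : ℝ} (hb : 0 ≤ b) (x : ℝ) : eta x b = max (x - b) 0 - max (-x - b) 0 := by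
  rw [eta_eq hb]
  rcases le_total b x with h | h
  · rw [clp_of_ge hb h, max_eq_left (by linarith), max_eq_right (by linarith)]; ring
  · rcases le_total x (-b) with h' | h'
    · rw [clp_of_le_neg hb h', max_eq_right (by linarith), max_eq_left (by linarith)]; ring
    · rw [clp_of_le (abs_le.2 ⟨h', h⟩), max_eq_right (by linarith), max_eq_right (by linarith)]; ring

lemma abs_eta {b : ℝ} (hb : 0 ≤ b) (x : ℝ) : |eta x b| = max (|x| - b) 0 := by
  rw [eta_eq_relu hb]
  rcases le_total 0 x with h | h
  · rw [abs_of_nonneg h, max_eq_right (a := -x - b) (by linarith), sub_zero,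
      abs_of_nonneg (le_max_right _ _)]
  · rw [abs_of_nonpos h, max_eq_right (a := x - b) (by linarith), zero_sub, abs_neg,
      abs_of_nonneg (le_max_right _ _)]

lemma eta_mul_clp {b : ℝ} (hb : 0 ≤ b) (x : ℝ) : eta x b * clp b x = b * |eta x b| := by
  rw [eta_eq hb]
  rcases le_total b x with h | h
  · rw [clp_of_ge hb h, abs_of_nonneg (by linarith)]; ring
  · rcases le_total x (-b) with h' | h'
    · rw [clp_of_le_neg hb h', abs_of_nonpos (by linarith)]; ring
    · rw [clp_of_le (abs_le.2 ⟨h', h⟩)]; simp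

lemma abs_eta_sub_le {b : ℝ} (hb : 0 ≤ b) (x y : ℝ) : |eta x b - eta y b| ≤ |x - y| := by
  rw [eta_eq hb, eta_eq hb]
  have key : ∀ u v : ℝ, u ≤ v → 0 ≤ (v - clp b v) - (u - clp b u) ∧
      (v - clp b v) - (u - clp b u) ≤ v - u := by
    intro u v huv
    have h1 : clp b u ≤ clp b v := by unfold clp; gcongr
    refine ⟨?_, by linarith⟩
    unfold clp
    rcases max_cases (-b) (min v b) with h | h <;> rcases max_cases (-b) (min u b) with h' | h' <;>
      rcases min_cases v b with h2 | h2 <;> rcases min_cases u b with h3 | h3 <;> linarith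
  rcases le_total x y with h | h
  · have := key x y h
    rw [abs_sub_comm, abs_of_nonneg this.1, abs_sub_comm, abs_of_nonneg (by linarith)]
    exact this.2
  · have := key y x h
    rw [abs_of_nonneg this.1, abs_of_nonneg (by linarith)]
    exact this.2

lemma abs_eta_add_sub_le {b τ : ℝ} (hb : 0 ≤ b) (hτ : 0 ≤ τ) (θ x : ℝ) :
    |eta (θ + τ * x) b - θ| ≤ b + τ * |x| := by
  rw [eta_eq hb]
  have h1 := abs_clp_le hb (θ + τ * x)
  have h2 : |τ * x| = τ * |x| := by rw [abs_mul, abs_of_nonneg hτ]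
  calc |θ + τ * x - clp b (θ + τ * x) - θ| = |τ * x - clp b (θ + τ * x)| := by ring_nf
    _ ≤ |τ * x| + |clp b (θ + τ * x)| := abs_sub _ _
    _ ≤ _ := by linarith

lemma measurable_eta' (b : ℝ) : Measurable fun x => eta' x b := by
  unfold eta'
  exact Measurable.ite (measurableSet_lt measurable_const measurable_id.abs) measurable_const
    measurable_const

lemma eta'_nonneg (x b : ℝ) : 0 ≤ eta' x b := by unfold eta'; split_ifs <;> norm_num

lemma eta'_le_one (x b : ℝ) : eta' x b ≤ 1 := by unfold eta'; split_ifs <;> norm_num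

lemma empDist_prod {N : ℕ} (θ : Fin N → ℝ) (ν : Measure ℝ) [IsProbabilityMeasure ν] :
    (empDist θ).prod ν
      = ((N : ℝ≥0∞))⁻¹ • ∑ i : Fin N, ν.map (fun x => (θ i, x)) := by
  unfold empDist
  rw [Measure.prod_smul_left, ← Measure.sum_fintype, Measure.prod_sum_left, Measure.sum_fintype]
  congr 1
  exact Finset.sum_congr rfl fun i _ => Measure.dirac_prod _

lemma integral_empDist_prod {N : ℕ} (θ : Fin N → ℝ) {F : ℝ × ℝ → ℝ} (hF : Measurable F)
    (hint : ∀ j, Integrable (fun x => F (θ j, x)) (gaussianReal 0 1)) :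
    ∫ q, F q ∂((empDist θ).prod stdG)
      = (1 / (N : ℝ)) * ∑ j, ∫ x, F (θ j, x) ∂(gaussianReal 0 1) := by
  have hm : ∀ j, Measurable (fun x : ℝ => (θ j, x)) := fun j => measurable_prodMk_left
  unfold stdG
  rw [empDist_prod, integral_smul_measure, integral_finsetSum_measure]
  · simp only [smul_eq_mul, one_div, ENNReal.toReal_inv, ENNReal.toReal_natCast]
    congr 1
    refine Finset.sum_congr rfl fun j _ => ?_
    rw [integral_map (hm j).aemeasurable hF.aestronglyMeasurable]
  · intro j _
    rw [integrable_map_measure hF.aestronglyMeasurable (hm j).aemeasurable]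
    exact hint j

/-- Stein's identity for the positive part. -/
lemma stein_relu (a : ℝ) :
    ∫ x, x * max (x - a) 0 ∂(gaussianReal 0 1)
      = ∫ x, (if a < x then (1 : ℝ) else 0) ∂(gaussianReal 0 1) := by
  have hI1 : Integrable (fun x => gaussianPDFReal 0 1 x) := integrable_gaussianPDFReal 0 1
  have hq : Integrable (fun x => x * (x - a)) (gaussianReal 0 1) := by
    have := integrable_sq_gaussian.sub (integrable_id_gaussian.mul_const a)
    refine this.congr (Filter.Eventually.of_forall fun x => ?_)
    simp only [Pi.sub_apply]; ring
  have hI2 := (integrable_gaussian_iff _).1 hq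
  have hI3 := (integrable_gaussian_iff _).1 (integrable_id_gaussian.sub (integrable_const a))
  have hderiv : ∀ x : ℝ, HasDerivAt (fun x => gaussianPDFReal 0 1 x * (x - a))
      (gaussianPDFReal 0 1 x - gaussianPDFReal 0 1 x * (x * (x - a))) x := by
    intro x
    have := (hasDerivAt_gaussianPDFReal x).mul ((hasDerivAt_id x).sub_const a)
    refine this.congr_deriv ?_
    simp; ring
  have hint : Integrable (fun x => gaussianPDFReal 0 1 x - gaussianPDFReal 0 1 x * (x * (x - a))) :=
    hI1.sub hI2
  have hlim := tendsto_zero_of_hasDerivAt_of_integrableOn_Ioi (a := a)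
    (fun x _ => hderiv x) hint.integrableOn hI3.integrableOn
  have h := integral_Ioi_of_hasDerivAt_of_tendsto' (a := a) (fun x _ => hderiv x)
    hint.integrableOn hlim
  rw [integral_sub hI1.integrableOn hI2.integrableOn] at h
  simp only [sub_self, mul_zero] at h
  rw [integral_gaussian_eq, integral_gaussian_eq]
  have e1 : (fun x => gaussianPDFReal 0 1 x * (x * max (x - a) 0))
      = (Set.Ioi a).indicator fun x => gaussianPDFReal 0 1 x * (x * (x - a)) := by
    funext x
    by_cases hx : a < x
    · rw [Set.indicator_of_mem (by simpa using hx), max_eq_left (by linarith)]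
    · rw [Set.indicator_of_notMem (by simpa using hx), max_eq_right (by linarith)]; simp
  have e2 : (fun x => gaussianPDFReal 0 1 x * (if a < x then (1 : ℝ) else 0))
      = (Set.Ioi a).indicator fun x => gaussianPDFReal 0 1 x := by
    funext x
    by_cases hx : a < x
    · rw [Set.indicator_of_mem (by simpa using hx)]; simp [hx]
    · rw [Set.indicator_of_notMem (by simpa using hx)]; simp [hx]
  rw [e1, e2, integral_indicator measurableSet_Ioi, integral_indicator measurableSet_Ioi]
  linarith

lemma integral_gaussian_neg (f : ℝ → ℝ) (hf : Measurable f) :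
    ∫ x, f (-x) ∂(gaussianReal 0 1) = ∫ x, f x ∂(gaussianReal 0 1) := by
  have h := gaussianReal_map_neg (μ := 0) (v := 1)
  rw [neg_zero] at h
  conv_rhs => rw [← h, integral_map measurable_neg.aemeasurable hf.aestronglyMeasurable]

/-- Stein's identity for soft thresholding. -/
lemma stein_eta {b τ : ℝ} (hb : 0 ≤ b) (hτ : 0 < τ) (θ : ℝ) :
    ∫ x, x * (eta (θ + τ * x) b - θ) ∂(gaussianReal 0 1)
      = τ * ∫ x, eta' (θ + τ * x) b ∂(gaussianReal 0 1) := by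
  set a₁ := (b - θ) / τ with ha₁
  set a₂ := (b + θ) / τ with ha₂
  have hr : ∀ a : ℝ, Integrable (fun x => x * max (x - a) 0) (gaussianReal 0 1) := fun a => by
    refine integrable_of_quad (by fun_prop) (K := 2 + |a|) fun x => ?_
    rw [abs_mul]
    have h1 : |max (x - a) 0| ≤ |x| + |a| := by
      rw [abs_of_nonneg (le_max_right _ _)]
      exact max_le (by linarith [le_abs_self x, neg_abs_le a]) (by positivity)
    have h2 := sq_abs x
    have h3 := abs_nonneg x
    have h4 := abs_nonneg a
    calc |x| * |max (x - a) 0| ≤ |x| * (|x| + |a|) := by gcongr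
      _ ≤ _ := by nlinarith [mul_nonneg h4 (sq_nonneg (|x| - 1)), sq_nonneg (|x| - 1), mul_nonneg h4 (sq_nonneg |x|)]
  have hr' : Integrable (fun x => x * max (-x - a₂) 0) (gaussianReal 0 1) := by
    have h := (gaussianReal_map_neg (μ := 0) (v := 1))
    rw [neg_zero] at h
    have h2 := hr a₂
    rw [← h, integrable_map_measure (by fun_prop) (by fun_prop)] at h2
    refine h2.neg.congr (Filter.Eventually.of_forall fun x => ?_)
    simp
  have e1 : ∀ x, x * (eta (θ + τ * x) b - θ)
      = τ * (x * max (x - a₁) 0) - τ * (x * max (-x - a₂) 0) - θ * x := by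
    intro x
    rw [eta_eq_relu hb]
    have h1 : max (θ + τ * x - b) 0 = τ * max (x - a₁) 0 := by
      rw [mul_max_of_nonneg _ _ hτ.le, mul_zero, ha₁]
      congr 1; field_simp; ring
    have h2 : max (-(θ + τ * x) - b) 0 = τ * max (-x - a₂) 0 := by
      rw [mul_max_of_nonneg _ _ hτ.le, mul_zero, ha₂]
      congr 1; field_simp; ring
    rw [h1, h2]; ring
  have e2 : ∀ x, eta' (θ + τ * x) b
      = (if a₁ < x then (1 : ℝ) else 0) + (if a₂ < -x then (1 : ℝ) else 0) := by
    intro x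
    unfold eta'
    have h1 : a₁ < x ↔ b < θ + τ * x := by
      rw [ha₁, div_lt_iff₀ hτ]; constructor <;> intro h <;> linarith
    have h2 : a₂ < -x ↔ b < -(θ + τ * x) := by
      rw [ha₂, div_lt_iff₀ hτ]; constructor <;> intro h <;> linarith
    simp only [h1, h2, lt_abs]
    by_cases c1 : b < θ + τ * x
    · have c2 : ¬ b < -(θ + τ * x) := by linarith
      rw [if_pos (Or.inl c1), if_pos c1, if_neg c2, add_zero]
    · simp only [c1, false_or, if_false, zero_add]
  have m1 : ∀ a : ℝ, Measurable (fun x : ℝ => if a < x then (1 : ℝ) else 0) := fun a =>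
    Measurable.ite measurableSet_Ioi measurable_const measurable_const
  have i1 : ∀ a : ℝ, Integrable (fun x : ℝ => if a < x then (1 : ℝ) else 0) (gaussianReal 0 1) :=
    fun a => integrable_of_quad (m1 a) (K := 1) fun x => by
      split_ifs <;> simp <;> nlinarith [sq_nonneg x]
  have i2 : ∀ a : ℝ, Integrable (fun x : ℝ => if a < -x then (1 : ℝ) else 0) (gaussianReal 0 1) :=
    fun a => integrable_of_quad ((m1 a).comp measurable_neg) (K := 1) fun x => by
      split_ifs <;> simp <;> nlinarith [sq_nonneg x]
  simp only [e1, e2]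
  rw [integral_add (i1 a₁) (i2 a₂), integral_gaussian_neg _ (m1 a₂), integral_sub, integral_sub,
    integral_const_mul, integral_const_mul, integral_const_mul, integral_id_std, stein_relu,
    ← stein_relu a₂]
  · have := integral_gaussian_neg (fun x => x * max (x - a₂) 0) (by fun_prop)
    simp only [neg_mul, integral_neg] at this
    rw [← this]; ring
  · exact (hr a₁).const_mul τ
  · exact hr'.const_mul τ
  · exact ((hr a₁).const_mul τ).sub (hr'.const_mul τ)
  · exact integrable_id_gaussian.const_mul θ

lemma sq_shift_sub_le {b τ : ℝ} (hb : 0 ≤ b) (hτ : 0 ≤ τ) (θ x : ℝ) :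
    |(eta (θ + τ * x) b - θ) ^ 2| ≤ (2 * (b ^ 2 + τ ^ 2)) * (1 + x ^ 2) := by
  have h := abs_eta_add_sub_le hb hτ θ x
  rw [abs_pow]
  calc |eta (θ + τ * x) b - θ| ^ 2 ≤ (b + τ * |x|) ^ 2 := by gcongr
    _ ≤ _ := by
      have := sq_abs x
      nlinarith [sq_nonneg (b - τ * |x|), mul_nonneg (sq_nonneg b) (sq_nonneg x), sq_nonneg τ]

lemma mul_shift_sub_le {b τ : ℝ} (hb : 0 ≤ b) (hτ : 0 ≤ τ) (θ x : ℝ) :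
    |x * (eta (θ + τ * x) b - θ)| ≤ (b + τ) * (1 + x ^ 2) := by
  have h := abs_eta_add_sub_le hb hτ θ x
  rw [abs_mul]
  calc |x| * |eta (θ + τ * x) b - θ| ≤ |x| * (b + τ * |x|) := by gcongr
    _ ≤ _ := by
      have := sq_abs x
      nlinarith [mul_nonneg hb (sq_nonneg (|x| - 1)), mul_nonneg hb (sq_nonneg x)]

lemma continuous_eta_shift {b : ℝ} (hb : 0 ≤ b) (θ τ : ℝ) :
    Continuous fun x => eta (θ + τ * x) b :=
  (continuous_eta hb).comp (by fun_prop)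

lemma integrable_sq_shift {b τ : ℝ} (hb : 0 ≤ b) (hτ : 0 ≤ τ) (θ : ℝ) :
    Integrable (fun x => (eta (θ + τ * x) b - θ) ^ 2) (gaussianReal 0 1) :=
  integrable_of_quad (((continuous_eta_shift hb θ τ).sub continuous_const).pow 2).measurable
    (sq_shift_sub_le hb hτ θ)

lemma integrable_mul_shift {b τ : ℝ} (hb : 0 ≤ b) (hτ : 0 ≤ τ) (θ : ℝ) :
    Integrable (fun x => x * (eta (θ + τ * x) b - θ)) (gaussianReal 0 1) :=
  integrable_of_quad (by have := continuous_eta_shift hb θ τ; fun_prop) (mul_shift_sub_le hb hτ θ)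

lemma integrable_eta'_shift (b τ θ : ℝ) :
    Integrable (fun x => eta' (θ + τ * x) b) (gaussianReal 0 1) :=
  integrable_of_quad ((measurable_eta' b).comp (by fun_prop)) (K := 1) fun x => by
    rw [abs_of_nonneg (eta'_nonneg _ _)]
    nlinarith [eta'_le_one (θ + τ * x) b, sq_nonneg x]

section StateEvolution
variable {N : ℕ} {δ σ lam β τ : ℝ} {θ : Fin N → ℝ}

lemma StateEvo.sum_sq (hδ : 0 < δ) (hN : 0 < N) (hlam : 0 < lam)
    (h : StateEvo δ σ (empDist θ) lam β τ) :
    ∑ j, ∫ x, (eta (θ j + τ * x) (τ * lam / β) - θ j) ^ 2 ∂(gaussianReal 0 1)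
      = δ * N * (τ ^ 2 - σ ^ 2) := by
  obtain ⟨hβ, hτ, h1, -⟩ := h
  have hb : 0 ≤ τ * lam / β := by positivity
  rw [integral_empDist_prod] at h1
  · rw [h1]
    have : (0 : ℝ) < N := by exact_mod_cast hN
    field_simp
    ring
  · have := continuous_eta hb
    have h2 : Continuous fun q : ℝ × ℝ => eta (q.1 + τ * q.2) (τ * lam / β) :=
      this.comp (by fun_prop)
    fun_prop
  · exact fun j => integrable_sq_shift hb hτ.le (θ j)

lemma StateEvo.sum_eta' (hδ : 0 < δ) (hN : 0 < N)
    (h : StateEvo δ σ (empDist θ) lam β τ) :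
    τ * ∑ j, ∫ x, eta' (θ j + τ * x) (τ * lam / β) ∂(gaussianReal 0 1)
      = δ * N * (τ - β) := by
  obtain ⟨hβ, hτ, -, h2⟩ := h
  rw [integral_empDist_prod] at h2
  · have : (0 : ℝ) < N := by exact_mod_cast hN
    generalize (∑ j, ∫ x, eta' (θ j + τ * x) (τ * lam / β) ∂(gaussianReal 0 1)) = S at *
    rw [h2]
    field_simp
    ring
  · exact (measurable_eta' _).comp (by fun_prop)
  · exact fun j => integrable_eta'_shift _ _ _

lemma StateEvo.sum_mul (hδ : 0 < δ) (hN : 0 < N) (hlam : 0 < lam)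
    (h : StateEvo δ σ (empDist θ) lam β τ) :
    ∑ j, ∫ x, x * (eta (θ j + τ * x) (τ * lam / β) - θ j) ∂(gaussianReal 0 1)
      = δ * N * (τ - β) := by
  rw [← h.sum_eta' hδ hN, Finset.mul_sum]
  obtain ⟨hβ, hτ, -, -⟩ := h
  exact Finset.sum_congr rfl fun j _ => stein_eta (by positivity) hτ (θ j)

lemma StateEvo.beta_le_tau (hδ : 0 < δ) (hN : 0 < N)
    (h : StateEvo δ σ (empDist θ) lam β τ) : β ≤ τ := by
  have h1 := h.sum_eta' hδ hN
  have h2 : 0 ≤ τ * ∑ j, ∫ x, eta' (θ j + τ * x) (τ * lam / β) ∂(gaussianReal 0 1) :=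
    mul_nonneg h.2.1.le (Finset.sum_nonneg fun j _ => integral_nonneg fun x => eta'_nonneg _ _)
  rw [h1] at h2
  have : (0 : ℝ) < δ * N := by have : (0 : ℝ) < N := by exact_mod_cast hN
                               positivity
  have := nonneg_of_mul_nonneg_right h2 this
  linarith

lemma StateEvo.sigma_le_tau (hδ : 0 < δ) (hN : 0 < N) (hlam : 0 < lam)
    (h : StateEvo δ σ (empDist θ) lam β τ) : σ ≤ τ := by
  have h1 := h.sum_sq hδ hN hlam
  have h2 : 0 ≤ ∑ j, ∫ x, (eta (θ j + τ * x) (τ * lam / β) - θ j) ^ 2 ∂(gaussianReal 0 1) :=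
    Finset.sum_nonneg fun j _ => integral_nonneg fun x => sq_nonneg _
  rw [h1] at h2
  have : (0 : ℝ) < δ * N := by have : (0 : ℝ) < N := by exact_mod_cast hN
                               positivity
  have := nonneg_of_mul_nonneg_right h2 this
  exact (le_abs_self _).trans (abs_le_of_sq_le_sq (by linarith) h.2.1.le)

end StateEvolution

lemma Fball_count {N : ℕ} (hN : 0 < N) {p ξ s : ℝ} (hp : 0 < p) (hξ : 0 < ξ) (hs : 0 < s)
    {θ : Fin N → ℝ} (hθ : θ ∈ Fball N p ξ) :
    ∑ j, (if s < |θ j| then (1 : ℝ) else 0) ≤ N * (ξ / s) ^ p := by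
  have hN' : (0 : ℝ) < N := by exact_mod_cast hN
  have h1 : (1 / (N : ℝ)) * ∑ i, |θ i| ^ p ≤ ξ ^ p := hθ
  rw [one_div, inv_mul_le_iff₀ hN'] at h1
  rw [Real.div_rpow hξ.le hs.le, ← mul_div_assoc, le_div_iff₀ (Real.rpow_pos_of_pos hs p),
    Finset.sum_mul]
  refine le_trans (Finset.sum_le_sum fun j _ => ?_) h1
  split_ifs with h
  · rw [one_mul]; gcongr
  · rw [zero_mul]; positivity

lemma exists_level {p ξ q : ℝ} (hp : 0 < p) (hξ : 0 < ξ) (hq : 0 < q) :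
    ∃ s₀ : ℝ, 0 < s₀ ∧ ∀ s, s₀ ≤ s → (ξ / s) ^ p ≤ q := by
  have hq' : 0 < q ^ p⁻¹ := by positivity
  refine ⟨ξ / q ^ p⁻¹, by positivity, fun s hs => ?_⟩
  have hs0 : 0 < s := lt_of_lt_of_le (by positivity) hs
  have : ξ / s ≤ q ^ p⁻¹ := by
    rw [div_le_iff₀ hq'] at hs
    rw [div_le_iff₀ hs0]; linarith
  calc (ξ / s) ^ p ≤ (q ^ p⁻¹) ^ p := by gcongr
    _ = q := Real.rpow_inv_rpow hq.le hp.ne'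

lemma integral_excess_pos (A : ℝ) : 0 < ∫ x, max (|x| - A) 0 ∂(gaussianReal 0 1) := by
  have hi : Integrable (fun x : ℝ => max (|x| - A) 0) (gaussianReal 0 1) :=
    (integrable_id_gaussian.abs.sub (integrable_const A)).pos_part
  refine (integral_pos_iff_support_of_nonneg (f := fun x : ℝ => max (|x| - A) 0)
    (fun x => le_max_right _ _) hi).2 ?_
  have hsub : Set.Ioo (max A 0) (max A 0 + 1) ⊆ Function.support fun x : ℝ => max (|x| - A) 0 := by
    intro x hx
    have h1 : A < x := (le_max_left A 0).trans_lt hx.1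
    have h2 : A < |x| := h1.trans_le (le_abs_self x)
    rw [Function.mem_support, max_eq_left (by linarith)]
    linarith
  refine lt_of_lt_of_le ?_ (measure_mono hsub)
  rw [pos_iff_ne_zero]
  intro h0
  have := gaussianReal_absolutelyContinuous' (0 : ℝ) (v := 1) one_ne_zero h0
  simp at this

/-- Uniform bounds on the state evolution fixed point. -/
lemma exists_state_bounds {δ σ lmin lmax p ξ : ℝ} (hδ : 0 < δ) (hσ : 0 < σ) (hl : 0 < lmin)
    (hp : 0 < p) (hξ : 0 < ξ) :
    ∃ bmin tmax : ℝ, 0 < bmin ∧ 0 < tmax ∧ ∀ N : ℕ, 0 < N → ∀ lam ∈ Set.Icc lmin lmax,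
      ∀ θ ∈ Fball N p ξ, ∀ β τ : ℝ, StateEvo δ σ (empDist θ) lam β τ →
        bmin ≤ β ∧ τ ≤ tmax := by
  obtain ⟨s₀, hs₀, hlev₀⟩ := exists_level hp hξ (q := δ / 4) (by positivity)
  set A := max (2 * s₀ / σ) (16 / δ + 1) with hA
  set M := max A (2 * lmax / σ) with hM
  have hA1 : 1 < A := lt_of_lt_of_le (by linarith [show 0 < 16 / δ by positivity]) (le_max_right _ _)
  have hM0 : 0 < M := lt_of_lt_of_le (by linarith) (le_max_left _ _)
  set m := ∫ x, max (|x| - M) 0 ∂(gaussianReal 0 1) with hm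
  have hm0 : 0 < m := integral_excess_pos M
  obtain ⟨s₁, hs₁, hlev₁⟩ := exists_level hp hξ (q := (m / 2) / (M + 1 + m / 2)) (by positivity)
  refine ⟨lmin / M, max (4 * s₁ / m) (σ ^ 2 / (lmin / M)), by positivity, by positivity, ?_⟩
  intro N hN lam hlam θ hθ β τ hS
  have hN' : (0 : ℝ) < N := by exact_mod_cast hN
  have hlam0 : 0 < lam := hl.trans_le hlam.1
  have hβ := hS.1
  have hτ := hS.2.1
  have hστ := hS.sigma_le_tau hδ hN hlam0
  set b := τ * lam / β with hb
  have hb0 : 0 < b := by positivity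
  -- the threshold ratio is bounded
  have hα : lam / β ≤ M := by
    by_contra hlt
    push Not at hlt
    have hAlt : A < lam / β := (le_max_left _ _).trans_lt hlt
    have hbA : A * τ ≤ b := by
      rw [hb, mul_comm τ lam, mul_div_right_comm]; gcongr
    have hP : ∑ j, ∫ x, eta' (θ j + τ * x) b ∂(gaussianReal 0 1) ≤ N * (δ / 2) := by
      have hj : ∀ j, ∫ x, eta' (θ j + τ * x) b ∂(gaussianReal 0 1)
          ≤ (if b / 2 < |θ j| then (1 : ℝ) else 0) + 4 * τ ^ 2 / b ^ 2 := by
        intro j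
        have hpt : ∀ x, eta' (θ j + τ * x) b
            ≤ (if b / 2 < |θ j| then (1 : ℝ) else 0) + 4 * τ ^ 2 / b ^ 2 * x ^ 2 := by
          intro x
          have hnn : 0 ≤ 4 * τ ^ 2 / b ^ 2 * x ^ 2 := by positivity
          split_ifs with hc
          · linarith [eta'_le_one (θ j + τ * x) b]
          · unfold eta'
            split_ifs with hc2
            · rw [zero_add, div_mul_eq_mul_div, le_div_iff₀ (by positivity), one_mul]
              have h1 := abs_add_le (θ j) (τ * x)
              rw [abs_mul, abs_of_pos hτ] at h1
              have h2 : b / 2 ≤ τ * |x| := by linarith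
              have h3 : (b / 2) ^ 2 ≤ (τ * |x|) ^ 2 := by gcongr
              rw [mul_pow, sq_abs] at h3
              linarith
            · linarith
        have hi : Integrable (fun x : ℝ => 4 * τ ^ 2 / b ^ 2 * x ^ 2) (gaussianReal 0 1) :=
          integrable_sq_gaussian.const_mul _
        refine (integral_mono (integrable_eta'_shift _ _ _)
          ((integrable_const _).add hi) hpt).trans (le_of_eq ?_)
        rw [Pi.add_def, integral_add (integrable_const _) hi, integral_const_mul, integral_sq_std]
        simp
      refine (Finset.sum_le_sum fun j _ => hj j).trans ?_
      rw [Finset.sum_add_distrib]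
      have h1 := Fball_count hN hp hξ (s := b / 2) (by positivity) hθ
      have h2 : (ξ / (b / 2)) ^ p ≤ δ / 4 := by
        apply hlev₀
        have : 2 * s₀ / σ ≤ A := le_max_left _ _
        rw [div_le_iff₀ hσ] at this
        have : A * σ ≤ A * τ := by gcongr
        linarith
      have h3 : 4 * τ ^ 2 / b ^ 2 ≤ δ / 4 := by
        have h4 : A ^ 2 * τ ^ 2 ≤ b ^ 2 := by
          rw [← mul_pow]; gcongr
        have h5 : 16 / δ ≤ A := by
          have : 16 / δ + 1 ≤ A := le_max_right _ _
          linarith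
        rw [div_le_iff₀ hδ] at h5
        have h6 : A * δ ≤ A ^ 2 * δ := by nlinarith
        rw [div_le_iff₀ (by positivity)]
        have h7 : δ * (A ^ 2 * τ ^ 2) ≤ δ * b ^ 2 := by gcongr
        have h8 : 16 * τ ^ 2 ≤ A ^ 2 * δ * τ ^ 2 := by
          gcongr; linarith
        linarith
      simp only [Finset.sum_const, Finset.card_univ, Fintype.card_fin, nsmul_eq_mul]
      have : (N : ℝ) * (ξ / (b / 2)) ^ p ≤ N * (δ / 4) := by gcongr
      have : (N : ℝ) * (4 * τ ^ 2 / b ^ 2) ≤ N * (δ / 4) := by gcongr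
      linarith
    have h1 := hS.sum_eta' hδ hN
    have h2 : τ * ∑ j, ∫ x, eta' (θ j + τ * x) b ∂(gaussianReal 0 1) ≤ τ * (N * (δ / 2)) := by
      gcongr
    rw [h1] at h2
    have h3 : τ / 2 ≤ β := by
      have h4 : (δ * N) * (τ - β) ≤ (δ * N) * (τ / 2) := by linarith
      have := le_of_mul_le_mul_left h4 (by positivity)
      linarith
    have h5 : 2 * lmax / σ < lam / β := (le_max_right _ _).trans_lt hlt
    rw [div_lt_div_iff₀ hσ hβ] at h5
    have : lam * σ ≤ lmax * σ := by gcongr; exact hlam.2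
    have : lmax * (σ / 2) ≤ lmax * β := by
      have : 0 < lmax := hlam0.trans_le hlam.2
      gcongr; linarith
    linarith
  have hβmin : lmin / M ≤ β := by
    rw [div_le_iff₀ hM0]
    rw [div_le_iff₀ hβ] at hα
    linarith [hlam.1]
  refine ⟨hβmin, ?_⟩
  by_contra hlt
  push Not at hlt
  have hbM : b ≤ M * τ := by
    rw [hb, mul_comm τ lam, mul_div_right_comm]; gcongr
  have hτ1 : s₁ ≤ τ * m / 4 := by
    have : 4 * s₁ / m < τ := (le_max_left _ _).trans_lt hlt
    rw [div_lt_iff₀ hm0] at this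
    linarith
  have hτ2 : σ ^ 2 < τ * β := by
    have : σ ^ 2 / (lmin / M) < τ := (le_max_right _ _).trans_lt hlt
    rw [div_lt_iff₀ (by positivity)] at this
    exact this.trans_le (by gcongr)
  set J : Fin N → ℝ := fun j =>
    ∫ x, ((eta (θ j + τ * x) b - θ j) ^ 2 - τ * (x * (eta (θ j + τ * x) b - θ j)))
      ∂(gaussianReal 0 1) with hJ
  have hsum : ∑ j, J j = δ * N * (τ * β - σ ^ 2) := by
    have : ∀ j, J j = (∫ x, (eta (θ j + τ * x) b - θ j) ^ 2 ∂(gaussianReal 0 1))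
        - τ * ∫ x, x * (eta (θ j + τ * x) b - θ j) ∂(gaussianReal 0 1) := fun j => by
      rw [hJ, ← integral_const_mul, ← integral_sub (integrable_sq_shift hb0.le hτ.le _)
        ((integrable_mul_shift hb0.le hτ.le _).const_mul τ)]
    simp only [this]
    rw [Finset.sum_sub_distrib, ← Finset.mul_sum, hS.sum_sq hδ hN hlam0,
      hS.sum_mul hδ hN hlam0]
    ring
  have hident : ∀ θ x : ℝ, (eta (θ + τ * x) b - θ) ^ 2 - τ * (x * (eta (θ + τ * x) b - θ))
      = θ * clp b (θ + τ * x) - b * |eta (θ + τ * x) b| := by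
    intro θ x
    rw [← eta_mul_clp hb0.le, eta_eq hb0.le]
    ring
  have hiJ : ∀ j, Integrable (fun x => (eta (θ j + τ * x) b - θ j) ^ 2
      - τ * (x * (eta (θ j + τ * x) b - θ j))) (gaussianReal 0 1) := fun j =>
    (integrable_sq_shift hb0.le hτ.le _).sub ((integrable_mul_shift hb0.le hτ.le _).const_mul τ)
  have hiabs : Integrable (fun x : ℝ => |x|) (gaussianReal 0 1) := integrable_id_gaussian.abs
  have hiex : Integrable (fun x : ℝ => max (|x| - M) 0) (gaussianReal 0 1) :=
    (hiabs.sub (integrable_const M)).pos_part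
  have hJ1 : ∀ j, J j ≤ b * τ * (M + 1) := by
    intro j
    have hpt : ∀ x, (eta (θ j + τ * x) b - θ j) ^ 2 - τ * (x * (eta (θ j + τ * x) b - θ j))
        ≤ b ^ 2 + b * τ * |x| := by
      intro x
      rw [hident]
      set Y := θ j + τ * x with hY
      have e1 : θ j = Y - τ * x := by rw [hY]; ring
      rw [e1, sub_mul]
      have h1 : Y * clp b Y - b * |eta Y b| ≤ b ^ 2 := by
        have h2 : Y = eta Y b + clp b Y := by rw [eta_eq hb0.le]; ring
        have h3 : Y * clp b Y = eta Y b * clp b Y + clp b Y ^ 2 := by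
          conv_lhs => rw [h2, add_mul]
          rw [← h2]; ring
        rw [h3, eta_mul_clp hb0.le]
        have := abs_clp_le hb0.le Y
        have : clp b Y ^ 2 ≤ b ^ 2 := by rw [← sq_abs]; gcongr
        linarith
      have h2 : -(τ * x * clp b Y) ≤ b * τ * |x| := by
        refine (neg_le_abs _).trans ?_
        rw [abs_mul, abs_mul, abs_of_pos hτ]
        have := abs_clp_le hb0.le Y
        calc τ * |x| * |clp b Y| ≤ τ * |x| * b := by gcongr
          _ = _ := by ring
      linarith
    have h1 := integral_mono (hiJ j) ((integrable_const (b ^ 2)).add (hiabs.const_mul (b * τ))) hpt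
    rw [Pi.add_def, integral_add (integrable_const _) (hiabs.const_mul _), integral_const_mul] at h1
    have h2 : b * τ * ∫ x : ℝ, |x| ∂(gaussianReal 0 1) ≤ b * τ * 1 := by
      gcongr; exact integral_abs_std_le
    simp only [integral_const, probReal_univ, smul_eq_mul, one_mul] at h1
    have h3 : b * b ≤ b * (M * τ) := by gcongr
    have h4 : J j = ∫ x, ((eta (θ j + τ * x) b - θ j) ^ 2
      - τ * (x * (eta (θ j + τ * x) b - θ j))) ∂(gaussianReal 0 1) := rfl
    rw [h4]
    linarith
  have hJ2 : ∀ j, J j ≤ b * (2 * |θ j| - τ * m) := by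
    intro j
    have hpt : ∀ x, (eta (θ j + τ * x) b - θ j) ^ 2 - τ * (x * (eta (θ j + τ * x) b - θ j))
        ≤ 2 * b * |θ j| - b * τ * max (|x| - M) 0 := by
      intro x
      rw [hident]
      set Y := θ j + τ * x with hY
      have h1 : θ j * clp b Y ≤ |θ j| * b := by
        refine (le_abs_self _).trans ?_
        rw [abs_mul]
        gcongr
        exact abs_clp_le hb0.le Y
      have h2 : τ * max (|x| - M) 0 - |θ j| ≤ |eta Y b| := by
        rw [abs_eta hb0.le, mul_max_of_nonneg _ _ hτ.le, mul_zero]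
        have h3 : τ * |x| ≤ |Y| + |θ j| := by
          have := abs_sub Y (θ j)
          rw [hY, add_sub_cancel_left, abs_mul, abs_of_pos hτ] at this
          exact this
        have h4 := le_max_left (|Y| - b) 0
        have h5 := le_max_right (|Y| - b) 0
        have h6 := abs_nonneg (θ j)
        rw [sub_le_iff_le_add]
        apply max_le <;> linarith
      have h7 : b * (τ * max (|x| - M) 0 - |θ j|) ≤ b * |eta Y b| := by gcongr
      linarith
    have h1 := integral_mono (hiJ j)
      ((integrable_const (2 * b * |θ j|)).sub (hiex.const_mul (b * τ))) hpt
    rw [Pi.sub_def, integral_sub (integrable_const _) (hiex.const_mul _),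
      integral_const_mul (b * τ)] at h1
    simp only [integral_const, probReal_univ, smul_eq_mul, one_mul, ← hm] at h1
    have h4 : J j = ∫ x, ((eta (θ j + τ * x) b - θ j) ^ 2
      - τ * (x * (eta (θ j + τ * x) b - θ j))) ∂(gaussianReal 0 1) := rfl
    rw [h4]
    linarith
  have hJ3 : ∀ j, J j ≤ b * τ * (-(m / 2) + (M + 1 + m / 2)
      * (if τ * m / 4 < |θ j| then (1 : ℝ) else 0)) := by
    intro j
    split_ifs with h
    · have := hJ1 j; linarith
    · push Not at h
      have h1 := hJ2 j
      have h2 : b * (2 * |θ j|) ≤ b * (2 * (τ * m / 4)) := by gcongr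
      linarith
  have hle : ∑ j, J j ≤ 0 := by
    refine (Finset.sum_le_sum fun j _ => hJ3 j).trans ?_
    rw [← Finset.mul_sum, Finset.sum_add_distrib, ← Finset.mul_sum]
    simp only [Finset.sum_const, Finset.card_univ, Fintype.card_fin, nsmul_eq_mul]
    have h1 := Fball_count hN hp hξ (s := τ * m / 4) (by positivity) hθ
    have h2 := hlev₁ (τ * m / 4) hτ1
    have h3 : (M + 1 + m / 2) * ∑ j, (if τ * m / 4 < |θ j| then (1 : ℝ) else 0)
        ≤ (M + 1 + m / 2) * (N * ((m / 2) / (M + 1 + m / 2))) := by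
      gcongr
      exact h1.trans (by gcongr)
    have h4 : (M + 1 + m / 2) * (N * ((m / 2) / (M + 1 + m / 2))) = N * (m / 2) := by
      field_simp
    exact mul_nonpos_of_nonneg_of_nonpos (by positivity) (by linarith)
  rw [hsum] at hle
  have : 0 < δ * N * (τ * β - σ ^ 2) := mul_pos (by positivity) (by linarith)
  linarith

lemma exists_measurable_argmin {α ι : Type*} [MeasurableSpace α] [Finite ι] [Nonempty ι]
    {c : ι → α → ℝ} (hc : ∀ i, Measurable (c i)) :
    ∃ sel : α → ι, (∀ i, MeasurableSet (sel ⁻¹' {i})) ∧ ∀ x i, c (sel x) x ≤ c i x := by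
  classical
  have := Fintype.ofFinite ι
  let e := Fintype.equivFin ι
  let P : α → ℕ → Prop := fun x k => ∃ hk : k < Fintype.card ι, ∀ i, c (e.symm ⟨k, hk⟩) x ≤ c i x
  have hex : ∀ x, ∃ k, P x k := fun x => by
    obtain ⟨i, hi⟩ := Finite.exists_min fun i => c i x
    exact ⟨e i, (e i).2, by simpa using hi⟩
  have hms : ∀ k, MeasurableSet {x | P x k} := fun k => by
    by_cases hk : k < Fintype.card ι
    · have : {x | P x k} = ⋂ i, {x | c (e.symm ⟨k, hk⟩) x ≤ c i x} := by
        ext x; simp [P, hk]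
      rw [this]
      exact MeasurableSet.iInter fun i => measurableSet_le (hc _) (hc i)
    · have : {x | P x k} = ∅ := by ext x; simp [P, hk]
      rw [this]; exact MeasurableSet.empty
  have hfind := measurable_find hex hms
  refine ⟨fun x => e.symm ⟨Nat.find (hex x), (Nat.find_spec (hex x)).1⟩, fun i => ?_,
    fun x i => (Nat.find_spec (hex x)).2 i⟩
  have : ((fun x => e.symm ⟨Nat.find (hex x), (Nat.find_spec (hex x)).1⟩) ⁻¹' {i})
      = (fun x => Nat.find (hex x)) ⁻¹' {(e i : ℕ)} := by
    ext x
    simp only [Set.mem_preimage, Set.mem_singleton_iff, Equiv.symm_apply_eq, Fin.ext_iff]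
  rw [this]
  exact hfind (measurableSet_singleton _)

lemma sum_restrict_fibers {α ι : Type*} [MeasurableSpace α] [Fintype ι] (μ : Measure α)
    {sel : α → ι} (h : ∀ i, MeasurableSet (sel ⁻¹' {i})) :
    ∑ i, μ.restrict (sel ⁻¹' {i}) = μ := by
  rw [← Measure.sum_fintype, ← Measure.restrict_iUnion _ h]
  · have : ⋃ i, sel ⁻¹' {i} = Set.univ := by ext x; simp
    rw [this, Measure.restrict_univ]
  · intro i j hij
    exact Set.disjoint_left.2 fun x hx hy => hij (by rw [← hx, ← hy])

lemma integrable_sq_coord {ι : Type*} [Fintype ι] (i : ι) :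
    Integrable (fun h : ι → ℝ => (h i) ^ 2) (stdPi ι) :=
  (measurePreserving_eval (fun _ : ι => gaussianReal 0 1) i).integrable_comp_of_integrable
    integrable_sq_gaussian

/-- Couplings of empirical measures through permutations bound the Wasserstein distance. -/
lemma W2sq_le {N : ℕ} (hN : 0 < N) (θ θs : Fin N → ℝ) {α τ : ℝ} (hb : 0 ≤ α * τ)
    {B : (Fin N → ℝ) → ℝ} (hB : Integrable B (stdPi (Fin N)))
    (h : ∀ x, ∃ p : Equiv.Perm (Fin N), (1 / (N : ℝ)) * ∑ i,
      ((θ i - eta (θs (p i) + τ * x (p i)) (α * τ)) ^ 2 + (θs i - θs (p i)) ^ 2) ≤ B x) :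
    W2sq (empDist2 θ θs) (muStar (empDist θs) τ α) ≤ ∫ x, B x ∂(stdPi (Fin N)) := by
  classical
  have hN' : (0 : ℝ) < N := by exact_mod_cast hN
  set μ := stdPi (Fin N) with hμ
  set c : Equiv.Perm (Fin N) → (Fin N → ℝ) → ℝ := fun p x => (1 / (N : ℝ)) * ∑ i,
      ((θ i - eta (θs (p i) + τ * x (p i)) (α * τ)) ^ 2 + (θs i - θs (p i)) ^ 2) with hc
  have hceta : ∀ j, Continuous fun x : Fin N → ℝ => eta (θs j + τ * x j) (α * τ) := fun j =>
    (continuous_eta hb).comp (by fun_prop)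
  have hterm : ∀ i j, Continuous fun x : Fin N → ℝ =>
      ((θ i - eta (θs j + τ * x j) (α * τ)) ^ 2 + (θs i - θs j) ^ 2) := fun i j => by
    have := hceta j
    fun_prop
  have hcm : ∀ p, Measurable (c p) := fun p =>
    (continuous_const.mul (continuous_finsetSum _ fun i _ => hterm i (p i))).measurable
  obtain ⟨sel, hsel, hmin⟩ := exists_measurable_argmin hcm
  set ν : Equiv.Perm (Fin N) → Measure (Fin N → ℝ) := fun p => μ.restrict (sel ⁻¹' {p}) with hν
  have hνsum : ∑ p, ν p = μ := sum_restrict_fibers μ hsel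
  set G : Fin N → Fin N → (Fin N → ℝ) → (ℝ × ℝ) × (ℝ × ℝ) := fun i j x =>
    ((θ i, θs i), (eta (θs j + τ * x j) (α * τ), θs j)) with hG
  have hGm : ∀ i j, Measurable (G i j) := fun i j => by
    have := (hceta j).measurable
    simp only [hG]
    fun_prop
  set γ : Measure ((ℝ × ℝ) × (ℝ × ℝ)) :=
    ((N : ℝ≥0∞))⁻¹ • ∑ p, ∑ i, (ν p).map (G i (p i)) with hγ
  have hνT : ∀ T, ∑ p, ν p T = μ T := fun T => by
    conv_rhs => rw [← hνsum]
    rw [Measure.finsetSum_apply]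
  have hγapp : ∀ S, MeasurableSet S →
      γ S = ((N : ℝ≥0∞))⁻¹ * ∑ p, ∑ i, ν p (G i (p i) ⁻¹' S) := fun S hS => by
    rw [hγ, Measure.smul_apply, Measure.finsetSum_apply, smul_eq_mul]
    congr 1
    refine Finset.sum_congr rfl fun p _ => ?_
    rw [Measure.finsetSum_apply]
    exact Finset.sum_congr rfl fun i _ => Measure.map_apply (hGm _ _) hS
  have hfst : γ.map Prod.fst = empDist2 θ θs := by
    ext S hS
    rw [Measure.map_apply measurable_fst hS, hγapp _ (measurable_fst hS), Finset.sum_comm]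
    unfold empDist2
    rw [Measure.smul_apply, Measure.finsetSum_apply, smul_eq_mul]
    congr 1
    refine Finset.sum_congr rfl fun i _ => ?_
    rw [Measure.dirac_apply' _ hS]
    by_cases hi : (θ i, θs i) ∈ S
    · have : ∀ p : Equiv.Perm (Fin N), G i (p i) ⁻¹' (Prod.fst ⁻¹' S) = Set.univ := fun p => by
        ext x; simp [hG, hi]
      simp only [this, hνT, measure_univ, Set.indicator_of_mem hi, Pi.one_apply]
    · have : ∀ p : Equiv.Perm (Fin N), G i (p i) ⁻¹' (Prod.fst ⁻¹' S) = ∅ := fun p => by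
        ext x; simp [hG, hi]
      simp [this, hi]
  have hsnd : γ.map Prod.snd = muStar (empDist θs) τ α := by
    ext S hS
    have hFm : Measurable fun q : ℝ × ℝ => (eta (q.1 + τ * q.2) (α * τ), q.1) := by
      have : Continuous fun q : ℝ × ℝ => eta (q.1 + τ * q.2) (α * τ) :=
        (continuous_eta hb).comp (by fun_prop)
      have := this.measurable
      fun_prop
    have hFS := hFm hS
    rw [Measure.map_apply measurable_snd hS, hγapp _ (measurable_snd hS)]
    unfold muStar stdG
    rw [Measure.map_apply hFm hS, empDist_prod, Measure.smul_apply, Measure.finsetSum_apply,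
      smul_eq_mul]
    congr 1
    have h1 : ∀ p : Equiv.Perm (Fin N), ∑ i, ν p (G i (p i) ⁻¹' (Prod.snd ⁻¹' S))
        = ∑ j, ν p {x | (eta (θs j + τ * x j) (α * τ), θs j) ∈ S} := fun p =>
      Equiv.sum_comp p fun j => ν p {x | (eta (θs j + τ * x j) (α * τ), θs j) ∈ S}
    simp only [h1]
    rw [Finset.sum_comm]
    refine Finset.sum_congr rfl fun j _ => ?_
    rw [hνT, Measure.map_apply measurable_prodMk_left hFS]
    have hmp := measurePreserving_eval (fun _ : Fin N => gaussianReal 0 1) j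
    rw [← hmp.measure_preimage (measurable_prodMk_left hFS).nullMeasurableSet]
    rfl
  have hmem : W2sq (empDist2 θ θs) (muStar (empDist θs) τ α)
      ≤ ∫ q, ((q.1.1 - q.2.1) ^ 2 + (q.1.2 - q.2.2) ^ 2) ∂γ := by
    refine csInf_le ⟨0, ?_⟩ ⟨γ, hfst, hsnd, rfl⟩
    rintro r ⟨γ', -, -, rfl⟩
    exact integral_nonneg fun q => by positivity
  refine hmem.trans ?_
  have hint : ∀ i j, Integrable (fun x : Fin N → ℝ =>
      ((θ i - eta (θs j + τ * x j) (α * τ)) ^ 2 + (θs i - θs j) ^ 2)) μ := fun i j => by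
    have hdom : Integrable (fun x : Fin N → ℝ => (2 * (|θ i| + |θs j| + α * τ) ^ 2
        + 2 * τ ^ 2 * (x j) ^ 2) + (θs i - θs j) ^ 2) μ :=
      ((integrable_const _).add ((integrable_sq_coord j).const_mul _)).add (integrable_const _)
    refine hdom.mono' (hterm i j).aestronglyMeasurable (Filter.Eventually.of_forall fun x => ?_)
    rw [Real.norm_eq_abs, abs_of_nonneg (by positivity)]
    gcongr
    rw [eta_eq hb]
    have h1 := abs_clp_le hb (θs j + τ * x j)
    have h2 : |θ i - (θs j + τ * x j - clp (α * τ) (θs j + τ * x j))|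
        ≤ (|θ i| + |θs j| + α * τ) + |τ * x j| := by
      rw [abs_le]
      have := abs_le.1 h1
      have := neg_abs_le (θ i)
      have := le_abs_self (θ i)
      have := neg_abs_le (θs j)
      have := le_abs_self (θs j)
      have := neg_abs_le (τ * x j)
      have := le_abs_self (τ * x j)
      constructor <;> linarith
    have h3 : |θ i - (θs j + τ * x j - clp (α * τ) (θs j + τ * x j))| ^ 2
        ≤ ((|θ i| + |θs j| + α * τ) + |τ * x j|) ^ 2 := by gcongr
    rw [sq_abs] at h3
    have h4 : |τ * x j| ^ 2 = τ ^ 2 * x j ^ 2 := by rw [sq_abs, mul_pow]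
    nlinarith [sq_nonneg ((|θ i| + |θs j| + α * τ) - |τ * x j|)]
  have hcost : Measurable fun q : (ℝ × ℝ) × (ℝ × ℝ) =>
      ((q.1.1 - q.2.1) ^ 2 + (q.1.2 - q.2.2) ^ 2) := by fun_prop
  have hintν : ∀ p i j, Integrable (fun x : Fin N → ℝ =>
      ((θ i - eta (θs j + τ * x j) (α * τ)) ^ 2 + (θs i - θs j) ^ 2)) (ν p) := fun p i j =>
    (hint i j).restrict
  have hmapint : ∀ p i, Integrable (fun q : (ℝ × ℝ) × (ℝ × ℝ) =>
      ((q.1.1 - q.2.1) ^ 2 + (q.1.2 - q.2.2) ^ 2)) ((ν p).map (G i (p i))) := fun p i => by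
    rw [integrable_map_measure hcost.aestronglyMeasurable (hGm _ _).aemeasurable]
    exact hintν p i (p i)
  have hval : ∫ q, ((q.1.1 - q.2.1) ^ 2 + (q.1.2 - q.2.2) ^ 2) ∂γ = ∑ p, ∫ x, c p x ∂(ν p) := by
    rw [hγ, integral_smul_measure, integral_finsetSum_measure
      (fun p _ => integrable_finsetSum_measure.2 fun i _ => hmapint p i), smul_eq_mul,
      Finset.mul_sum]
    refine Finset.sum_congr rfl fun p _ => ?_
    rw [integral_finsetSum_measure fun i _ => hmapint p i, hc, integral_const_mul,
      integral_finsetSum _ fun i _ => hintν p i (p i)]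
    congr 1
    · simp
    · refine Finset.sum_congr rfl fun i _ => ?_
      rw [integral_map (hGm _ _).aemeasurable hcost.aestronglyMeasurable]
  rw [hval]
  have hle : ∀ p, ∫ x, c p x ∂(ν p) ≤ ∫ x, B x ∂(ν p) := fun p => by
    refine setIntegral_mono_on ?_ hB.integrableOn (hsel p) fun x hx => ?_
    · exact (Integrable.const_mul (integrable_finsetSum _ fun i _ => hint i (p i)) _).integrableOn
    · obtain ⟨p', hp'⟩ := h x
      have hx' : sel x = p := hx
      exact (hx' ▸ hmin x p').trans hp'
  refine (Finset.sum_le_sum fun p _ => hle p).trans (le_of_eq ?_)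
  rw [← integral_finsetSum_measure fun p _ => hB.restrict, hνsum]

/-- The indicator of `a ≤ x`. -/
def stepLe (x a : ℝ) : ℝ := if a ≤ x then 1 else 0

lemma measurable_stepLe : Measurable fun q : ℝ × ℝ => stepLe q.1 q.2 := by
  unfold stepLe
  exact Measurable.ite (measurableSet_le measurable_snd measurable_fst) measurable_const
    measurable_const

lemma stepLe_nonneg (x a : ℝ) : 0 ≤ stepLe x a := by unfold stepLe; split_ifs <;> norm_num

lemma stepLe_le_one (x a : ℝ) : stepLe x a ≤ 1 := by unfold stepLe; split_ifs <;> norm_num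

/-- Within each label class a monotone matching exists. -/
lemma exists_monotone_matching {ι κ : Type*} [Fintype ι] (c : ι → κ) (h h' : ι → ℝ) :
    ∃ p : Equiv.Perm ι, (∀ i, c (p i) = c i) ∧ ∀ i i', c i = c i' → ∀ x,
      h i ≤ x → x < h' (p i) → h' (p i') ≤ x → h i' ≤ x := by
  classical
  let P := {p : Equiv.Perm ι // ∀ i, c (p i) = c i}
  have : Nonempty P := ⟨⟨1, fun i => rfl⟩⟩
  obtain ⟨⟨p, hp⟩, hmin⟩ := Finite.exists_min fun p : P => ∑ i, (h i - h' (p.1 i)) ^ 2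
  refine ⟨p, hp, fun i i' hc x h1 h2 h3 => ?_⟩
  by_contra h4
  push Not at h4
  have hne : i ≠ i' := by rintro rfl; linarith
  let q : Equiv.Perm ι := (Equiv.swap i i').trans p
  have hq : ∀ j, c (q j) = c j := fun j => by
    simp only [q, Equiv.trans_apply]
    rw [hp]
    rcases eq_or_ne j i with rfl | hj
    · rw [Equiv.swap_apply_left, hc]
    · rcases eq_or_ne j i' with rfl | hj'
      · rw [Equiv.swap_apply_right, hc]
      · rw [Equiv.swap_apply_of_ne_of_ne hj hj']
  have hle := hmin ⟨q, hq⟩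
  simp only at hle
  rw [← sub_nonneg, ← Finset.sum_sub_distrib, Fintype.sum_eq_add i i' hne] at hle
  · simp only [q, Equiv.trans_apply, Equiv.swap_apply_left, Equiv.swap_apply_right] at hle
    nlinarith [mul_pos (sub_pos.2 (h1.trans_lt h4)) (sub_pos.2 (h3.trans_lt h2))]
  · rintro j ⟨hj, hj'⟩
    simp [q, Equiv.swap_apply_of_ne_of_ne hj hj']

lemma abs_clp_sub_le {M : ℝ} (hM : 0 < M) (a b : ℝ) :
    |clp M a - clp M b| ≤ ∫ x in Set.Ico (-M) M, |stepLe x a - stepLe x b| := by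
  wlog hab : a ≤ b generalizing a b
  · have := this b a (le_of_not_ge hab)
    rw [abs_sub_comm]
    simpa only [abs_sub_comm (stepLe _ b)] using this
  have e : (fun x => |stepLe x a - stepLe x b|) = (Set.Ico a b).indicator fun _ => (1 : ℝ) := by
    funext x
    unfold stepLe
    by_cases h1 : a ≤ x
    · by_cases h2 : b ≤ x
      · rw [Set.indicator_of_notMem (by simp [h2])]; simp [h1, h2]
      · rw [Set.indicator_of_mem (by simp [h1, not_le.1 h2])]; simp [h1, h2]
    · have h2 : ¬ b ≤ x := fun h => h1 (hab.trans h)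
      rw [Set.indicator_of_notMem (by simp [h1])]; simp [h1, h2]
  have hmono : clp M a ≤ clp M b := by unfold clp; gcongr
  rw [e, abs_sub_comm, abs_of_nonneg (by linarith), integral_indicator measurableSet_Ico,
    Measure.restrict_restrict measurableSet_Ico, setIntegral_const, smul_eq_mul, mul_one,
    Set.Ico_inter_Ico, Measure.real, Real.volume_Ico, ENNReal.toReal_ofReal']
  have key : max (-M) (min b M) - max (-M) (min a M) ≤ max (min b M - max a (-M)) 0 := by
    simp only [max_def, min_def]
    split_ifs <;> linarith
  exact key

/-- Signed discrepancy between two samples inside a label class. -/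
def disc {ι κ : Type*} [Fintype ι] [DecidableEq κ] (c : ι → κ) (k : κ) (x : ℝ) (h h' : ι → ℝ) : ℝ :=
  ∑ i, if c i = k then stepLe x (h i) - stepLe x (h' i) else 0

lemma sum_abs_step_eq {ι κ : Type*} [Fintype ι] [DecidableEq κ] (c : ι → κ) (h h' : ι → ℝ)
    (p : Equiv.Perm ι) (hp : ∀ i, c (p i) = c i)
    (hmon : ∀ i i', c i = c i' → ∀ x, h i ≤ x → x < h' (p i) → h' (p i') ≤ x → h i' ≤ x)
    (k : κ) (x : ℝ) :
    ∑ i, (if c i = k then |stepLe x (h i) - stepLe x (h' (p i))| else 0) = |disc c k x h h'| := by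
  have e : disc c k x h h' = ∑ i, if c i = k then stepLe x (h i) - stepLe x (h' (p i)) else 0 := by
    have h1 : ∑ i, (if c i = k then stepLe x (h' (p i)) else 0)
        = ∑ i, (if c i = k then stepLe x (h' i) else 0) := by
      rw [← Equiv.sum_comp p fun i => if c i = k then stepLe x (h' i) else 0]
      simp only [hp]
    have h2 : ∀ a : ι → ℝ, ∑ i, (if c i = k then stepLe x (h i) - a i else 0)
        = ∑ i, (if c i = k then stepLe x (h i) else 0) - ∑ i, (if c i = k then a i else 0) := by
      intro a
      rw [← Finset.sum_sub_distrib]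
      refine Finset.sum_congr rfl fun i _ => ?_
      split_ifs <;> simp
    unfold disc
    rw [h2, h2, h1]
  rw [e]
  by_cases hex : ∃ i, c i = k ∧ h i ≤ x ∧ x < h' (p i)
  · obtain ⟨i, hi, hi1, hi2⟩ := hex
    have hnn : ∀ j, 0 ≤ if c j = k then stepLe x (h j) - stepLe x (h' (p j)) else 0 := by
      intro j
      split_ifs with hj
      · have := hmon i j (hi.trans hj.symm) x hi1 hi2
        unfold stepLe
        split_ifs with a b <;> first | exact absurd (this ‹_›) ‹_› | norm_num
      · rfl
    rw [abs_of_nonneg (Finset.sum_nonneg fun j _ => hnn j)]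
    refine Finset.sum_congr rfl fun j _ => ?_
    have := hnn j
    split_ifs with hj
    · rw [if_pos hj] at this
      exact abs_of_nonneg this
    · rfl
  · push Not at hex
    have hnp : ∀ j, (if c j = k then stepLe x (h j) - stepLe x (h' (p j)) else 0) ≤ 0 := by
      intro j
      split_ifs with hj
      · have := hex j hj
        unfold stepLe
        split_ifs with a b <;> first | exact absurd (this ‹_›) ‹_› | norm_num
      · rfl
    rw [abs_of_nonpos (Finset.sum_nonpos fun j _ => hnp j), ← Finset.sum_neg_distrib]
    refine Finset.sum_congr rfl fun j _ => ?_
    have := hnp j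
    split_ifs with hj
    · rw [if_pos hj] at this
      exact abs_of_nonpos this
    · simp

lemma chernoff_average {X Y : Type*} [MeasurableSpace X] [MeasurableSpace Y] (μ : Measure X)
    (ν : Measure Y) [IsProbabilityMeasure μ] [IsProbabilityMeasure ν] {F : X × Y → ℝ}
    (hF : Measurable F) {K : ℝ} (hK : ∀ q, |F q| ≤ K) (s t : ℝ) :
    μ {x | t ≤ s * ∫ y, F (x, y) ∂ν}
      ≤ ENNReal.ofReal (Real.exp (-t) * ∫ q, Real.exp (s * F q) ∂(μ.prod ν)) := by
  have hbd : ∀ q, |Real.exp (s * F q)| ≤ Real.exp (|s| * K) := fun q => by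
    rw [Real.abs_exp, Real.exp_le_exp]
    refine (le_abs_self _).trans ?_
    rw [abs_mul]
    exact mul_le_mul_of_nonneg_left (hK q) (abs_nonneg s)
  have hmexp : Measurable fun q => Real.exp (s * F q) := by fun_prop
  have hintE : Integrable (fun q => Real.exp (s * F q)) (μ.prod ν) :=
    Integrable.of_bound hmexp.aestronglyMeasurable _ (.of_forall hbd)
  have hintF : Integrable F (μ.prod ν) :=
    Integrable.of_bound hF.aestronglyMeasurable _ (.of_forall hK)
  have hjen : ∀ x, Real.exp (s * ∫ y, F (x, y) ∂ν) ≤ ∫ y, Real.exp (s * F (x, y)) ∂ν := by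
    intro x
    have hFx : Measurable fun y => F (x, y) := hF.comp (by fun_prop)
    rw [← integral_const_mul]
    refine ConvexOn.map_integral_le (g := Real.exp) convexOn_exp Real.continuous_exp.continuousOn
      isClosed_univ (.of_forall fun _ => Set.mem_univ _) ?_ ?_
    · exact (Integrable.of_bound hFx.aestronglyMeasurable _ (.of_forall fun y => hK (x, y))).const_mul _
    · exact Integrable.of_bound (hmexp.comp (by fun_prop : Measurable fun y => (x, y))).aestronglyMeasurable _
        (.of_forall fun y => hbd (x, y))
  have hm : Measurable fun x => Real.exp (s * ∫ y, F (x, y) ∂ν) := by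
    have : StronglyMeasurable fun x => ∫ y, F (x, y) ∂ν :=
      hF.stronglyMeasurable.integral_prod_right'
    have := this.measurable
    fun_prop
  have hint := hintE.integral_prod_left
  have hint' : Integrable (fun x => Real.exp (s * ∫ y, F (x, y) ∂ν)) μ :=
    hint.mono' hm.aestronglyMeasurable (.of_forall fun x => by
      rw [Real.norm_eq_abs, Real.abs_exp]; exact hjen x)
  refine (chernoff hint' t).trans (ENNReal.ofReal_le_ofReal ?_)
  refine mul_le_mul_of_nonneg_left ?_ (Real.exp_pos _).le
  rw [integral_prod _ hintE]
  exact integral_mono hint' hint hjen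

lemma integral_exp_stepLe (x t : ℝ) :
    ∫ z, Real.exp (t * stepLe x z) ∂(gaussianReal 0 1)
      = 1 + (gaussianReal 0 1).real (Set.Iic x) * (Real.exp t - 1) := by
  have : (fun z => Real.exp (t * stepLe x z))
      = fun z => 1 + (Set.Iic x).indicator (fun _ => Real.exp t - 1) z := by
    funext z
    unfold stepLe
    by_cases h : z ≤ x
    · simp [h]
    · simp [h]
  rw [this, integral_add (integrable_const _)
    ((integrable_const _).indicator measurableSet_Iic), integral_indicator measurableSet_Iic,
    setIntegral_const, integral_const]
  simp

lemma integral_exp_stepLe_mul_le (x t : ℝ) :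
    (∫ z, Real.exp (t * stepLe x z) ∂(gaussianReal 0 1))
      * (∫ z, Real.exp (-t * stepLe x z) ∂(gaussianReal 0 1)) ≤ Real.exp (t ^ 2 / 2) := by
  rw [integral_exp_stepLe, integral_exp_stepLe]
  set p := (gaussianReal 0 1).real (Set.Iic x)
  have h0 : 0 ≤ p := measureReal_nonneg
  have h1 : p ≤ 1 := measureReal_le_one
  have hc := Real.cosh_le_exp_half_sq t
  have hc1 := Real.one_le_cosh t
  have hm : Real.exp t * Real.exp (-t) = 1 := by rw [← Real.exp_add]; simp
  have hs : Real.exp t + Real.exp (-t) = 2 * Real.cosh t := by rw [Real.cosh_eq]; ring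
  have e : (1 + p * (Real.exp t - 1)) * (1 + p * (Real.exp (-t) - 1))
      = 1 + 2 * (p * (1 - p)) * (Real.cosh t - 1) := by
    have : (1 + p * (Real.exp t - 1)) * (1 + p * (Real.exp (-t) - 1))
      = (1 - p) ^ 2 + p ^ 2 * (Real.exp t * Real.exp (-t))
        + p * (1 - p) * (Real.exp t + Real.exp (-t)) := by ring
    rw [this, hm, hs]; ring
  rw [e]
  have : p * (1 - p) ≤ 1 / 2 := by nlinarith [sq_nonneg (p - 1 / 2)]
  nlinarith

lemma integral_exp_signed_le {N : ℕ} (x : ℝ) (a : Fin N → ℝ) (s : ℝ) (ha : ∀ i, (a i) ^ 2 ≤ s ^ 2) :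
    Integrable (fun q : (Fin N → ℝ) × (Fin N → ℝ) =>
      Real.exp (∑ i, a i * (stepLe x (q.1 i) - stepLe x (q.2 i))))
      ((stdPi (Fin N)).prod (stdPi (Fin N))) ∧
    ∫ q : (Fin N → ℝ) × (Fin N → ℝ), Real.exp (∑ i, a i * (stepLe x (q.1 i) - stepLe x (q.2 i)))
      ∂((stdPi (Fin N)).prod (stdPi (Fin N))) ≤ Real.exp (s ^ 2 * N / 2) := by
  have hst : Measurable fun z => stepLe x z := measurable_stepLe.comp (by fun_prop : Measurable fun z => (x, z))
  have hi : ∀ t : ℝ, Integrable (fun z => Real.exp (t * stepLe x z)) (gaussianReal 0 1) := fun t =>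
    Integrable.of_bound (by fun_prop) (Real.exp |t|) (.of_forall fun z => by
      rw [Real.norm_eq_abs, Real.abs_exp, Real.exp_le_exp]
      have := stepLe_nonneg x z
      have := stepLe_le_one x z
      nlinarith [le_abs_self t, abs_nonneg t])
  have e : (fun q : (Fin N → ℝ) × (Fin N → ℝ) =>
      Real.exp (∑ i, a i * (stepLe x (q.1 i) - stepLe x (q.2 i))))
      = fun q => Real.exp (∑ i, a i * stepLe x (q.1 i)) * Real.exp (∑ i, -a i * stepLe x (q.2 i)) := by
    funext q
    rw [← Real.exp_add, ← Finset.sum_add_distrib]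
    congr 1
    exact Finset.sum_congr rfl fun i _ => by ring
  rw [e]
  constructor
  · exact (integrable_exp_sum (f := fun i z => a i * stepLe x z) fun i => hi _).mul_prod
      (integrable_exp_sum (f := fun i z => -a i * stepLe x z) fun i => hi _)
  rw [integral_prod_mul (fun h : Fin N → ℝ => Real.exp (∑ i, a i * stepLe x (h i)))
      (fun h : Fin N → ℝ => Real.exp (∑ i, -a i * stepLe x (h i))),
    integral_exp_sum (f := fun i z => a i * stepLe x z),
    integral_exp_sum (f := fun i z => -a i * stepLe x z), ← Finset.prod_mul_distrib]
  have h1 : ∀ i ∈ Finset.univ, (∫ z, Real.exp (a i * stepLe x z) ∂(gaussianReal 0 1))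
      * (∫ z, Real.exp (-a i * stepLe x z) ∂(gaussianReal 0 1)) ≤ Real.exp (s ^ 2 / 2) := fun i _ =>
    (integral_exp_stepLe_mul_le x (a i)).trans (Real.exp_le_exp.2 (by linarith [ha i]))
  refine (Finset.prod_le_prod (fun i _ => mul_nonneg (integral_nonneg fun _ => (Real.exp_pos _).le)
    (integral_nonneg fun _ => (Real.exp_pos _).le)) h1).trans (le_of_eq ?_)
  rw [Finset.prod_const, ← Real.exp_nat_mul]
  simp
  ring

lemma measurable_disc {ι κ : Type*} [Fintype ι] [DecidableEq κ] (c : ι → κ) (k : κ) :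
    Measurable fun q : ℝ × (ι → ℝ) × (ι → ℝ) => disc c k q.1 q.2.1 q.2.2 := by
  have hm : ∀ {g : ℝ × (ι → ℝ) × (ι → ℝ) → ℝ}, Measurable g → Measurable fun q => stepLe q.1 (g q) :=
    fun hg => measurable_stepLe.comp (measurable_fst.prodMk hg)
  unfold disc
  refine Finset.measurable_sum _ fun i _ => ?_
  split_ifs
  · exact (hm (by fun_prop)).sub (hm (by fun_prop))
  · exact measurable_const

lemma abs_disc_le {ι κ : Type*} [Fintype ι] [DecidableEq κ] (c : ι → κ) (k : κ) (x : ℝ)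
    (h h' : ι → ℝ) : |disc c k x h h'| ≤ Fintype.card ι := by
  unfold disc
  refine (Finset.abs_sum_le_sum_abs _ _).trans ?_
  refine (Finset.sum_le_card_nsmul _ _ 1 fun i _ => ?_).trans (by simp)
  have h1 := stepLe_nonneg x (h i)
  have h2 := stepLe_le_one x (h i)
  have h3 := stepLe_nonneg x (h' i)
  have h4 := stepLe_le_one x (h' i)
  split_ifs
  · rw [abs_le]; constructor <;> linarith
  · simp

lemma integral_exp_disc_le {N : ℕ} {κ : Type*} [DecidableEq κ] (c : Fin N → κ) (S : Finset κ)
    (x s : ℝ) :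
    ∫ q : (Fin N → ℝ) × (Fin N → ℝ), Real.exp (s * ∑ k ∈ S, |disc c k x q.1 q.2|)
      ∂((stdPi (Fin N)).prod (stdPi (Fin N))) ≤ 2 ^ S.card * Real.exp (s ^ 2 * N / 2) := by
  classical
  let a : Finset κ → Fin N → ℝ := fun A i => if c i ∈ S then (if c i ∈ A then s else -s) else 0
  have ha : ∀ A i, (a A i) ^ 2 ≤ s ^ 2 := fun A i => by
    simp only [a]; split_ifs <;> simp [sq_nonneg]
  have hpt : ∀ q : (Fin N → ℝ) × (Fin N → ℝ), Real.exp (s * ∑ k ∈ S, |disc c k x q.1 q.2|)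
      ≤ ∑ A ∈ S.powerset, Real.exp (∑ i, a A i * (stepLe x (q.1 i) - stepLe x (q.2 i))) := by
    intro q
    rw [Finset.mul_sum, Real.exp_sum]
    calc ∏ k ∈ S, Real.exp (s * |disc c k x q.1 q.2|)
        ≤ ∏ k ∈ S, (Real.exp (s * disc c k x q.1 q.2) + Real.exp (-s * disc c k x q.1 q.2)) := by
          refine Finset.prod_le_prod (fun _ _ => (Real.exp_pos _).le) fun k _ => ?_
          rcases abs_cases (disc c k x q.1 q.2) with ⟨h, -⟩ | ⟨h, -⟩ <;> rw [h]
          · linarith [Real.exp_pos (-s * disc c k x q.1 q.2)]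
          · rw [mul_neg, ← neg_mul]; linarith [Real.exp_pos (s * disc c k x q.1 q.2)]
      _ = _ := by
          rw [Finset.prod_add]
          refine Finset.sum_congr rfl fun A hA => ?_
          rw [Finset.mem_powerset] at hA
          rw [← Real.exp_sum, ← Real.exp_sum, ← Real.exp_add]
          congr 1
          have h1 : ∀ k ∈ A, s * disc c k x q.1 q.2
              = (if k ∈ A then s else -s) * disc c k x q.1 q.2 := fun k hk => by rw [if_pos hk]
          have h2 : ∀ k ∈ S \ A, -s * disc c k x q.1 q.2
              = (if k ∈ A then s else -s) * disc c k x q.1 q.2 := fun k hk => by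
            rw [if_neg (Finset.mem_sdiff.1 hk).2]
          rw [Finset.sum_congr rfl h1, Finset.sum_congr rfl h2, add_comm,
            Finset.sum_sdiff hA]
          unfold disc
          simp only [Finset.mul_sum]
          rw [Finset.sum_comm]
          refine Finset.sum_congr rfl fun i _ => ?_
          simp only [a, mul_ite, mul_zero]
          rw [Finset.sum_ite_eq]
          split_ifs <;> simp
  have hI := fun A => integral_exp_signed_le x (a A) s (ha A)
  calc _ ≤ ∫ q : (Fin N → ℝ) × (Fin N → ℝ), ∑ A ∈ S.powerset,
        Real.exp (∑ i, a A i * (stepLe x (q.1 i) - stepLe x (q.2 i)))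
          ∂((stdPi (Fin N)).prod (stdPi (Fin N))) :=
        integral_mono_of_nonneg (.of_forall fun q => (Real.exp_pos _).le)
          (integrable_finsetSum _ fun A _ => (hI A).1) (.of_forall hpt)
    _ ≤ _ := by
        rw [integral_finsetSum _ fun A _ => (hI A).1]
        refine (Finset.sum_le_card_nsmul _ _ _ fun A _ => (hI A).2).trans (le_of_eq ?_)
        rw [Finset.card_powerset, nsmul_eq_mul]
        push_cast
        ring

/-- The uniform distribution on `[-M, M)`. -/
def unifIco (M : ℝ) : Measure ℝ := ProbabilityTheory.cond volume (Set.Ico (-M) M)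

lemma isProbabilityMeasure_unifIco {M : ℝ} (hM : 0 < M) : IsProbabilityMeasure (unifIco M) :=
  cond_isProbabilityMeasure_of_finite (by simp [hM]) (by simp)

lemma integral_unifIco {M : ℝ} (hM : 0 < M) (f : ℝ → ℝ) :
    ∫ x, f x ∂(unifIco M) = (2 * M)⁻¹ * ∫ x in Set.Ico (-M) M, f x := by
  unfold unifIco ProbabilityTheory.cond
  rw [integral_smul_measure, Real.volume_Ico, smul_eq_mul, ENNReal.toReal_inv,
    ENNReal.toReal_ofReal (by linarith)]
  congr 2; ring

lemma abs_clp_sub_le_unifIco {M : ℝ} (hM : 0 < M) (a b : ℝ) :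
    |clp M a - clp M b| ≤ 2 * M * ∫ x, |stepLe x a - stepLe x b| ∂(unifIco M) := by
  rw [integral_unifIco hM, ← mul_assoc, mul_inv_cancel₀ (by positivity), one_mul]
  exact abs_clp_sub_le hM a b

/-- Expected class-wise Kolmogorov-type discrepancy of `h` against a fresh Gaussian sample. -/
def meanDisc {N : ℕ} {κ : Type*} [DecidableEq κ] (c : Fin N → κ) (S : Finset κ) (M : ℝ)
    (h : Fin N → ℝ) : ℝ :=
  ∫ y : (Fin N → ℝ) × ℝ, ∑ k ∈ S, |disc c k y.2 h y.1| ∂((stdPi (Fin N)).prod (unifIco M))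

lemma measurable_sum_disc {N : ℕ} {κ : Type*} [DecidableEq κ] (c : Fin N → κ) (S : Finset κ) :
    Measurable fun q : (Fin N → ℝ) × (Fin N → ℝ) × ℝ => ∑ k ∈ S, |disc c k q.2.2 q.1 q.2.1| :=
  Finset.measurable_sum _ fun k _ => ((measurable_disc c k).comp
    (by fun_prop : Measurable fun q : (Fin N → ℝ) × (Fin N → ℝ) × ℝ => (q.2.2, q.1, q.2.1))).abs

lemma sum_disc_le {N : ℕ} {κ : Type*} [DecidableEq κ] (c : Fin N → κ) (S : Finset κ)
    (x : ℝ) (h h' : Fin N → ℝ) : abs (∑ k ∈ S, |disc c k x h h'|) ≤ S.card * N := by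
  rw [abs_of_nonneg (Finset.sum_nonneg fun _ _ => abs_nonneg _)]
  refine (Finset.sum_le_card_nsmul _ _ (N : ℝ) fun k _ => ?_).trans (by simp)
  simpa using abs_disc_le c k x h h'

lemma meanDisc_tail {N : ℕ} {κ : Type*} [DecidableEq κ] (c : Fin N → κ) (S : Finset κ) {M : ℝ}
    (hM : 0 < M) {s : ℝ} (hs : 0 ≤ s) :
    stdPi (Fin N) {h | s * N ≤ meanDisc c S M h}
      ≤ ENNReal.ofReal (2 ^ S.card * Real.exp (-(s ^ 2 * N / 2))) := by
  have := isProbabilityMeasure_unifIco hM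
  set μ := stdPi (Fin N)
  set F : (Fin N → ℝ) × (Fin N → ℝ) × ℝ → ℝ := fun q => ∑ k ∈ S, |disc c k q.2.2 q.1 q.2.1| with hF
  have hFm : Measurable F := measurable_sum_disc c S
  have hFK : ∀ q, |F q| ≤ S.card * N := fun q => sum_disc_le c S _ _ _
  have hch := chernoff_average μ (μ.prod (unifIco M)) hFm hFK s (s * (s * N))
  refine (measure_mono fun h hh => ?_).trans (hch.trans (ENNReal.ofReal_le_ofReal ?_))
  · exact mul_le_mul_of_nonneg_left hh hs
  have hE : ∫ q, Real.exp (s * F q) ∂(μ.prod (μ.prod (unifIco M)))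
      ≤ 2 ^ S.card * Real.exp (s ^ 2 * N / 2) := by
    have hmeas : Measurable fun q => Real.exp (s * F q) := by fun_prop
    rw [← integral_comp_measurePreserving (measurePreserving_prodAssoc μ μ (unifIco M))
      hmeas.aestronglyMeasurable]
    have hi : Integrable (fun q : ((Fin N → ℝ) × (Fin N → ℝ)) × ℝ =>
        Real.exp (s * F (MeasurableEquiv.prodAssoc q))) ((μ.prod μ).prod (unifIco M)) := by
      refine integrable_of_bounded (hmeas.comp (MeasurableEquiv.measurable _)).aestronglyMeasurable
        (C := Real.exp (s * (S.card * N))) fun q => ?_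
      rw [Real.abs_exp, Real.exp_le_exp]
      exact mul_le_mul_of_nonneg_left ((le_abs_self _).trans (hFK _)) hs
    rw [integral_prod_symm _ hi]
    refine (integral_mono hi.integral_prod_right (integrable_const _) fun x =>
      integral_exp_disc_le c S x s).trans ?_
    simp
  calc _ ≤ Real.exp (-(s * (s * N))) * (2 ^ S.card * Real.exp (s ^ 2 * N / 2)) :=
        mul_le_mul_of_nonneg_left hE (Real.exp_pos _).le
    _ = 2 ^ S.card * (Real.exp (-(s * (s * N))) * Real.exp (s ^ 2 * N / 2)) := by ring
    _ = _ := by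
        rw [← Real.exp_add]
        congr 2
        ring

/-- Squared excess of `|x|` over the level `M`. -/
def tailSq (M x : ℝ) : ℝ := (x - clp M x) ^ 2

lemma continuous_tailSq (M : ℝ) : Continuous (tailSq M) := by
  unfold tailSq
  have := continuous_clp M
  fun_prop

lemma tailSq_nonneg (M x : ℝ) : 0 ≤ tailSq M x := sq_nonneg _

lemma tailSq_eq_zero {M x : ℝ} (h : |x| ≤ M) : tailSq M x = 0 := by
  rw [abs_le] at h
  unfold tailSq clp
  rw [min_eq_left h.2, max_eq_right h.1, sub_self]
  norm_num

lemma tailSq_le {M x : ℝ} (hM : 0 ≤ M) (h : M ≤ |x|) : tailSq M x ≤ x ^ 2 - M ^ 2 := by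
  unfold tailSq clp
  rcases abs_cases x with ⟨h1, h2⟩ | ⟨h1, h2⟩ <;> rw [h1] at h
  · rw [min_eq_right h, max_eq_right (by linarith)]; nlinarith
  · rw [min_eq_left (by linarith), max_eq_left (by linarith)]; nlinarith

lemma exp_tailSq_le {M : ℝ} (hM : 0 ≤ M) (x : ℝ) :
    Real.exp (tailSq M x / 4) ≤ 1 + Real.exp (-(M ^ 2 / 4)) * Real.exp (x ^ 2 / 4) := by
  rw [← Real.exp_add]
  rcases le_total |x| M with h | h
  · rw [tailSq_eq_zero h]
    simpa using (Real.exp_pos _).le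
  · refine le_add_of_nonneg_of_le zero_le_one (Real.exp_le_exp.2 ?_)
    linarith [tailSq_le hM h]

lemma integrable_exp_tailSq {M : ℝ} (hM : 0 ≤ M) :
    Integrable (fun x => Real.exp (tailSq M x / 4)) (gaussianReal 0 1) := by
  have := continuous_tailSq M
  refine ((integrable_const (1 : ℝ)).add (integrable_exp_sq_gaussian.const_mul
    (Real.exp (-(M ^ 2 / 4))))).mono' (by fun_prop) (.of_forall fun x => ?_)
  rw [Real.norm_eq_abs, Real.abs_exp]
  exact exp_tailSq_le hM x

lemma integral_exp_tailSq_le {M : ℝ} (hM : 0 ≤ M) :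
    ∫ x, Real.exp (tailSq M x / 4) ∂(gaussianReal 0 1) ≤ 1 + Real.exp (-(M ^ 2 / 4)) * gaussExpSq := by
  calc _ ≤ ∫ x, (1 + Real.exp (-(M ^ 2 / 4)) * Real.exp (x ^ 2 / 4)) ∂(gaussianReal 0 1) :=
        integral_mono (integrable_exp_tailSq hM) ((integrable_const (1 : ℝ)).add
          (integrable_exp_sq_gaussian.const_mul _)) (exp_tailSq_le hM)
    _ = _ := by
        rw [integral_add (integrable_const _) (integrable_exp_sq_gaussian.const_mul _),
          integral_const_mul]
        simp [gaussExpSq]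

lemma integrable_tailSq {M : ℝ} (hM : 0 ≤ M) : Integrable (tailSq M) (gaussianReal 0 1) := by
  refine ((integrable_exp_tailSq hM).const_mul 4).mono'
    (continuous_tailSq M).aestronglyMeasurable (.of_forall fun x => ?_)
  rw [Real.norm_eq_abs, abs_of_nonneg (tailSq_nonneg M x)]
  linarith [Real.add_one_le_exp (tailSq M x / 4)]

lemma integral_tailSq_le {M : ℝ} (hM : 0 ≤ M) :
    ∫ x, tailSq M x ∂(gaussianReal 0 1) ≤ 4 * (Real.exp (-(M ^ 2 / 4)) * gaussExpSq) := by
  have h1 : ∫ x, tailSq M x ∂(gaussianReal 0 1)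
      ≤ ∫ x, 4 * (Real.exp (tailSq M x / 4) - 1) ∂(gaussianReal 0 1) :=
    integral_mono (integrable_tailSq hM)
      (((integrable_exp_tailSq hM).sub (integrable_const (1 : ℝ))).const_mul 4) fun x => by
      simp only
      linarith [Real.add_one_le_exp (tailSq M x / 4)]
  rw [integral_const_mul, integral_sub (integrable_exp_tailSq hM) (integrable_const _)] at h1
  have h2 := integral_exp_tailSq_le hM
  simp at h1
  linarith

lemma sum_tailSq_tail {N : ℕ} {M : ℝ} (hM : 0 ≤ M) (t : ℝ) :
    stdPi (Fin N) {h | t ≤ ∑ i, tailSq M (h i)}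
      ≤ ENNReal.ofReal (Real.exp (-(t / 4) + N * (Real.exp (-(M ^ 2 / 4)) * gaussExpSq))) := by
  have h := chernoff_sum (ι := Fin N) (f := fun _ x => tailSq M x / 4)
    (B := fun _ => Real.exp (-(M ^ 2 / 4)) * gaussExpSq) (fun _ => integrable_exp_tailSq hM)
    (fun _ => (integral_exp_tailSq_le hM).trans (by
      rw [add_comm]; exact Real.add_one_le_exp _)) (t / 4)
  refine (measure_mono fun x hx => ?_).trans (h.trans (le_of_eq ?_))
  · change t / 4 ≤ ∑ i, tailSq M (x i) / 4
    rw [← Finset.sum_div]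
    have : t ≤ ∑ i, tailSq M (x i) := hx
    linarith
  · simp

lemma sum_sq_subset_tail {N : ℕ} (R : Finset (Fin N)) (t : ℝ) :
    stdPi (Fin N) {h | t ≤ ∑ i ∈ R, (h i) ^ 2}
      ≤ ENNReal.ofReal (Real.exp (-(t / 4) + R.card * Real.log gaussExpSq)) := by
  classical
  have h := chernoff_sum (ι := Fin N) (f := fun i x => if i ∈ R then x ^ 2 / 4 else 0)
    (B := fun i => if i ∈ R then Real.log gaussExpSq else 0)
    (fun i => by
      by_cases hi : i ∈ R
      · simpa [hi] using integrable_exp_sq_gaussian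
      · simp [hi])
    (fun i => by
      by_cases hi : i ∈ R
      · simp only [hi, if_true]
        rw [Real.exp_log (by linarith [one_le_gaussExpSq])]
        rfl
      · simp [hi]) (t / 4)
  refine (measure_mono fun x hx => ?_).trans (h.trans (le_of_eq ?_))
  · change t / 4 ≤ ∑ i, if i ∈ R then (x i) ^ 2 / 4 else 0
    rw [← Finset.sum_filter, Finset.filter_mem_eq_inter, Finset.univ_inter, ← Finset.sum_div]
    have : t ≤ ∑ i ∈ R, (x i) ^ 2 := hx
    linarith
  · rw [← Finset.sum_filter, Finset.filter_mem_eq_inter, Finset.univ_inter]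
    simp

/-- The labels in the left summand, as a finite set. -/
def inlSet (K N : ℕ) : Finset (Fin K ⊕ Fin N) := Finset.univ.map Function.Embedding.inl

lemma sum_left_label {N K : ℕ} (c : Fin N → Fin K ⊕ Fin N) (g : Fin N → ℝ) :
    ∑ i, (if (c i).isLeft then g i else 0)
      = ∑ k ∈ inlSet K N, ∑ i, if c i = k then g i else 0 := by
  unfold inlSet
  rw [Finset.sum_comm]
  refine Finset.sum_congr rfl fun i _ => ?_
  rw [Finset.sum_ite_eq]
  rcases hc : c i with k | j <;> simp

lemma exists_coupling_perm {N K : ℕ} (c : Fin N → Fin K ⊕ Fin N) {M : ℝ} (hM : 0 < M)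
    (hr : ∀ i j, c i = Sum.inr j → j = i) (h h' : Fin N → ℝ) :
    ∃ p : Equiv.Perm (Fin N), (∀ i, c (p i) = c i) ∧
      ∑ i, (h i - h' (p i)) ^ 2
        ≤ 12 * M ^ 2 * ∫ x, ∑ k ∈ inlSet K N, |disc c k x h h'| ∂(unifIco M)
          + 3 * ∑ i, tailSq M (h i) + 3 * ∑ i, tailSq M (h' i)
          + 2 * ∑ i with (c i).isRight, (h i) ^ 2 + 2 * ∑ i with (c i).isRight, (h' i) ^ 2 := by
  have := isProbabilityMeasure_unifIco hM
  obtain ⟨p, hp, hmon⟩ := exists_monotone_matching c h h'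
  refine ⟨p, hp, ?_⟩
  have hpt : ∀ i, (h i - h' (p i)) ^ 2
      ≤ 6 * M * (if (c i).isLeft then |clp M (h i) - clp M (h' (p i))| else 0)
        + 3 * tailSq M (h i) + 3 * tailSq M (h' (p i))
        + 2 * (if (c i).isRight then (h i) ^ 2 else 0)
        + 2 * (if (c i).isRight then (h' i) ^ 2 else 0) := by
    intro i
    have t1 := tailSq_nonneg M (h i)
    have t2 := tailSq_nonneg M (h' (p i))
    rcases hc : c i with k | j
    · have h1 : |clp M (h i) - clp M (h' (p i))| ≤ 2 * M := by
        have a1 := abs_le.1 (abs_clp_le hM.le (h i))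
        have a2 := abs_le.1 (abs_clp_le hM.le (h' (p i)))
        rw [abs_le]; constructor <;> linarith
      have h2 : (clp M (h i) - clp M (h' (p i))) ^ 2 ≤ 2 * M * |clp M (h i) - clp M (h' (p i))| := by
        rw [← sq_abs, sq]
        exact mul_le_mul_of_nonneg_right h1 (abs_nonneg _)
      simp only [Sum.isLeft_inl, Sum.isRight_inl, if_true, Bool.false_eq_true, if_false]
      unfold tailSq
      nlinarith [sq_nonneg ((h i - clp M (h i)) - (clp M (h i) - clp M (h' (p i)))),
        sq_nonneg ((h i - clp M (h i)) + (h' (p i) - clp M (h' (p i)))),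
        sq_nonneg ((h' (p i) - clp M (h' (p i))) + (clp M (h i) - clp M (h' (p i))))]
    · have h3 : p i = i := by
        have h4 := hp i
        rw [hc] at h4
        rw [← hr (p i) j h4, ← hr i j hc]
      rw [h3] at t2 ⊢
      simp only [Sum.isLeft_inr, Sum.isRight_inr, if_true, Bool.false_eq_true, if_false]
      nlinarith [sq_nonneg (h i + h' i)]
  have hdint : ∀ i, Integrable (fun x => |stepLe x (h i) - stepLe x (h' (p i))|) (unifIco M) := by
    intro i
    have hm : ∀ a : ℝ, Measurable fun x => stepLe x a := fun a =>
      measurable_stepLe.comp (by fun_prop : Measurable fun x : ℝ => (x, a))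
    refine integrable_of_bounded ((hm _).sub (hm _)).abs.aestronglyMeasurable (C := 1) fun x => ?_
    rw [abs_abs, abs_le]
    constructor <;> linarith [stepLe_nonneg x (h i), stepLe_le_one x (h i),
      stepLe_nonneg x (h' (p i)), stepLe_le_one x (h' (p i))]
  have hcl : ∑ i, (if (c i).isLeft then |clp M (h i) - clp M (h' (p i))| else 0)
      ≤ 2 * M * ∫ x, ∑ k ∈ inlSet K N, |disc c k x h h'| ∂(unifIco M) := by
    have e : (fun x => ∑ k ∈ inlSet K N, |disc c k x h h'|)
        = fun x => ∑ i, if (c i).isLeft then |stepLe x (h i) - stepLe x (h' (p i))| else 0 := by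
      funext x
      rw [sum_left_label]
      exact Finset.sum_congr rfl fun k _ => (sum_abs_step_eq c h h' p hp hmon k x).symm
    rw [e, integral_finsetSum _ fun i _ => by split_ifs; exacts [hdint i, integrable_zero _ _ _],
      Finset.mul_sum]
    refine Finset.sum_le_sum fun i _ => ?_
    split_ifs
    · exact abs_clp_sub_le_unifIco hM _ _
    · simp
  have hsum := Finset.sum_le_sum fun i (_ : i ∈ Finset.univ) => hpt i
  simp only [Finset.sum_add_distrib, ← Finset.mul_sum] at hsum
  rw [Equiv.sum_comp p fun i => tailSq M (h' i), ← Finset.sum_filter, ← Finset.sum_filter,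
    ← Finset.sum_filter] at hsum
  rw [← Finset.sum_filter] at hcl
  nlinarith

lemma integral_coord {N : ℕ} (i : Fin N) {f : ℝ → ℝ} (hf : Measurable f) :
    ∫ h : Fin N → ℝ, f (h i) ∂(stdPi (Fin N)) = ∫ x, f x ∂(gaussianReal 0 1) :=
  integral_comp_measurePreserving (measurePreserving_eval (fun _ : Fin N => gaussianReal 0 1) i)
    hf.aestronglyMeasurable

lemma integrable_coord_comp {N : ℕ} (i : Fin N) {f : ℝ → ℝ}
    (hf : Integrable f (gaussianReal 0 1)) :
    Integrable (fun h : Fin N → ℝ => f (h i)) (stdPi (Fin N)) :=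
  (measurePreserving_eval (fun _ : Fin N => gaussianReal 0 1) i).integrable_comp_of_integrable hf

/-- Indices carrying a leftover label. -/
def leftover {N K : ℕ} (c : Fin N → Fin K ⊕ Fin N) : Finset (Fin N) :=
  Finset.univ.filter fun i => (c i).isRight

lemma W2sq_le_of_labels {N K : ℕ} (hN : 0 < N) (θ θs h : Fin N → ℝ) {α τ : ℝ} (hb : 0 ≤ α * τ)
    (c : Fin N → Fin K ⊕ Fin N) {M d : ℝ} (hM : 0 < M) (hd : 0 ≤ d)
    (hr : ∀ i j, c i = Sum.inr j → j = i)
    (hc : ∀ i j k, c i = Sum.inl k → c j = Sum.inl k → |θs i - θs j| ≤ d) :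
    W2sq (empDist2 θ θs) (muStar (empDist θs) τ α)
      ≤ 2 / N * ∑ i, (θ i - eta (θs i + τ * h i) (α * τ)) ^ 2
        + 4 * τ ^ 2 / N * (12 * M ^ 2 * meanDisc c (inlSet K N) M h
          + 3 * ∑ i, tailSq M (h i) + 3 * (N * (4 * (Real.exp (-(M ^ 2 / 4)) * gaussExpSq)))
          + 2 * ∑ i ∈ leftover c, (h i) ^ 2 + 2 * (leftover c).card)
        + 5 * d ^ 2 := by
  have := isProbabilityMeasure_unifIco hM
  have hN' : (0 : ℝ) < N := by exact_mod_cast hN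
  set μ := stdPi (Fin N) with hμ
  set D : (Fin N → ℝ) → ℝ := fun h' => ∫ x, ∑ k ∈ inlSet K N, |disc c k x h h'| ∂(unifIco M) with hD
  have hDint' : Integrable (fun q : (Fin N → ℝ) × ℝ => ∑ k ∈ inlSet K N, |disc c k q.2 h q.1|)
      (μ.prod (unifIco M)) :=
    integrable_of_bounded ((measurable_sum_disc c (inlSet K N)).comp
      (by fun_prop : Measurable fun q : (Fin N → ℝ) × ℝ => (h, q))).aestronglyMeasurable
      fun q => sum_disc_le c _ q.2 h q.1
  have hDint : Integrable D μ := hDint'.integral_prod_left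
  have hDval : ∫ h', D h' ∂μ = meanDisc c (inlSet K N) M h := by
    unfold meanDisc
    rw [integral_prod _ hDint']
  have hT : Integrable (fun h' : Fin N → ℝ => ∑ i, tailSq M (h' i)) μ :=
    integrable_finsetSum _ fun i _ => integrable_coord_comp i (integrable_tailSq hM.le)
  have hTval : ∫ h', ∑ i, tailSq M (h' i) ∂μ ≤ N * (4 * (Real.exp (-(M ^ 2 / 4)) * gaussExpSq)) := by
    rw [integral_finsetSum _ fun i _ => integrable_coord_comp i (integrable_tailSq hM.le)]
    refine (Finset.sum_le_card_nsmul _ _ (4 * (Real.exp (-(M ^ 2 / 4)) * gaussExpSq))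
      fun i _ => ?_).trans (by simp)
    rw [integral_coord i (continuous_tailSq M).measurable]
    exact integral_tailSq_le hM.le
  have hR : Integrable (fun h' : Fin N → ℝ => ∑ i ∈ leftover c, (h' i) ^ 2) μ :=
    integrable_finsetSum _ fun i _ => integrable_sq_coord i
  have hRval : ∫ h', ∑ i ∈ leftover c, (h' i) ^ 2 ∂μ = (leftover c).card := by
    rw [integral_finsetSum _ fun i _ => integrable_sq_coord i]
    have : ∀ i : Fin N, ∫ h' : Fin N → ℝ, (h' i) ^ 2 ∂μ = 1 := fun i => by
      rw [integral_coord i (f := fun x => x ^ 2) (by fun_prop), integral_sq_std]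
    rw [Finset.sum_congr rfl fun i _ => this i]
    simp
  set A : ℝ := 2 / N * ∑ i, (θ i - eta (θs i + τ * h i) (α * τ)) ^ 2
    + 4 * τ ^ 2 / N * (3 * ∑ i, tailSq M (h i) + 2 * ∑ i ∈ leftover c, (h i) ^ 2) + 5 * d ^ 2 with hA
  set B : (Fin N → ℝ) → ℝ := fun h' => A + 4 * τ ^ 2 / N * (12 * M ^ 2) * D h'
    + 4 * τ ^ 2 / N * 3 * ∑ i, tailSq M (h' i)
    + 4 * τ ^ 2 / N * 2 * ∑ i ∈ leftover c, (h' i) ^ 2 with hB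
  have i1 : Integrable (fun h' => A + 4 * τ ^ 2 / N * (12 * M ^ 2) * D h') μ :=
    (integrable_const A).add (hDint.const_mul (4 * τ ^ 2 / N * (12 * M ^ 2)))
  have i2 : Integrable (fun h' => A + 4 * τ ^ 2 / N * (12 * M ^ 2) * D h'
    + 4 * τ ^ 2 / N * 3 * ∑ i, tailSq M (h' i)) μ := i1.add (hT.const_mul (4 * τ ^ 2 / N * 3))
  have i3 : Integrable B μ := i2.add (hR.const_mul (4 * τ ^ 2 / N * 2))
  have hAi : ∫ _, A ∂μ = A := by simp [integral_const]
  have hBval : ∫ h', B h' ∂μ ≤ A + 4 * τ ^ 2 / N * (12 * M ^ 2) * meanDisc c (inlSet K N) M h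
      + 4 * τ ^ 2 / N * 3 * (N * (4 * (Real.exp (-(M ^ 2 / 4)) * gaussExpSq)))
      + 4 * τ ^ 2 / N * 2 * (leftover c).card := by
    rw [hB, integral_add i2 (hR.const_mul (4 * τ ^ 2 / N * 2)),
      integral_add i1 (hT.const_mul (4 * τ ^ 2 / N * 3)),
      integral_add (integrable_const A) (hDint.const_mul (4 * τ ^ 2 / N * (12 * M ^ 2))),
      integral_const_mul, integral_const_mul, integral_const_mul, hDval, hRval]
    gcongr
    exact hAi.le
  refine (W2sq_le hN θ θs hb i3 fun h' => ?_).trans (hBval.trans (le_of_eq ?_))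
  · obtain ⟨p, hp, hsum⟩ := exists_coupling_perm c hM hr h h'
    refine ⟨p, ?_⟩
    have hdist : ∀ i, |θs i - θs (p i)| ≤ d := fun i => by
      rcases hci : c i with k | j
      · exact hc i (p i) k hci ((hp i).trans hci)
      · have h4 := (hp i).trans hci
        rw [← hr (p i) j h4, ← hr i j hci]
        simpa using hd
    have hpt : ∀ i, (θ i - eta (θs (p i) + τ * h' (p i)) (α * τ)) ^ 2 + (θs i - θs (p i)) ^ 2
        ≤ 2 * (θ i - eta (θs i + τ * h i) (α * τ)) ^ 2 + 4 * τ ^ 2 * (h i - h' (p i)) ^ 2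
          + 5 * d ^ 2 := by
      intro i
      have hl := abs_eta_sub_le hb (θs i + τ * h i) (θs (p i) + τ * h' (p i))
      set a := eta (θs i + τ * h i) (α * τ)
      set b := eta (θs (p i) + τ * h' (p i)) (α * τ)
      have h1 : (θs i - θs (p i)) ^ 2 ≤ d ^ 2 := sq_le_sq' (abs_le.1 (hdist i)).1 (abs_le.1 (hdist i)).2
      have h2 := sq_le_sq.2 hl
      nlinarith [sq_nonneg (θ i - a - (a - b)),
        sq_nonneg ((θs i - θs (p i)) - τ * (h i - h' (p i)))]
    have hs : ∑ i, ((θ i - eta (θs (p i) + τ * h' (p i)) (α * τ)) ^ 2 + (θs i - θs (p i)) ^ 2)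
        ≤ 2 * ∑ i, (θ i - eta (θs i + τ * h i) (α * τ)) ^ 2
          + 4 * τ ^ 2 * ∑ i, (h i - h' (p i)) ^ 2 + N * (5 * d ^ 2) := by
      refine (Finset.sum_le_sum fun i _ => hpt i).trans (le_of_eq ?_)
      simp only [Finset.sum_add_distrib, Finset.mul_sum]
      simp
    have hs2 := hs.trans (add_le_add_left (add_le_add_right
      (mul_le_mul_of_nonneg_left hsum (by positivity : 0 ≤ 4 * τ ^ 2)) _) _)
    refine (mul_le_mul_of_nonneg_left hs2 (by positivity)).trans (le_of_eq ?_)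
    simp only [hB, hA, hD, leftover]
    field_simp
    ring
  · simp only [hA]
    field_simp
    ring

lemma exists_labels {N : ℕ} (θs : Fin N → ℝ) {s d : ℝ} (hd : 0 < d) :
    ∃ c : Fin N → Fin (⌊2 * s / d⌋₊ + 1) ⊕ Fin N,
      (∀ i j, c i = Sum.inr j → j = i) ∧
      (∀ i j k, c i = Sum.inl k → c j = Sum.inl k → |θs i - θs j| ≤ d) ∧
      ((leftover c).card : ℝ) ≤ ∑ j, if s < |θs j| then (1 : ℝ) else 0 := by
  classical
  have hlt : ∀ i, |θs i| ≤ s → ⌊(θs i + s) / d⌋₊ < ⌊2 * s / d⌋₊ + 1 := fun i hi =>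
    Nat.lt_succ_of_le (Nat.floor_mono (by gcongr; linarith [(abs_le.1 hi).2]))
  let c : Fin N → Fin (⌊2 * s / d⌋₊ + 1) ⊕ Fin N := fun i =>
    if h : |θs i| ≤ s then Sum.inl ⟨⌊(θs i + s) / d⌋₊, hlt i h⟩ else Sum.inr i
  have key : ∀ i k, c i = Sum.inl k → (k : ℝ) * d ≤ θs i + s ∧ θs i + s < (k + 1) * d := by
    intro i k h
    simp only [c] at h
    split_ifs at h with hi
    obtain rfl := Sum.inl_injective h
    have h0 : 0 ≤ (θs i + s) / d := div_nonneg (by linarith [(abs_le.1 hi).1]) hd.le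
    exact ⟨(le_div_iff₀ hd).1 (Nat.floor_le h0), (div_lt_iff₀ hd).1 (Nat.lt_floor_add_one _)⟩
  refine ⟨c, fun i j h => ?_, fun i j k h1 h2 => ?_, ?_⟩
  · simp only [c] at h
    split_ifs at h with hi
    exact (Sum.inr_injective h).symm
  · obtain ⟨a1, a2⟩ := key i k h1
    obtain ⟨b1, b2⟩ := key j k h2
    rw [abs_le]
    constructor <;> linarith
  · rw [← Finset.sum_filter, Finset.sum_const, nsmul_eq_mul, mul_one]
    refine Nat.cast_le.2 (Finset.card_le_card fun i hi => ?_)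
    simp only [leftover, Finset.mem_filter, Finset.mem_univ, true_and, c] at hi ⊢
    split_ifs at hi with h
    · simp at hi
    · exact not_le.1 h

lemma neg_log_ge {ε : ℝ} (hε : 0 < ε) (hε2 : ε ≤ 1 / 2) : 1 / 2 ≤ -Real.log ε := by
  have h := Real.log_le_log hε hε2
  have : Real.log (1 / 2 : ℝ) = -Real.log 2 := by simp
  linarith [Real.log_two_gt_d9]

set_option maxHeartbeats 400000 in
lemma exists_coupling_event {T p ξ : ℝ} (hT : 0 < T) (hp : 0 < p) (hξ : 0 < ξ) :
    ∃ C c : ℝ, 0 < C ∧ 0 < c ∧ ∀ N : ℕ, 0 < N → ∀ θs ∈ Fball N p ξ, ∀ ε : ℝ, 0 < ε → ε ≤ 1 / 2 →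
      ∃ E : Set (Fin N → ℝ),
        stdPi (Fin N) E ≤ ENNReal.ofReal (C * Real.exp (C * ε ^ (-(1 / 2 + 1 / p))
          - c * N * (ε ^ 2 / (Real.log ε) ^ 2))) ∧
        ∀ τ α : ℝ, 0 < τ → τ ≤ T → 0 ≤ α * τ → ∀ h ∉ E, ∀ θ : Fin N → ℝ,
          W2sq (empDist2 θ θs) (muStar (empDist θs) τ α)
            ≤ 2 / N * ∑ i, (θ i - eta (θs i + τ * h i) (α * τ)) ^ 2 + ε / 2 := by
  set M0 := gaussExpSq with hM0
  have hM1 : 1 ≤ M0 := one_le_gaussExpSq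
  have hM0p : 0 < M0 := by linarith
  set κ : ℝ := min 1 (1 / (600 * T ^ 2)) with hκdef
  have hκ : 0 < κ := lt_min one_pos (by positivity)
  have hκ1 : κ ≤ 1 := min_le_left _ _
  have hκT : T ^ 2 * κ ≤ 1 / 600 := by
    have : κ ≤ 1 / (600 * T ^ 2) := min_le_right _ _
    rw [le_div_iff₀ (by positivity)] at this
    linarith
  set κ' : ℝ := κ / (8 * (1 + Real.log M0)) with hκ'def
  have hlogM : 0 ≤ Real.log M0 := Real.log_nonneg hM1
  have hκ' : 0 < κ' := by positivity
  have hκ'κ : κ' ≤ κ := div_le_self hκ.le (by linarith)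
  have hκ'log : κ' * Real.log M0 ≤ κ / 8 := by
    rw [hκ'def, div_mul_eq_mul_div, div_le_div_iff₀ (by positivity) (by norm_num)]
    nlinarith
  set CM : ℝ := 4 * (1 + 2 * Real.log (8 * M0 / κ)) with hCM
  have hlog8 : 0 ≤ Real.log (8 * M0 / κ) := Real.log_nonneg (by
    rw [le_div_iff₀ hκ]; linarith)
  have hCMp : 0 < CM := by positivity
  set CK : ℝ := 2 * (ξ * κ' ^ (-(1 / p))) * Real.sqrt 60 + 1 with hCK
  have hCKp : 0 < CK := by positivity
  refine ⟨3 + CK, min (κ ^ 2 / (2 * CM ^ 2)) (κ / 16), by positivity, lt_min (by positivity)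
    (by positivity), fun N hN θs hθs ε hε hε2 => ?_⟩
  have hN' : (0 : ℝ) < N := by exact_mod_cast hN
  set L := -Real.log ε with hL
  have hL2 : 1 / 2 ≤ L := neg_log_ge hε hε2
  have hLsq : (Real.log ε) ^ 2 = L ^ 2 := by rw [hL]; ring
  set M := Real.sqrt (4 * Real.log (8 * M0 / (κ * ε))) with hM
  have hlogpos : Real.log (8 * M0 / (κ * ε)) = Real.log (8 * M0 / κ) + L := by
    rw [← div_div, Real.log_div (by positivity) hε.ne', hL]; ring
  have hMsq : M ^ 2 = 4 * Real.log (8 * M0 / (κ * ε)) := Real.sq_sqrt (by rw [hlogpos]; linarith)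
  have hMpos : 0 < M := Real.sqrt_pos.2 (by rw [hlogpos]; linarith)
  have hMexp : Real.exp (-(M ^ 2 / 4)) * M0 = κ * ε / 8 := by
    have : -(M ^ 2 / 4) = -Real.log (8 * M0 / (κ * ε)) := by rw [hMsq]; ring
    rw [this, Real.exp_neg, Real.exp_log (by positivity)]
    field_simp
  have hMle : M ^ 2 ≤ CM * L := by
    rw [hMsq, hlogpos, hCM]
    have := mul_nonneg hlog8 (by linarith : 0 ≤ 2 * L - 1)
    linarith
  set s := ξ * (κ' * ε) ^ (-(1 / p)) with hs
  have hspos : 0 < s := by positivity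
  have hξs : (ξ / s) ^ p = κ' * ε := by
    have : ξ / s = (κ' * ε) ^ (1 / p) := by
      rw [hs, Real.rpow_neg (by positivity)]
      field_simp
    rw [this, ← Real.rpow_mul (by positivity), one_div, inv_mul_cancel₀ hp.ne', Real.rpow_one]
  set d := Real.sqrt (ε / 60) with hd
  have hdpos : 0 < d := Real.sqrt_pos.2 (by positivity)
  have hdsq : d ^ 2 = ε / 60 := Real.sq_sqrt (by positivity)
  obtain ⟨K, hK, c, hr, hc, hcard⟩ : ∃ K : ℕ, K = ⌊2 * s / d⌋₊ + 1 ∧ ∃ c : Fin N → Fin K ⊕ Fin N,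
      (∀ i j, c i = Sum.inr j → j = i) ∧
      (∀ i j k, c i = Sum.inl k → c j = Sum.inl k → |θs i - θs j| ≤ d) ∧
      ((leftover c).card : ℝ) ≤ ∑ j, if s < |θs j| then (1 : ℝ) else 0 :=
    ⟨_, rfl, exists_labels θs hdpos⟩
  have hcard2 : ((leftover c).card : ℝ) ≤ N * (κ' * ε) := by
    rw [← hξs]; exact hcard.trans (Fball_count hN hp hξ hspos hθs)
  have hKle : (K : ℝ) ≤ CK * ε ^ (-(1 / 2 + 1 / p)) := by
    have h1 : (K : ℝ) ≤ 2 * s / d + 1 := by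
      rw [hK]; push_cast
      linarith [Nat.floor_le (by positivity : 0 ≤ 2 * s / d)]
    have h2 : 2 * s / d = 2 * (ξ * κ' ^ (-(1 / p))) * Real.sqrt 60 * ε ^ (-(1 / 2 + 1 / p)) := by
      have e1 : ε ^ (-(1 / 2 + 1 / p)) = ε ^ (-(1 / p)) * (Real.sqrt ε)⁻¹ := by
        rw [Real.sqrt_eq_rpow, ← Real.rpow_neg hε.le, ← Real.rpow_add hε]
        congr 1; ring
      rw [e1, hs, hd, Real.sqrt_div hε.le, Real.mul_rpow hκ'.le hε.le]
      field_simp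
    have h3 : 1 ≤ ε ^ (-(1 / 2 + 1 / p)) :=
      Real.one_le_rpow_of_pos_of_le_one_of_nonpos hε (by linarith)
        (by have : 0 < 1 / p := by positivity
            linarith)
    rw [h2] at h1
    rw [hCK]
    linarith
  refine ⟨{h | κ * ε / M ^ 2 * N ≤ meanDisc c (inlSet K N) M h}
    ∪ ({h | κ * ε * N ≤ ∑ i, tailSq M (h i)} ∪ {h | κ * ε * N ≤ ∑ i ∈ leftover c, (h i) ^ 2}), ?_, ?_⟩
  · set c0 := min (κ ^ 2 / (2 * CM ^ 2)) (κ / 16) with hc0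
    set x := (N : ℝ) * (ε ^ 2 / L ^ 2) with hx
    have hx0 : 0 ≤ x := by positivity
    have hKexp : (1 : ℝ) ≤ Real.exp (CK * ε ^ (-(1 / 2 + 1 / p))) := Real.one_le_exp (by positivity)
    have hsmall : Real.exp (-(κ * ε * N / 8)) ≤ Real.exp (CK * ε ^ (-(1 / 2 + 1 / p)) - c0 * x) := by
      refine Real.exp_le_exp.2 ?_
      have h1 : c0 * x ≤ κ / 16 * x := mul_le_mul_of_nonneg_right (min_le_right _ _) hx0
      have h2 : ε ^ 2 / L ^ 2 ≤ 2 * ε := by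
        rw [div_le_iff₀ (by positivity)]
        have h21 : (1 / 2 : ℝ) ^ 2 ≤ L ^ 2 := by gcongr
        have h22 := mul_le_mul_of_nonneg_left h21 hε.le
        have h23 := mul_le_mul_of_nonneg_left hε2 hε.le
        linarith
      have h3 : x ≤ N * (2 * ε) := mul_le_mul_of_nonneg_left h2 hN'.le
      have h4 : κ / 16 * x ≤ κ / 16 * (N * (2 * ε)) := mul_le_mul_of_nonneg_left h3 (by positivity)
      have h5 : 0 ≤ CK * ε ^ (-(1 / 2 + 1 / p)) := by positivity
      linarith
    have hP1 : stdPi (Fin N) {h | κ * ε / M ^ 2 * N ≤ meanDisc c (inlSet K N) M h}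
        ≤ ENNReal.ofReal (Real.exp (CK * ε ^ (-(1 / 2 + 1 / p)) - c0 * x)) := by
      refine (meanDisc_tail c (inlSet K N) hMpos (by positivity)).trans (ENNReal.ofReal_le_ofReal ?_)
      have hcardS : (inlSet K N).card = K := by simp [inlSet]
      rw [hcardS, sub_eq_add_neg, Real.exp_add]
      refine mul_le_mul ?_ ?_ (Real.exp_pos _).le (Real.exp_pos _).le
      · calc (2 : ℝ) ^ K ≤ Real.exp 1 ^ K := by
              gcongr; linarith [Real.exp_one_gt_d9]
          _ = Real.exp K := by rw [← Real.exp_nat_mul, mul_one]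
          _ ≤ _ := Real.exp_le_exp.2 hKle
      · refine Real.exp_le_exp.2 (neg_le_neg ?_)
        have h1 : c0 * x ≤ κ ^ 2 / (2 * CM ^ 2) * x :=
          mul_le_mul_of_nonneg_right (min_le_left _ _) hx0
        refine h1.trans ?_
        have h2 : 1 / (CM * L) ≤ 1 / M ^ 2 := one_div_le_one_div_of_le (by positivity) hMle
        have h3 : (1 / (CM * L)) ^ 2 ≤ (1 / M ^ 2) ^ 2 := by gcongr
        calc κ ^ 2 / (2 * CM ^ 2) * x = (κ * ε) ^ 2 * N / 2 * (1 / (CM * L)) ^ 2 := by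
              rw [hx]; field_simp
          _ ≤ (κ * ε) ^ 2 * N / 2 * (1 / M ^ 2) ^ 2 := by gcongr
          _ = _ := by ring
    have hP2 : stdPi (Fin N) {h | κ * ε * N ≤ ∑ i, tailSq M (h i)}
        ≤ ENNReal.ofReal (Real.exp (CK * ε ^ (-(1 / 2 + 1 / p)) - c0 * x)) := by
      refine (sum_tailSq_tail hMpos.le _).trans (ENNReal.ofReal_le_ofReal (le_trans ?_ hsmall))
      rw [← hM0, hMexp]
      refine Real.exp_le_exp.2 (le_of_eq ?_)
      ring
    have hP3 : stdPi (Fin N) {h | κ * ε * N ≤ ∑ i ∈ leftover c, (h i) ^ 2}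
        ≤ ENNReal.ofReal (Real.exp (CK * ε ^ (-(1 / 2 + 1 / p)) - c0 * x)) := by
      refine (sum_sq_subset_tail _ _).trans (ENNReal.ofReal_le_ofReal (le_trans ?_ hsmall))
      refine Real.exp_le_exp.2 ?_
      have h1 : ((leftover c).card : ℝ) * Real.log M0 ≤ N * (κ' * ε) * Real.log M0 :=
        mul_le_mul_of_nonneg_right hcard2 hlogM
      have h2 : N * (κ' * ε) * Real.log M0 ≤ N * ε * (κ / 8) := by
        calc N * (κ' * ε) * Real.log M0 = N * ε * (κ' * Real.log M0) := by ring
          _ ≤ _ := by gcongr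
      rw [← hM0]
      linarith
    refine (measure_union_le _ _).trans ((add_le_add hP1 ((measure_union_le _ _).trans
      (add_le_add hP2 hP3))).trans ?_)
    rw [← ENNReal.ofReal_add (by positivity) (by positivity),
      ← ENNReal.ofReal_add (by positivity) (by positivity)]
    refine ENNReal.ofReal_le_ofReal ?_
    rw [hLsq, mul_assoc c0]
    have h6 : Real.exp (CK * ε ^ (-(1 / 2 + 1 / p)) - c0 * x)
        ≤ Real.exp ((3 + CK) * ε ^ (-(1 / 2 + 1 / p)) - c0 * x) := by
      refine Real.exp_le_exp.2 ?_
      have : 0 < ε ^ (-(1 / 2 + 1 / p)) := by positivity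
      linarith
    have h7 := mul_pos hCKp (Real.exp_pos ((3 + CK) * ε ^ (-(1 / 2 + 1 / p)) - c0 * x))
    linarith
  · intro τ α hτ hτT hb h hh θ
    simp only [Set.mem_union, not_or, Set.mem_ofPred_eq, not_le] at hh
    obtain ⟨h1, h2, h3⟩ := hh
    refine (W2sq_le_of_labels hN θ θs h hb c hMpos hdpos.le hr hc).trans ?_
    rw [← hM0, hMexp, hdsq, add_assoc]
    have h1' : 12 * M ^ 2 * meanDisc c (inlSet K N) M h ≤ 12 * (κ * ε * N) := by
      have := mul_le_mul_of_nonneg_left h1.le (by positivity : 0 ≤ 12 * M ^ 2)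
      refine this.trans (le_of_eq ?_)
      field_simp
    have hcard3 : ((leftover c).card : ℝ) ≤ N * (κ * ε) := hcard2.trans (by gcongr)
    have hin : 12 * M ^ 2 * meanDisc c (inlSet K N) M h + 3 * ∑ i, tailSq M (h i)
        + 3 * (N * (4 * (κ * ε / 8))) + 2 * ∑ i ∈ leftover c, (h i) ^ 2
        + 2 * ((leftover c).card : ℝ) ≤ 21 * (κ * ε * N) := by
      have : 0 ≤ N * (κ * ε) := by positivity
      linarith
    have hout : 4 * τ ^ 2 / N * (12 * M ^ 2 * meanDisc c (inlSet K N) M h + 3 * ∑ i, tailSq M (h i)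
        + 3 * (N * (4 * (κ * ε / 8))) + 2 * ∑ i ∈ leftover c, (h i) ^ 2
        + 2 * ((leftover c).card : ℝ)) ≤ 84 * ε / 600 := by
      calc _ ≤ 4 * T ^ 2 / N * (21 * (κ * ε * N)) := by
            refine (mul_le_mul_of_nonneg_left hin (by positivity)).trans ?_
            gcongr
        _ = 84 * ε * (T ^ 2 * κ) := by field_simp; ring
        _ ≤ 84 * ε * (1 / 600) := by gcongr
        _ = _ := by ring
    linarith

lemma radius_lower {a V q σ T T' : ℝ} (hT : 0 < T) (hT' : 0 < T')
    (hq : q ^ 2 ≤ a * V) (hT2 : T ^ 2 = a + 2 * q + V + σ ^ 2) (hT2' : T' ^ 2 = a + σ ^ 2) :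
    T' + q / T' + σ ^ 2 * V / (2 * T * T' ^ 2) ≤ T := by
  have h1 : (T * T') ^ 2 - (T' ^ 2 + q) ^ 2 ≥ σ ^ 2 * V := by
    have : (T * T') ^ 2 = (a + 2 * q + V + σ ^ 2) * (a + σ ^ 2) := by rw [mul_pow, hT2, hT2']
    rw [this, hT2']
    nlinarith
  have hTT : 0 < T * T' := mul_pos hT hT'
  have hVσ : 0 ≤ σ ^ 2 * V ∨ σ ^ 2 * V < 0 := le_or_gt 0 _
  have h2 : T' ^ 2 + q + σ ^ 2 * V / (2 * (T * T')) ≤ T * T' := by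
    rw [← le_sub_iff_add_le', div_le_iff₀ (by positivity)]
    nlinarith [sq_nonneg (T * T' - (T' ^ 2 + q))]
  have h3 : T' + q / T' + σ ^ 2 * V / (2 * T * T' ^ 2)
      = (T' ^ 2 + q + σ ^ 2 * V / (2 * (T * T'))) / T' := by
    field_simp
  rw [h3, div_le_iff₀ hT']
  exact h2

lemma radius_upper {a V q σ T T' R : ℝ} (hT' : 0 < T') (hR : 0 ≤ R) (hV : V = R ^ 2)
    (hq : |q| ≤ T' * R) (hT2 : T ^ 2 = a + 2 * q + V + σ ^ 2) (hT2' : T' ^ 2 = a + σ ^ 2) :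
    T ≤ T' + R := by
  refine le_of_not_gt fun hlt => ?_
  have := mul_self_lt_mul_self (by positivity : 0 ≤ T' + R) hlt
  nlinarith [le_abs_self q]

lemma abs_sub_le_of_sq {x y ρ s : ℝ} (hs : 0 < s) (hx : 0 ≤ x) (hy : s ≤ y)
    (h : |x ^ 2 - y ^ 2| ≤ ρ) : |x - y| ≤ ρ / s := by
  rw [le_div_iff₀ hs]
  have h1 : |x ^ 2 - y ^ 2| = |x - y| * (x + y) := by
    rw [← abs_of_nonneg (by linarith : 0 ≤ x + y), ← abs_mul]
    congr 1; ring
  rw [h1] at h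
  nlinarith [abs_nonneg (x - y)]

lemma process_gap {bmin tmax rmax σ β τ ρ r R T T' G q : ℝ} (hσ : 0 < σ) (hbmin : 0 < bmin)
    (hβ : bmin ≤ β) (hβτ : β ≤ τ) (hτ : τ ≤ tmax) (hστ : σ ≤ τ) (hρ : ρ ≤ 1 / 2)
    (hG : |G - 1| ≤ ρ) (hT' : 0 < T') (hT'τ : |T' - τ| ≤ ρ / σ) (hT : 0 < T) (hr : 0 < r)
    (hrmax : r ≤ rmax) (hrR : r ≤ R) (hq : |q| ≤ T' * R) (hTR : T ≤ T' + R)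
    (hlow : T' + q / T' + σ ^ 2 * R ^ 2 / (2 * T * T' ^ 2) ≤ T)
    (hρr : ρ * (tmax + 1 / σ) ≤
      bmin * σ ^ 2 / (8 * (tmax + 1 / σ) ^ 2 * (tmax + 1 / σ + rmax)) * r) :
    bmin * σ ^ 2 / (8 * (tmax + 1 / σ) ^ 2 * (tmax + 1 / σ + rmax)) * r ^ 2
      ≤ β * G * (T - T') - β / τ * q := by
  have hρ0 : 0 ≤ ρ := (abs_nonneg _).trans hG
  have hτ0 : 0 < τ := hσ.trans_le hστ
  have hβ0 : 0 < β := hbmin.trans_le hβ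
  have hR : 0 < R := hr.trans_le hrR
  set B := tmax + 1 / σ with hB
  have hBσ : 0 < 1 / σ := by positivity
  have hB0 : 0 < B := by linarith
  have hρσ : ρ / σ ≤ 1 / σ := by gcongr; linarith
  have hT'B : T' ≤ B := by linarith [(abs_le.1 hT'τ).2]
  have hG2 : 1 / 2 ≤ G := by linarith [(abs_le.1 hG).1]
  have h1 : q / T' + σ ^ 2 * R ^ 2 / (2 * T * T' ^ 2) ≤ T - T' := by linarith
  have h2 := mul_le_mul_of_nonneg_left h1 (by positivity : 0 ≤ β * G)
  have h3 : β * G * (q / T' + σ ^ 2 * R ^ 2 / (2 * T * T' ^ 2)) - β / τ * q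
      = β / τ * (q / T') * (G * τ - T') + β * G * (σ ^ 2 * R ^ 2 / (2 * T * T' ^ 2)) := by
    field_simp
    ring
  have h4 : |β / τ * (q / T') * (G * τ - T')| ≤ R * (ρ * B) := by
    rw [abs_mul, abs_mul, abs_div q, abs_of_pos hT', abs_of_pos (by positivity : 0 < β / τ)]
    have a1 : β / τ ≤ 1 := (div_le_one hτ0).2 hβτ
    have a2 : |q| / T' ≤ R := by rw [div_le_iff₀ hT']; linarith
    have a3 : |G * τ - T'| ≤ ρ * B := by
      have : G * τ - T' = (G - 1) * τ - (T' - τ) := by ring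
      rw [this]
      refine (abs_sub _ _).trans ?_
      rw [abs_mul, abs_of_pos hτ0]
      have : |G - 1| * τ ≤ ρ * tmax := mul_le_mul hG hτ hτ0.le hρ0
      have e : ρ * B = ρ * tmax + ρ / σ := by rw [hB]; ring
      linarith
    have a4 : β / τ * (|q| / T') ≤ 1 * R := mul_le_mul a1 a2 (by positivity) zero_le_one
    rw [one_mul] at a4
    exact mul_le_mul a4 a3 (abs_nonneg _) hR.le
  have h5 : 2 * (bmin * σ ^ 2 / (8 * B ^ 2 * (B + rmax)) * r) * R
      ≤ β * G * (σ ^ 2 * R ^ 2 / (2 * T * T' ^ 2)) := by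
    have b1 : bmin * (1 / 2) ≤ β * G := mul_le_mul hβ hG2 (by norm_num) hβ0.le
    have b2 : T * T' ^ 2 ≤ (B + R) * B ^ 2 := by
      have : T' ^ 2 ≤ B ^ 2 := by gcongr
      exact mul_le_mul (by linarith) this (by positivity) (by positivity)
    have b3 : r / (B + rmax) ≤ R / (B + R) := by
      rw [div_le_div_iff₀ (by linarith) (by positivity)]
      nlinarith
    have b4 : σ ^ 2 * R ^ 2 / (2 * ((B + R) * B ^ 2)) ≤ σ ^ 2 * R ^ 2 / (2 * T * T' ^ 2) := by
      rw [mul_assoc 2 T]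
      gcongr
    have hBr : 0 < B + rmax := by linarith
    calc 2 * (bmin * σ ^ 2 / (8 * B ^ 2 * (B + rmax)) * r) * R
        = bmin * (1 / 2) * (σ ^ 2 * R / (2 * B ^ 2)) * (r / (B + rmax)) := by
          field_simp; ring
      _ ≤ bmin * (1 / 2) * (σ ^ 2 * R / (2 * B ^ 2)) * (R / (B + R)) := by gcongr
      _ = bmin * (1 / 2) * (σ ^ 2 * R ^ 2 / (2 * ((B + R) * B ^ 2))) := by field_simp
      _ ≤ _ := mul_le_mul b1 b4 (by positivity) (by positivity)
  set c := bmin * σ ^ 2 / (8 * B ^ 2 * (B + rmax)) with hc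
  have hc0 : 0 ≤ c := by
    have : 0 < B + rmax := by linarith
    positivity
  have h6 : c * r ^ 2 ≤ c * r * R := by
    rw [sq, ← mul_assoc]
    exact mul_le_mul_of_nonneg_left hrR (by positivity)
  have h7 : R * (ρ * B) ≤ R * (c * r) := mul_le_mul_of_nonneg_left hρr hR.le
  have h8 := (abs_le.1 h4).1
  linarith

/-- Subgradient inequality for the absolute value at a soft-thresholded point. -/
lemma soft_subgradient {lam β τ : ℝ} (hlam : 0 < lam) (hβ : 0 < β) (hτ : 0 < τ) (θ h w : ℝ) :
    (β * h - β / τ * (eta (θ + τ * h) (τ * lam / β) - θ))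
      * (w - (eta (θ + τ * h) (τ * lam / β) - θ))
      ≤ lam * |θ + w| - lam * |eta (θ + τ * h) (τ * lam / β)| := by
  have hb : 0 < τ * lam / β := by positivity
  set b := τ * lam / β with hbdef
  have e1 := eta_eq hb.le (θ + τ * h)
  have e2 := eta_mul_clp hb.le (θ + τ * h)
  have e3 := abs_clp_le hb.le (θ + τ * h)
  set a := eta (θ + τ * h) b
  set k := clp b (θ + τ * h)
  have h1 : k * (θ + w) ≤ b * |θ + w| := by
    refine (le_abs_self _).trans ?_
    rw [abs_mul]
    exact mul_le_mul_of_nonneg_right e3 (abs_nonneg _)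
  have h2 : k * (θ + w - a) ≤ b * (|θ + w| - |a|) := by linarith
  have h3 : β * h - β / τ * (a - θ) = β / τ * k := by
    rw [e1]; field_simp; ring
  have h4 : lam = β / τ * b := by rw [hbdef]; field_simp
  rw [h3]
  have h5 := mul_le_mul_of_nonneg_left h2 (by positivity : 0 ≤ β / τ)
  calc _ = β / τ * (k * (θ + w - a)) := by ring
    _ ≤ _ := h5
    _ = β / τ * b * |θ + w| - β / τ * b * |a| := by ring
    _ = _ := by rw [← h4]

/-- The error of the soft-thresholding denoiser in the scalar Gaussian channel. -/
def denoiseErr {N : ℕ} (θs : Fin N → ℝ) (τ b : ℝ) (h : Fin N → ℝ) (j : Fin N) : ℝ :=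
  eta (θs j + τ * h j) b - θs j

/-- The Gaussian vectors of Gordon's comparison are `ρ`-typical for the fixed point `(β, τ)`. -/
structure Typical {n N : ℕ} (σ ρ lam β τ m : ℝ) (θs : Fin N → ℝ)
    (ω : (Fin n → ℝ) × (Fin N → ℝ) × ℝ) : Prop where
  noise : |∑ i, ω.1 i ^ 2 - n| ≤ ρ * n
  err_sq : |∑ j, denoiseErr θs τ (τ * lam / β) ω.2.1 j ^ 2 - n * (τ ^ 2 - σ ^ 2)| ≤ ρ * n
  err_mul : |∑ j, ω.2.1 j * denoiseErr θs τ (τ * lam / β) ω.2.1 j - n * (τ - β)| ≤ ρ * n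
  penalty : |lam * ∑ j, |θs j + denoiseErr θs τ (τ * lam / β) ω.2.1 j| - n * m| ≤ ρ * n
  scalar : |ω.2.2| ≤ ρ * √n

lemma abs_div_sub_le {x y ρ n : ℝ} (hn : 0 < n) (h : |x - n * y| ≤ ρ * n) : |x / n - y| ≤ ρ := by
  have : x / n - y = (x - n * y) / n := by field_simp
  rw [this, abs_div, abs_of_pos hn, div_le_iff₀ hn]
  exact h

lemma scale_value {r n : ℝ} (hr : 0 < r) (hn : r * r = n) (T x y s : ℝ) :
    T * x + (y - s / r) = r * (T * (x / r) + y / r - s / n) := by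
  subst hn; field_simp; ring

section
variable {n N : ℕ} {σ ρ lam β τ m : ℝ} {θs : Fin N → ℝ} {ω : (Fin n → ℝ) × (Fin N → ℝ) × ℝ}

lemma Typical.radius (hn : 0 < n) (hσ : 0 < σ) (hτ : σ ≤ τ) (H : Typical σ ρ lam β τ m θs ω) :
    |√((∑ j, denoiseErr θs τ (τ * lam / β) ω.2.1 j ^ 2) / n + σ ^ 2) - τ| ≤ ρ / σ := by
  refine abs_sub_le_of_sq hσ (Real.sqrt_nonneg _) hτ ?_
  rw [Real.sq_sqrt (by positivity)]
  have := abs_div_sub_le (by exact_mod_cast hn) H.err_sq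
  rwa [show ∀ a : ℝ, a + σ ^ 2 - τ ^ 2 = a - (τ ^ 2 - σ ^ 2) from fun a => by ring]

lemma Typical.norm_noise (hn : 0 < n) (H : Typical σ ρ lam β τ m θs ω) :
    |nrm ω.1 / √n - 1| ≤ ρ := by
  have hn' : (0 : ℝ) < n := by exact_mod_cast hn
  rw [← div_one ρ]
  refine abs_sub_le_of_sq one_pos (div_nonneg (nrm_nonneg _) (Real.sqrt_nonneg _)) le_rfl ?_
  rw [div_pow, nrm_sq, Real.sq_sqrt hn'.le, one_pow]
  exact abs_div_sub_le hn' (by simpa using H.noise)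

lemma Typical.value {tmax : ℝ} (hn : 0 < n) (hσ : 0 < σ) (hτ : σ ≤ τ) (hτm : τ ≤ tmax)
    (hρ1 : ρ ≤ 1) (H : Typical σ ρ lam β τ m θs ω) :
    |√((∑ j, denoiseErr θs τ (τ * lam / β) ω.2.1 j ^ 2) / n + σ ^ 2) * (nrm ω.1 / √n)
      + σ * (ω.2.2 / √n) - (∑ j, ω.2.1 j * denoiseErr θs τ (τ * lam / β) ω.2.1 j) / n - β|
      ≤ (tmax + 2 / σ + σ + 1) * ρ := by
  have hn' : (0 : ℝ) < n := by exact_mod_cast hn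
  have hs : 0 < √(n : ℝ) := Real.sqrt_pos.2 hn'
  have hT := H.radius hn hσ hτ
  have hG := H.norm_noise hn
  have hk : |ω.2.2 / √n| ≤ ρ := by
    rw [abs_div, abs_of_pos hs, div_le_iff₀ hs]; exact H.scalar
  have hs' := abs_div_sub_le hn' H.err_mul
  have hT0 := Real.sqrt_nonneg ((∑ j, denoiseErr θs τ (τ * lam / β) ω.2.1 j ^ 2) / n + σ ^ 2)
  have hρ0 : 0 ≤ ρ := (abs_nonneg _).trans hG
  generalize √((∑ j, denoiseErr θs τ (τ * lam / β) ω.2.1 j ^ 2) / n + σ ^ 2) = T at *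
  generalize nrm ω.1 / √n = G at *
  generalize ω.2.2 / √n = k at *
  generalize (∑ j, ω.2.1 j * denoiseErr θs τ (τ * lam / β) ω.2.1 j) / n = s at *
  have hρσ : ρ / σ ≤ 1 / σ := by gcongr
  have hTB : T ≤ tmax + 1 / σ := by linarith [(abs_le.1 hT).2]
  have h1 : |T * (G - 1)| ≤ (tmax + 1 / σ) * ρ := by
    rw [abs_mul, abs_of_nonneg hT0]
    exact mul_le_mul hTB hG (abs_nonneg _) (hT0.trans hTB)
  have h2 : |σ * k| ≤ σ * ρ := by
    rw [abs_mul, abs_of_pos hσ]; exact mul_le_mul_of_nonneg_left hk hσ.le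
  have h3 : (tmax + 2 / σ + σ + 1) * ρ = (tmax + 1 / σ) * ρ + ρ / σ + σ * ρ + ρ := by ring
  rw [h3]
  rw [abs_le] at *
  constructor <;> linarith [h1.1, h1.2, h2.1, h2.2, hs'.1, hs'.2, hT.1, hT.2]

lemma Typical.upper {tmax : ℝ} (hn : 0 < n) (hσ : 0 < σ) (hτ : σ ≤ τ) (hτm : τ ≤ tmax)
    (hβ : 0 < β) (hβτ : β ≤ τ) (hρ1 : ρ ≤ 1) (H : Typical σ ρ lam β τ m θs ω) :
    (max 0 (√((∑ j, denoiseErr θs τ (τ * lam / β) ω.2.1 j ^ 2) / n + σ ^ 2) * nrm ω.1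
      + (σ * ω.2.2 - (∑ j, ω.2.1 j * denoiseErr θs τ (τ * lam / β) ω.2.1 j) / √n))) ^ 2 / 2
      + lam * ∑ j, |θs j + denoiseErr θs τ (τ * lam / β) ω.2.1 j|
      ≤ n * (β ^ 2 / 2 + m + ((tmax + 2 / σ + σ + 1) * tmax + (tmax + 2 / σ + σ + 1) ^ 2 + 1) * ρ) := by
  have hn' : (0 : ℝ) < n := by exact_mod_cast hn
  have hs : 0 < √(n : ℝ) := Real.sqrt_pos.2 hn'
  have hss : √(n : ℝ) * √n = n := Real.mul_self_sqrt hn'.le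
  have hv := H.value hn hσ hτ hτm hρ1
  have hA := H.penalty
  have hρ0 : 0 ≤ ρ := (abs_nonneg _).trans (H.norm_noise hn)
  set C1 := tmax + 2 / σ + σ + 1
  have hC1 : 0 ≤ C1 := by
    have : 0 < 2 / σ := by positivity
    simp only [C1]; linarith
  generalize √((∑ j, denoiseErr θs τ (τ * lam / β) ω.2.1 j ^ 2) / n + σ ^ 2) = T at *
  generalize (∑ j, ω.2.1 j * denoiseErr θs τ (τ * lam / β) ω.2.1 j) = s at *
  have e : T * nrm ω.1 + (σ * ω.2.2 - s / √n)
      = √n * (T * (nrm ω.1 / √n) + σ * (ω.2.2 / √n) - s / n) := by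
    rw [← mul_div_assoc σ]; exact scale_value hs hss _ _ _ _
  rw [e]
  generalize T * (nrm ω.1 / √n) + σ * (ω.2.2 / √n) - s / n = x at *
  have h1 : max 0 (√n * x) ≤ √n * (β + C1 * ρ) := by
    refine max_le (by positivity) (mul_le_mul_of_nonneg_left ?_ hs.le)
    linarith [(abs_le.1 hv).2]
  have h2 : (max 0 (√n * x)) ^ 2 ≤ n * (β + C1 * ρ) ^ 2 := by
    calc _ ≤ (√n * (β + C1 * ρ)) ^ 2 := pow_le_pow_left₀ (le_max_left _ _) h1 2
      _ = _ := by rw [mul_pow, sq (√(n : ℝ)), hss]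
  have h3 : (β + C1 * ρ) ^ 2 / 2 ≤ β ^ 2 / 2 + C1 * tmax * ρ + C1 ^ 2 * ρ := by
    have a1 : C1 * ρ * β ≤ C1 * ρ * tmax :=
      mul_le_mul_of_nonneg_left (hβτ.trans hτm) (by positivity)
    have a2 : C1 ^ 2 * ρ ^ 2 ≤ C1 ^ 2 * ρ := by
      refine mul_le_mul_of_nonneg_left ?_ (by positivity)
      nlinarith
    have a3 : 0 ≤ C1 ^ 2 * ρ := by positivity
    nlinarith
  have h4 := mul_le_mul_of_nonneg_left h3 hn'.le
  have h5 := (abs_le.1 hA).2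
  nlinarith

lemma exists_dual_noise (hn : 0 < n) (hβ : 0 < β) (hg : 0 < nrm ω.1) (w : Fin N → ℝ) :
    ∃ u, valG σ ω u w - nrm u ^ 2 / 2
      = n * (β * (√((∑ j, w j ^ 2) / n + σ ^ 2) * (nrm ω.1 / √n) + σ * (ω.2.2 / √n)
        - (∑ j, ω.2.1 j * w j) / n) - β ^ 2 / 2) := by
  have hn' : (0 : ℝ) < n := by exact_mod_cast hn
  have hs : 0 < √(n : ℝ) := Real.sqrt_pos.2 hn'
  have hss : √(n : ℝ) * √n = n := Real.mul_self_sqrt hn'.le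
  have hk : 0 ≤ β * √n / nrm ω.1 := by positivity
  refine ⟨fun i => β * √n / nrm ω.1 * ω.1 i, ?_⟩
  have e1 : nrm (fun i => β * √n / nrm ω.1 * ω.1 i) = β * √n := by
    refine (sq_eq_sq₀ (nrm_nonneg _) (by positivity)).1 ?_
    rw [nrm_sq]
    simp only [mul_pow]
    rw [← Finset.mul_sum, ← nrm_sq]
    field_simp
  have e2 : ∑ i, ω.1 i * (β * √n / nrm ω.1 * ω.1 i) = β * √n * nrm ω.1 := by
    have : ∀ i, ω.1 i * (β * √n / nrm ω.1 * ω.1 i) = β * √n / nrm ω.1 * ω.1 i ^ 2 :=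
      fun i => by ring
    simp only [this]
    rw [← Finset.mul_sum, ← nrm_sq]
    field_simp
  unfold valG
  rw [e1, e2]
  generalize √((∑ j, w j ^ 2) / n + σ ^ 2) = T
  generalize (∑ j, ω.2.1 j * w j) = s
  have e3 := scale_value hs hss T (nrm ω.1) (σ * ω.2.2) s
  rw [mul_div_assoc σ] at e3
  generalize T * (nrm ω.1 / √n) + σ * (ω.2.2 / √n) - s / n = x at *
  rw [mul_pow, sq (√(n : ℝ)), hss]
  have e4 : T * (β * √n * nrm ω.1) + β * √n * (σ * ω.2.2 - s / √n) = β * (√n * √n) * x := by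
    linear_combination β * √n * e3
  rw [e4, hss]
  ring

/-- Growth of the decoupled objective away from the denoiser output. -/
lemma Typical.lower {bmin tmax rmax r : ℝ} (hn : 0 < n) (hσ : 0 < σ) (hτ : σ ≤ τ) (hτm : τ ≤ tmax)
    (hbmin : 0 < bmin) (hβ : bmin ≤ β) (hβτ : β ≤ τ) (hlam : 0 < lam) (hρ : ρ ≤ 1 / 2)
    (hr : 0 < r) (hrmax : r ≤ rmax)
    (hρr : ρ * (tmax + 1 / σ) ≤
      bmin * σ ^ 2 / (8 * (tmax + 1 / σ) ^ 2 * (tmax + 1 / σ + rmax)) * r)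
    (H : Typical σ ρ lam β τ m θs ω) (w : Fin N → ℝ)
    (hw : n * r ^ 2 ≤ ∑ j, (w j - denoiseErr θs τ (τ * lam / β) ω.2.1 j) ^ 2) :
    ∃ u, n * (β ^ 2 / 2 + m - (tmax * (tmax + 2 / σ + σ + 1) + 1) * ρ
        + bmin * σ ^ 2 / (8 * (tmax + 1 / σ) ^ 2 * (tmax + 1 / σ + rmax)) * r ^ 2)
      ≤ valG σ ω u w - nrm u ^ 2 / 2 + lam * ∑ j, |θs j + w j| := by
  have hn' : (0 : ℝ) < n := by exact_mod_cast hn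
  have hs : 0 < √(n : ℝ) := Real.sqrt_pos.2 hn'
  have hβ0 : 0 < β := hbmin.trans_le hβ
  have hτ0 : 0 < τ := hσ.trans_le hτ
  have hG := H.norm_noise hn
  have hg : 0 < nrm ω.1 := by
    by_contra hc
    have : nrm ω.1 / √n ≤ 0 := div_nonpos_of_nonpos_of_nonneg (not_lt.1 hc) hs.le
    linarith [(abs_le.1 hG).1]
  obtain ⟨u, hu⟩ := exists_dual_noise (σ := σ) hn hβ0 hg w
  refine ⟨u, ?_⟩
  rw [hu]
  have hv := H.value hn hσ hτ hτm (by linarith)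
  have hT := H.radius hn hσ hτ
  have hA := (abs_le.1 H.penalty).1
  have hρ0 : 0 ≤ ρ := (abs_nonneg _).trans hG
  have hsub : ∑ j, (β * ω.2.1 j - β / τ * denoiseErr θs τ (τ * lam / β) ω.2.1 j)
      * (w j - denoiseErr θs τ (τ * lam / β) ω.2.1 j)
      ≤ lam * ∑ j, |θs j + w j| - lam * ∑ j, |θs j + denoiseErr θs τ (τ * lam / β) ω.2.1 j| := by
    rw [Finset.mul_sum, Finset.mul_sum, ← Finset.sum_sub_distrib]
    refine Finset.sum_le_sum fun j _ => ?_
    have := soft_subgradient hlam hβ0 hτ0 (θs j) (ω.2.1 j) (w j)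
    unfold denoiseErr
    rwa [add_sub_cancel]
  generalize denoiseErr θs τ (τ * lam / β) ω.2.1 = e at *
  have hsub' : β * ∑ j, ω.2.1 j * w j - β * ∑ j, ω.2.1 j * e j
      - β / τ * ∑ j, e j * (w j - e j)
      ≤ lam * ∑ j, |θs j + w j| - lam * ∑ j, |θs j + e j| := by
    refine le_trans (le_of_eq ?_) hsub
    simp only [Finset.mul_sum, ← Finset.sum_sub_distrib]
    exact Finset.sum_congr rfl fun j _ => by ring
  have hexp : ∑ j, w j ^ 2 = ∑ j, e j ^ 2 + 2 * ∑ j, e j * (w j - e j) + ∑ j, (w j - e j) ^ 2 := by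
    simp only [Finset.mul_sum, ← Finset.sum_add_distrib]
    exact Finset.sum_congr rfl fun j _ => by ring
  have hcs : (∑ j, e j * (w j - e j)) ^ 2 ≤ (∑ j, e j ^ 2) * ∑ j, (w j - e j) ^ 2 :=
    Finset.sum_mul_sq_le_sq_mul_sq _ _ _
  have ha0 : 0 ≤ ∑ j, e j ^ 2 := Finset.sum_nonneg fun j _ => sq_nonneg _
  have hV0 : 0 ≤ ∑ j, (w j - e j) ^ 2 := Finset.sum_nonneg fun j _ => sq_nonneg _
  have hw0 : 0 ≤ ∑ j, w j ^ 2 := Finset.sum_nonneg fun j _ => sq_nonneg _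
  generalize ∑ j, w j ^ 2 = W at *
  generalize ∑ j, e j ^ 2 = a at *
  generalize ∑ j, e j * (w j - e j) = q at *
  generalize ∑ j, (w j - e j) ^ 2 = V at *
  generalize lam * ∑ j, |θs j + w j| = A at *
  generalize lam * ∑ j, |θs j + e j| = A' at *
  generalize ∑ j, ω.2.1 j * w j = s at *
  generalize ∑ j, ω.2.1 j * e j = s' at *
  generalize nrm ω.1 / √n = G at *
  generalize ω.2.2 / √n = k at *
  have hT0 : 0 < √(W / n + σ ^ 2) := Real.sqrt_pos.2 (by positivity)
  have hT0' : 0 < √(a / n + σ ^ 2) := Real.sqrt_pos.2 (by positivity)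
  have hT2 : √(W / n + σ ^ 2) ^ 2 = a / n + 2 * (q / n) + V / n + σ ^ 2 := by
    rw [Real.sq_sqrt (by positivity), hexp]; ring
  have hT2' : √(a / n + σ ^ 2) ^ 2 = a / n + σ ^ 2 := Real.sq_sqrt (by positivity)
  generalize √(W / n + σ ^ 2) = T at *
  generalize √(a / n + σ ^ 2) = T' at *
  have hR : V / n = √(V / n) ^ 2 := (Real.sq_sqrt (by positivity)).symm
  have hcs' : (q / n) ^ 2 ≤ a / n * (V / n) := by
    rw [div_pow, div_mul_div_comm, ← sq]; gcongr
  have hrR : r ≤ √(V / n) := by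
    refine Real.le_sqrt_of_sq_le ?_
    rw [le_div_iff₀ hn']; linarith
  have hqR : |q / n| ≤ T' * √(V / n) := by
    refine abs_le_of_sq_le_sq (hcs'.trans ?_) (by positivity)
    rw [mul_pow, ← hR, hT2']
    exact mul_le_mul_of_nonneg_right (by linarith [sq_nonneg σ]) (by positivity)
  have hlow := radius_lower hT0 hT0' hcs' hT2 hT2'
  have hup := radius_upper hT0' (Real.sqrt_nonneg _) hR hqR hT2 hT2'
  rw [hR] at hlow
  have hgap := process_gap hσ hbmin hβ hβτ hτm hτ hρ hG hT0' hT hT0 hr hrmax hrR hqR hup hlow hρr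
  set c := bmin * σ ^ 2 / (8 * (tmax + 1 / σ) ^ 2 * (tmax + 1 / σ + rmax))
  have hdiv : β * (s / n) - β * (s' / n) - β / τ * (q / n) ≤ A / n - A' / n := by
    rw [← mul_div_assoc, ← mul_div_assoc, ← mul_div_assoc, ← sub_div, ← sub_div, ← sub_div]
    gcongr
  have hA' : m - ρ ≤ A' / n := by
    rw [le_div_iff₀ hn']; linarith
  have hbv := mul_le_mul_of_nonneg_left (abs_le.1 hv).1 hβ0.le
  have hC1 : 0 ≤ tmax + 2 / σ + σ + 1 := by
    have : 0 < 2 / σ := by positivity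
    linarith
  set C1 := tmax + 2 / σ + σ + 1
  have hβt : β * (C1 * ρ) ≤ tmax * (C1 * ρ) :=
    mul_le_mul_of_nonneg_right (hβτ.trans hτm) (by positivity)
  have hfin : β ^ 2 / 2 + m - (tmax * C1 + 1) * ρ + c * r ^ 2
      ≤ β * (T * G + σ * k - s / n) - β ^ 2 / 2 + A / n := by
    linarith
  have := mul_le_mul_of_nonneg_left hfin hn'.le
  refine this.trans (le_of_eq ?_)
  field_simp
end

lemma GW_left (n N : ℕ) (S : Set (Fin n → ℝ)) : GW n N {ω | ω.1 ∈ S} = stdPi (Fin n) S := by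
  have : {ω : (Fin n → ℝ) × (Fin N → ℝ) × ℝ | ω.1 ∈ S} = S ×ˢ Set.univ := by ext; simp
  rw [this, GW, Measure.prod_prod, measure_univ, mul_one]

lemma GW_mid (n N : ℕ) (S : Set (Fin N → ℝ)) : GW n N {ω | ω.2.1 ∈ S} = stdPi (Fin N) S := by
  have : {ω : (Fin n → ℝ) × (Fin N → ℝ) × ℝ | ω.2.1 ∈ S}
      = Set.univ ×ˢ (S ×ˢ Set.univ) := by ext; simp
  rw [this, GW, Measure.prod_prod, Measure.prod_prod]
  simp

lemma GW_right (n N : ℕ) (S : Set ℝ) : GW n N {ω | ω.2.2 ∈ S} = gaussianReal 0 1 S := by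
  have : {ω : (Fin n → ℝ) × (Fin N → ℝ) × ℝ | ω.2.2 ∈ S}
      = Set.univ ×ˢ (Set.univ ×ˢ S) := by ext; simp
  rw [this, GW, Measure.prod_prod, Measure.prod_prod]
  simp

lemma measure_le_sum_five {α : Type*} [MeasurableSpace α] {μ : Measure α} {S S₁ S₂ S₃ S₄ S₅ : Set α}
    (h : S ⊆ S₁ ∪ S₂ ∪ S₃ ∪ S₄ ∪ S₅) {C x : ℝ} (hC : 2 ≤ C) (hx : 0 ≤ x)
    (h₁ : μ S₁ ≤ ENNReal.ofReal (2 * x)) (h₂ : μ S₂ ≤ ENNReal.ofReal (2 * x))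
    (h₃ : μ S₃ ≤ ENNReal.ofReal (2 * x)) (h₄ : μ S₄ ≤ ENNReal.ofReal (2 * x))
    (h₅ : μ S₅ ≤ ENNReal.ofReal (C * x)) : μ S ≤ ENNReal.ofReal (5 * C * x) := by
  have h0 : ENNReal.ofReal (2 * x) ≤ ENNReal.ofReal (C * x) := by gcongr
  calc μ S ≤ μ S₁ + μ S₂ + μ S₃ + μ S₄ + μ S₅ := by
        refine (measure_mono h).trans ?_
        refine (measure_union_le _ _).trans (add_le_add_left ?_ _)
        refine (measure_union_le _ _).trans (add_le_add_left ?_ _)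
        exact (measure_union_le _ _).trans (add_le_add_left (measure_union_le _ _) _)
    _ ≤ ENNReal.ofReal (C * x) + ENNReal.ofReal (C * x) + ENNReal.ofReal (C * x)
        + ENNReal.ofReal (C * x) + ENNReal.ofReal (C * x) := by gcongr <;> exact le_trans ‹_› h0
    _ = ENNReal.ofReal (5 * C * x) := by
        have : 0 ≤ C * x := by positivity
        rw [← ENNReal.ofReal_add this this, ← ENNReal.ofReal_add (by positivity) this,
          ← ENNReal.ofReal_add (by positivity) this, ← ENNReal.ofReal_add (by positivity) this]
        congr 1; ring

/-- Typicality holds with exponentially high probability. -/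
lemma exists_typical {δ σ lmax bmin tmax : ℝ} (hδ : 0 < δ) (hlmax : 0 < lmax) (hbmin : 0 < bmin)
    (htmax : 0 < tmax) :
    ∃ C c : ℝ, 0 < C ∧ 0 < c ∧ ∀ N n : ℕ, 0 < N → (n : ℝ) = δ * N → ∀ lam, 0 < lam → lam ≤ lmax →
      ∀ (θs : Fin N → ℝ) (β τ : ℝ), StateEvo δ σ (empDist θs) lam β τ → bmin ≤ β → τ ≤ tmax →
      ∃ m : ℝ, ∀ ρ : ℝ, 0 ≤ ρ → ρ ≤ 1 → ρ * δ ≤ 1 →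
        GW n N {ω | ¬ Typical σ ρ lam β τ m θs ω} ≤ ENNReal.ofReal (C * Real.exp (-c * N * ρ ^ 2)) := by
  set bm := tmax * lmax / bmin with hbm
  have hbm0 : 0 < bm := by positivity
  set K := 2 * (bm ^ 2 + tmax ^ 2) + (bm + tmax) + lmax * (bm + tmax) with hK
  have hK0 : 0 < K := by positivity
  obtain ⟨c₁, hc₁, B₁⟩ := gaussian_bernstein one_pos
  obtain ⟨c₂, hc₂, B₂⟩ := gaussian_bernstein hK0
  have hM := one_le_gaussExpSq
  set c := min (c₁ * δ) (min (c₂ * δ ^ 2) (δ / 4)) with hc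
  refine ⟨5 * (2 * gaussExpSq), c, by linarith, by positivity, ?_⟩
  intro N n hN hn lam hlam hlamm θs β τ hSE hβ hτm
  have hτ : 0 < τ := hSE.2.1
  have hβ0 : 0 < β := hSE.1
  have hN' : (0 : ℝ) < N := by exact_mod_cast hN
  have hn' : (0 : ℝ) < n := by rw [hn]; positivity
  have hsq := hSE.sum_sq hδ hN hlam
  have hmul := hSE.sum_mul hδ hN hlam
  have hb : 0 ≤ τ * lam / β := by positivity
  have hbb : τ * lam / β ≤ bm := by rw [hbm]; gcongr
  set b := τ * lam / β with hbdef
  have hx : ∀ x : ℝ, 0 ≤ 1 + x ^ 2 := fun x => by positivity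
  have hcont := continuous_eta_shift hb
  set f : Fin N → ℝ → ℝ := fun j x => lam * (|eta (θs j + τ * x) b| - |θs j|) with hf
  have hfb : ∀ j x, |f j x| ≤ K * (1 + x ^ 2) := by
    intro j x
    have h1 : |f j x| ≤ lmax * ((bm + tmax) * (1 + x ^ 2)) := by
      rw [hf, abs_mul, abs_of_pos hlam]
      refine mul_le_mul hlamm ?_ (abs_nonneg _) hlmax.le
      refine (abs_abs_sub_abs_le_abs_sub _ _).trans ((abs_eta_add_sub_le hb hτ.le _ _).trans ?_)
      have a1 : |x| ≤ 1 + x ^ 2 := by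
        rw [← sq_abs x]; nlinarith [sq_nonneg (|x| - 1)]
      have a2 : τ * |x| ≤ tmax * (1 + x ^ 2) := mul_le_mul hτm a1 (abs_nonneg _) htmax.le
      have a3 : b * 1 ≤ bm * (1 + x ^ 2) :=
        mul_le_mul hbb (by linarith [sq_nonneg x]) zero_le_one hbm0.le
      linarith
    refine h1.trans ?_
    rw [← mul_assoc]
    refine mul_le_mul_of_nonneg_right ?_ (hx x)
    have : 0 < 2 * (bm ^ 2 + tmax ^ 2) + (bm + tmax) := by positivity
    linarith
  refine ⟨(∑ j, ∫ x, f j x ∂(gaussianReal 0 1) + lam * ∑ j, |θs j|) / n, ?_⟩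
  intro ρ hρ0 hρ1 hρδ
  have hexp : ∀ a : ℝ, c ≤ a → Real.exp (-(a * N * ρ ^ 2)) ≤ Real.exp (-c * N * ρ ^ 2) := by
    intro a ha
    refine Real.exp_le_exp.2 ?_
    have := mul_le_mul_of_nonneg_right ha (by positivity : 0 ≤ N * ρ ^ 2)
    linarith
  have E₁ : GW n N {ω | ω.1 ∈ {g : Fin n → ℝ | ρ * n ≤ |∑ i, g i ^ 2 - n|}}
      ≤ ENNReal.ofReal (2 * Real.exp (-c * N * ρ ^ 2)) := by
    rw [GW_left]
    have := B₁ n (fun _ x => x ^ 2) (fun _ => by fun_prop)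
      (fun _ x => by rw [abs_of_nonneg (sq_nonneg x)]; linarith) ρ hρ0 hρ1
    simp only [integral_sq_std, Finset.sum_const, Finset.card_univ, Fintype.card_fin,
      nsmul_eq_mul, mul_one] at this
    refine this.trans (ENNReal.ofReal_le_ofReal (mul_le_mul_of_nonneg_left ?_ zero_le_two))
    refine le_trans (le_of_eq ?_) (hexp _ (min_le_left _ _))
    rw [hn]; congr 1; ring
  have bern : ∀ F : Fin N → ℝ → ℝ, (∀ j, Continuous (F j)) → (∀ j x, |F j x| ≤ K * (1 + x ^ 2)) →
      GW n N {ω | ω.2.1 ∈ {h : Fin N → ℝ | ρ * n ≤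
        |∑ j, F j (h j) - ∑ j, ∫ x, F j x ∂(gaussianReal 0 1)|}}
      ≤ ENNReal.ofReal (2 * Real.exp (-c * N * ρ ^ 2)) := by
    intro F hF hFK
    rw [GW_mid]
    have := B₂ N F (fun j => (hF j).measurable) hFK (ρ * δ) (by positivity) hρδ
    rw [mul_assoc ρ, ← hn] at this
    refine this.trans (ENNReal.ofReal_le_ofReal (mul_le_mul_of_nonneg_left ?_ zero_le_two))
    refine le_trans (le_of_eq ?_) (hexp _ ((min_le_right _ _).trans (min_le_left _ _)))
    congr 1; ring
  have E₂ := bern (fun j x => (eta (θs j + τ * x) b - θs j) ^ 2)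
    (fun j => ((hcont _ _).sub continuous_const).pow 2) (fun j x => by
      refine (sq_shift_sub_le hb hτ.le _ _).trans (mul_le_mul_of_nonneg_right ?_ (hx x))
      have a1 : b ^ 2 ≤ bm ^ 2 := pow_le_pow_left₀ hb hbb 2
      have a2 : τ ^ 2 ≤ tmax ^ 2 := pow_le_pow_left₀ hτ.le hτm 2
      have a3 : 0 < (bm + tmax) + lmax * (bm + tmax) := by positivity
      linarith)
  have E₃ := bern (fun j x => x * (eta (θs j + τ * x) b - θs j))
    (fun j => continuous_id.mul ((hcont _ _).sub continuous_const)) (fun j x => by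
      refine (mul_shift_sub_le hb hτ.le _ _).trans (mul_le_mul_of_nonneg_right ?_ (hx x))
      have a3 : 0 < 2 * (bm ^ 2 + tmax ^ 2) + lmax * (bm + tmax) := by positivity
      linarith)
  have E₄ := bern f (fun j => continuous_const.mul ((hcont _ _).abs.sub continuous_const)) hfb
  have E₅ : GW n N {ω | ω.2.2 ∈ {x : ℝ | ρ * √n ≤ |x|}}
      ≤ ENNReal.ofReal (2 * gaussExpSq * Real.exp (-c * N * ρ ^ 2)) := by
    rw [GW_right]
    refine (gaussian_tail _ (by positivity)).trans (ENNReal.ofReal_le_ofReal ?_)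
    refine mul_le_mul (by linarith) ?_ (Real.exp_pos _).le (by linarith)
    refine le_trans (le_of_eq ?_) (hexp _ ((min_le_right _ _).trans (min_le_right _ _)))
    rw [mul_pow, Real.sq_sqrt hn'.le, hn]; congr 1; ring
  refine measure_le_sum_five ?_ (by linarith) (Real.exp_pos _).le E₁ E₂ E₃ E₄ E₅
  intro ω hω
  by_contra hcon
  simp only [Set.mem_union, Set.mem_ofPred_eq, not_or, not_le] at hcon
  obtain ⟨⟨⟨⟨h₁, h₂⟩, h₃⟩, h₄⟩, h₅⟩ := hcon
  refine hω ⟨h₁.le, ?_, ?_, ?_, h₅.le⟩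
  · rw [hsq, ← hn] at h₂; exact h₂.le
  · rw [hmul, ← hn] at h₃; exact h₃.le
  · refine le_trans (le_of_eq ?_) h₄.le
    congr 1
    rw [mul_div_cancel₀ _ hn'.ne']
    simp only [hf, denoiseErr, add_sub_cancel, ← Finset.mul_sum, Finset.sum_sub_distrib]
    ring

/-- The elementary tail comparison behind the final probability bound. -/
lemma exists_tail_bound {C₁ c₁ C₂ c₂ κ a : ℝ} (hC₁ : 0 < C₁) (hc₁ : 0 < c₁) (hC₂ : 0 < C₂)
    (hc₂ : 0 < c₂) (hκ : 0 < κ) (ha : 0 < a) :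
    ∃ C c : ℝ, 0 < C ∧ 0 < c ∧ ∀ N ε P : ℝ, 0 ≤ N → 0 < ε → ε ≤ 1 / 2 → P ≤ 1 →
      P ≤ C₁ * Real.exp (-c₁ * N * (κ * ε) ^ 2)
        + C₂ * Real.exp (C₂ * ε ^ (-a) - c₂ * (N * (ε ^ 2 / (Real.log ε) ^ 2))) →
      P ≤ C * ε ^ (-(max (1 : ℝ) a))
        * Real.exp (-c * N * ε ^ 2 * ε ^ a / (Real.log ε) ^ 2) := by
  set c := min (c₁ * κ ^ 2 / 4) (c₂ / 2) with hc
  have hc0 : 0 < c := by positivity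
  set K := 2 * C₂ / c₂ with hK
  refine ⟨C₁ + C₂ + Real.exp (c * K), c, by positivity, hc0, ?_⟩
  intro N ε P hN hε hε2 hP1 hP
  have hlog := neg_log_ge hε hε2
  have hL : 1 / 4 ≤ (Real.log ε) ^ 2 := by nlinarith
  set L := (Real.log ε) ^ 2 with hLdef
  have hL0 : 0 < L := by linarith
  set y := N * (ε ^ 2 / L) with hy
  have hy0 : 0 ≤ y := by positivity
  have hεa : 0 < ε ^ a := Real.rpow_pos_of_pos hε a
  have hεa1 : ε ^ a ≤ 1 := Real.rpow_le_one hε.le (by linarith) ha.le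
  have hneg : ε ^ (-a) = (ε ^ a)⁻¹ := Real.rpow_neg hε.le a
  have e : -c * N * ε ^ 2 * ε ^ a / L = -(c * (y * ε ^ a)) := by rw [hy]; ring
  rw [e]
  have hpre : 1 ≤ ε ^ (-(max (1 : ℝ) a)) :=
    Real.one_le_rpow_of_pos_of_le_one_of_nonpos hε (by linarith)
      (neg_nonpos.2 (zero_le_one.trans (le_max_left _ _)))
  have hyx : y * ε ^ a ≤ y := mul_le_of_le_one_right hy0 hεa1
  set X := Real.exp (-(c * (y * ε ^ a))) with hX
  have hX0 : 0 < X := Real.exp_pos _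
  suffices h : P ≤ (C₁ + C₂ + Real.exp (c * K)) * X by
    refine h.trans (mul_le_mul_of_nonneg_right ?_ hX0.le)
    exact le_mul_of_one_le_right (by positivity) hpre
  rcases le_or_gt K (y * ε ^ a) with hKx | hKx
  · have h1 : Real.exp (-c₁ * N * (κ * ε) ^ 2) ≤ X := by
      refine Real.exp_le_exp.2 ?_
      have a1 : N * ε ^ 2 = y * L := by rw [hy]; field_simp
      have a2 : -c₁ * N * (κ * ε) ^ 2 = -(c₁ * κ ^ 2 * (N * ε ^ 2)) := by ring
      rw [a2, a1, neg_le_neg_iff]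
      calc c * (y * ε ^ a) ≤ c₁ * κ ^ 2 / 4 * y :=
            mul_le_mul (min_le_left _ _) hyx (by positivity) (by positivity)
        _ = c₁ * κ ^ 2 * (y * (1 / 4)) := by ring
        _ ≤ c₁ * κ ^ 2 * (y * L) := by gcongr
    have h2 : Real.exp (C₂ * ε ^ (-a) - c₂ * y) ≤ X := by
      refine Real.exp_le_exp.2 ?_
      have a1 : C₂ ≤ c₂ / 2 * (y * ε ^ a) := by
        rw [hK, div_le_iff₀ hc₂] at hKx; linarith
      have a2 : C₂ * ε ^ (-a) ≤ c₂ / 2 * y := by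
        rw [hneg, ← div_eq_mul_inv, div_le_iff₀ hεa]; linarith
      have a3 : c * (y * ε ^ a) ≤ c₂ / 2 * y :=
        mul_le_mul (min_le_right _ _) hyx (by positivity) (by positivity)
      linarith
    have h3 := mul_le_mul_of_nonneg_left h1 hC₁.le
    have h4 := mul_le_mul_of_nonneg_left h2 hC₂.le
    have h5 : 0 ≤ Real.exp (c * K) * X := by positivity
    linarith
  · have h1 : 1 ≤ Real.exp (c * K) * X := by
      rw [hX, ← Real.exp_add]
      refine Real.one_le_exp ?_
      have := mul_le_mul_of_nonneg_left hKx.le hc0.le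
      linarith
    have h2 : 0 ≤ (C₁ + C₂) * X := by positivity
    linarith

section
variable {N : ℕ} (lam : ℝ) (θs : Fin N → ℝ)

/-- The Lasso penalty as a function of the error vector. -/
def shiftPenalty (w : Fin N → ℝ) : ℝ := lam * ∑ j, |θs j + w j|

lemma continuous_shiftPenalty : Continuous (shiftPenalty lam θs) := by
  unfold shiftPenalty; fun_prop

variable {lam}

lemma convexOn_shiftPenalty (hlam : 0 ≤ lam) : ConvexOn ℝ Set.univ (shiftPenalty lam θs) := by
  refine ⟨convex_univ, fun x _ y _ a b ha hb hab => ?_⟩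
  simp only [shiftPenalty, smul_eq_mul, Pi.add_apply, Pi.smul_apply]
  rw [mul_left_comm a, mul_left_comm b, ← mul_add]
  refine mul_le_mul_of_nonneg_left ?_ hlam
  rw [Finset.mul_sum, Finset.mul_sum, ← Finset.sum_add_distrib]
  refine Finset.sum_le_sum fun j _ => ?_
  have : θs j + (a * x j + b * y j) = a * (θs j + x j) + b * (θs j + y j) := by
    linear_combination -θs j * hab
  rw [this]
  refine (abs_add_le _ _).trans ?_
  rw [abs_mul, abs_mul, abs_of_nonneg ha, abs_of_nonneg hb]

lemma tendsto_shiftPenalty (hlam : 0 < lam) :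
    Filter.Tendsto (shiftPenalty lam θs) (Filter.cocompact _) Filter.atTop := by
  have h : ∀ w : Fin N → ℝ, lam * (‖w‖ - ∑ j, |θs j|) ≤ shiftPenalty lam θs w := by
    intro w
    refine mul_le_mul_of_nonneg_left ?_ hlam.le
    rw [sub_le_iff_le_add, ← Finset.sum_add_distrib]
    refine (pi_norm_le_iff_of_nonneg (by positivity)).2 fun i => ?_
    calc ‖w i‖ ≤ |θs i + w i| + |θs i| := by
          rw [Real.norm_eq_abs]
          have := abs_sub (θs i + w i) (θs i)
          rwa [add_sub_cancel_left] at this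
      _ ≤ ∑ j, (|θs j + w j| + |θs j|) :=
          Finset.single_le_sum (f := fun j => |θs j + w j| + |θs j|)
            (fun j _ => by positivity) (Finset.mem_univ i)
  refine Filter.tendsto_atTop_mono h (Filter.Tendsto.const_mul_atTop hlam ?_)
  exact Filter.tendsto_atTop_add_const_right _ _ tendsto_norm_cocompact_atTop

end

lemma lassoCost_eq {n N : ℕ} (hn : 0 < n) (σ lam : ℝ) (θs θ : Fin N → ℝ)
    (ω : (Fin n → Fin N → ℝ) × (Fin n → ℝ)) :
    n * lassoCost ω.1 (yvec σ θs ω.1 ω.2) lam θ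
      = resCost σ ω (fun j => θ j - θs j) + shiftPenalty lam θs (fun j => θ j - θs j) := by
  have hn' : (n : ℝ) ≠ 0 := by exact_mod_cast hn.ne'
  have h1 : ∀ i, yvec σ θs ω.1 ω.2 i - ∑ j, ω.1 i j * θ j
      = σ * ω.2 i - ∑ j, ω.1 i j * (θ j - θs j) := by
    intro i
    simp only [yvec, mul_sub, Finset.sum_sub_distrib]
    ring
  simp only [lassoCost, resCost, shiftPenalty, h1, add_sub_cancel]
  field_simp

lemma lassoCost_nonneg {n N : ℕ} {lam : ℝ} (hlam : 0 ≤ lam) (X : Fin n → Fin N → ℝ)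
    (y : Fin n → ℝ) (θ : Fin N → ℝ) : 0 ≤ lassoCost X y lam θ := by
  unfold lassoCost; positivity

/-- Near-minimizers in a set force either a large minimum or a small constrained minimum. -/
lemma near_min_subset {n N : ℕ} (hn : 0 < n) {σ lam : ℝ} (hlam : 0 ≤ lam) (θs : Fin N → ℝ)
    (S : Set (Fin N → ℝ)) {t η t' : ℝ} (ht : t + n * η < t') :
    {ω : (Fin n → Fin N → ℝ) × (Fin n → ℝ) | ∃ θ : Fin N → ℝ, (fun j => θ j - θs j) ∈ S ∧
      lassoCost ω.1 (yvec σ θs ω.1 ω.2) lam θ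
        ≤ sInf (Set.range (lassoCost ω.1 (yvec σ θs ω.1 ω.2) lam)) + η}
    ⊆ {ω | ∀ w, t < resCost σ ω w + shiftPenalty lam θs w}
      ∪ {ω | ∃ w ∈ S, resCost σ ω w + shiftPenalty lam θs w < t'} := by
  have hn' : (0 : ℝ) < n := by exact_mod_cast hn
  rintro ω ⟨θ, hθS, hθ⟩
  by_cases hup : ∀ w, t < resCost σ ω w + shiftPenalty lam θs w
  · exact Or.inl hup
  right
  push Not at hup
  obtain ⟨w, hw⟩ := hup
  refine ⟨_, hθS, ?_⟩
  rw [← lassoCost_eq hn]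
  have h1 := lassoCost_eq hn σ lam θs (fun j => θs j + w j) ω
  simp only [add_sub_cancel_left] at h1
  have h2 : sInf (Set.range (lassoCost ω.1 (yvec σ θs ω.1 ω.2) lam))
      ≤ lassoCost ω.1 (yvec σ θs ω.1 ω.2) lam (fun j => θs j + w j) :=
    csInf_le ⟨0, by rintro _ ⟨θ', rfl⟩; exact lassoCost_nonneg hlam _ _ _⟩ ⟨_, rfl⟩
  have h3 := mul_le_mul_of_nonneg_left hθ hn'.le
  have h4 := mul_le_mul_of_nonneg_left h2 hn'.le
  change resCost σ ω w + _ ≤ t at hw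
  linarith

/-- Existence of the precision `ρ = κ ε` at which all error terms are dominated. -/
lemma exists_precision {δ B c₁ C₁ C₂ : ℝ} (hδ : 0 < δ) (hB : 0 < B) (hc₁ : 0 < c₁) (hC₁ : 0 < C₁)
    (hC₂ : 0 < C₂) :
    ∃ κ : ℝ, 0 < κ ∧ ∀ ε : ℝ, 0 < ε → ε ≤ 1 / 2 → κ * ε ≤ 1 / 2 ∧ κ * ε * δ ≤ 1 ∧
      κ * ε * B ≤ c₁ * √(ε / (4 * δ)) ∧ C₁ * (κ * ε) ≤ c₁ / (4 * δ) * ε / 8 ∧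
      C₂ * (κ * ε) ≤ c₁ / (4 * δ) * ε / 8 := by
  have hsδ : 0 < √(4 * δ) := by positivity
  set κ := min (min 1 (1 / δ)) (min (c₁ / (√(4 * δ) * B))
    (min (c₁ / (4 * δ) / (8 * C₁)) (c₁ / (4 * δ) / (8 * C₂)))) with hκ
  have hκ0 : 0 < κ := by positivity
  have k1 : κ ≤ 1 := (min_le_left _ _).trans (min_le_left _ _)
  have k2 : κ * δ ≤ 1 := (le_div_iff₀ hδ).1 ((min_le_left _ _).trans (min_le_right _ _))
  have k3 : κ * (√(4 * δ) * B) ≤ c₁ :=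
    (le_div_iff₀ (by positivity)).1 ((min_le_right _ _).trans (min_le_left _ _))
  have k4 : κ * (8 * C₁) ≤ c₁ / (4 * δ) := (le_div_iff₀ (by positivity)).1
    ((min_le_right _ _).trans ((min_le_right _ _).trans (min_le_left _ _)))
  have k5 : κ * (8 * C₂) ≤ c₁ / (4 * δ) := (le_div_iff₀ (by positivity)).1
    ((min_le_right _ _).trans ((min_le_right _ _).trans (min_le_right _ _)))
  refine ⟨κ, hκ0, fun ε hε hε2 => ⟨?_, ?_, ?_, ?_, ?_⟩⟩
  · exact (mul_le_of_le_one_left hε.le k1).trans hε2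
  · calc κ * ε * δ = κ * δ * ε := by ring
      _ ≤ 1 * ε := by gcongr
      _ ≤ 1 := by linarith
  · have hε' : ε ≤ √ε := Real.le_sqrt_of_sq_le (by nlinarith)
    rw [Real.sqrt_div hε.le, ← mul_div_assoc, le_div_iff₀ hsδ]
    calc κ * ε * B * √(4 * δ) = κ * (√(4 * δ) * B) * ε := by ring
      _ ≤ c₁ * √ε := mul_le_mul k3 hε' hε.le hc₁.le
  · have := mul_le_mul_of_nonneg_right k4 hε.le
    linarith
  · have := mul_le_mul_of_nonneg_right k5 hε.le
    linarith

lemma sqrt_div_le {δ ε : ℝ} (hδ : 0 < δ) (hε : ε ≤ 1 / 2) :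
    √(ε / (4 * δ)) ≤ 1 / (8 * δ) + 1 := by
  refine Real.sqrt_le_iff.2 ⟨by positivity, ?_⟩
  have h1 : ε / (4 * δ) ≤ 1 / (8 * δ) := by
    rw [div_le_div_iff₀ (by positivity) (by positivity)]; nlinarith
  have h2 : 0 < 1 / (8 * δ) := by positivity
  nlinarith

/-- Probability that a near-minimizer has an error vector in a set bounded away from the
denoiser output. -/
lemma near_min_prob {n N : ℕ} (hn : 0 < n) {σ ρ lam β τ m bmin tmax rmax r g : ℝ}
    {θs : Fin N → ℝ} {S E : Set (Fin N → ℝ)} (hσ : 0 < σ) (hτ : σ ≤ τ) (hτm : τ ≤ tmax)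
    (hbmin : 0 < bmin) (hβ : bmin ≤ β) (hβτ : β ≤ τ) (hlam : 0 < lam) (hρ : ρ ≤ 1 / 2)
    (hr : 0 < r) (hrmax : r ≤ rmax)
    (hρr : ρ * (tmax + 1 / σ) ≤
      bmin * σ ^ 2 / (8 * (tmax + 1 / σ) ^ 2 * (tmax + 1 / σ + rmax)) * r)
    (hg : g = bmin * σ ^ 2 / (8 * (tmax + 1 / σ) ^ 2 * (tmax + 1 / σ + rmax)) * r ^ 2)
    (hg0 : 0 < g)
    (hup : ((tmax + 2 / σ + σ + 1) * tmax + (tmax + 2 / σ + σ + 1) ^ 2 + 1) * ρ ≤ g / 8)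
    (hlow : (tmax * (tmax + 2 / σ + σ + 1) + 1) * ρ ≤ g / 8)
    (hS : ∀ h ∉ E, ∀ w ∈ S,
      n * r ^ 2 ≤ ∑ j, (w j - denoiseErr θs τ (τ * lam / β) h j) ^ 2) :
    Pmodel n N {ω | ∃ θ : Fin N → ℝ, (fun j => θ j - θs j) ∈ S ∧
      lassoCost ω.1 (yvec σ θs ω.1 ω.2) lam θ
        ≤ sInf (Set.range (lassoCost ω.1 (yvec σ θs ω.1 ω.2) lam)) + g / 4}
      ≤ 4 * GW n N {ω | ¬ Typical σ ρ lam β τ m θs ω} + 2 * stdPi (Fin N) E := by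
  have hn' : (0 : ℝ) < n := by exact_mod_cast hn
  have hng : 0 < n * g := by positivity
  have hβ0 : 0 < β := hbmin.trans_le hβ
  set t := n * (β ^ 2 / 2 + m + g / 4) with ht
  set t' := n * (β ^ 2 / 2 + m + 3 * g / 4) with ht'
  have htt : t + n * (g / 4) < t' := by rw [ht, ht']; linarith
  have h1 : Pmodel n N {ω | ∀ w, t < resCost σ ω w + shiftPenalty lam θs w}
      ≤ 2 * GW n N {ω | ¬ Typical σ ρ lam β τ m θs ω} := by
    refine (gordon_up hn σ _ (continuous_shiftPenalty lam θs) (convexOn_shiftPenalty θs hlam.le)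
      (tendsto_shiftPenalty θs hlam) t).trans ?_
    refine mul_le_mul_right (measure_mono fun ω hω hT => ?_) _
    have h2 := (hω _).trans (hT.upper hn hσ hτ hτm hβ0 hβτ (by linarith))
    have h3 := mul_le_mul_of_nonneg_left hup hn'.le
    linarith
  have h2 : Pmodel n N {ω | ∃ w ∈ S, resCost σ ω w + shiftPenalty lam θs w < t'}
      ≤ 2 * (GW n N {ω | ¬ Typical σ ρ lam β τ m θs ω} + stdPi (Fin N) E) := by
    refine (gordon_low hn σ S _ (continuous_shiftPenalty lam θs) t').trans ?_
    rw [← GW_mid n N E]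
    gcongr
    refine le_trans (measure_mono ?_) (measure_union_le _ _)
    rintro ω ⟨w, hw, hω⟩
    by_contra hcon
    simp only [Set.mem_union, Set.mem_ofPred_eq, not_or, not_not] at hcon
    obtain ⟨u, hu⟩ := hcon.1.lower hn hσ hτ hτm hbmin hβ hβτ hlam hρ hr hrmax hρr w
      (hS _ hcon.2 w hw)
    rw [← hg] at hu
    have h3 := hu.trans (hω u)
    have h4 := mul_le_mul_of_nonneg_left hlow hn'.le
    linarith
  refine (measure_mono (near_min_subset hn hlam.le θs S htt)).trans ((measure_union_le _ _).trans
    ((add_le_add h1 h2).trans (le_of_eq ?_)))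
  ring

/-- Theorem (local stability of the empirical distribution for the Lasso cost):
any near-minimizer of the Lasso cost has empirical distribution close to μ⋆_λ. -/
theorem stmt13 (δ σ lmin lmax p ξ : ℝ)
    (hδ : 0 < δ) (hσ : 0 < σ) (hl : 0 < lmin) (hll : lmin ≤ lmax)
    (hp : 0 < p) (hξ : 0 < ξ) :
    ∃ C c γ : ℝ, 0 < C ∧ 0 < c ∧ 0 < γ ∧
      ∀ (N n : ℕ), 0 < N → (n : ℝ) = δ * N →
      ∀ lam ∈ Set.Icc lmin lmax,
      ∀ θstar ∈ Fball N p ξ,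
      ∀ βstar τstar : ℝ,
      StateEvo δ σ (empDist θstar) lam βstar τstar →
      ∀ ε : ℝ, ε ∈ Set.Ioc (0 : ℝ) (1 / 2) →
      Pmodel n N
        {ω | ∃ θ : Fin N → ℝ,
          ε ≤ W2sq (empDist2 θ θstar) (muStar (empDist θstar) τstar (lam / βstar)) ∧
          lassoCost ω.1 (yvec σ θstar ω.1 ω.2) lam θ ≤
            sInf (Set.range (lassoCost ω.1 (yvec σ θstar ω.1 ω.2) lam)) + γ * ε}
      ≤ ENNReal.ofReal (C * ε ^ (-(max (1 : ℝ) (1 / 2 + 1 / p)))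
          * Real.exp (-c * N * ε ^ 2 * ε ^ (1 / 2 + 1 / p) / (Real.log ε) ^ 2)) := by
  obtain ⟨bmin, tmax, hbmin, htmax, hbounds⟩ :=
    exists_state_bounds (lmax := lmax) hδ hσ hl hp hξ
  obtain ⟨Ct, ct, hCt, hct, htyp⟩ :=
    exists_typical (σ := σ) hδ (hl.trans_le hll) hbmin htmax
  obtain ⟨Ce, ce, hCe, hce, hcoup⟩ := exists_coupling_event htmax hp hξ
  obtain ⟨B, hB⟩ : ∃ B, B = tmax + 1 / σ := ⟨_, rfl⟩
  have hB0 : 0 < B := by rw [hB]; positivity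
  obtain ⟨rmax, hrmax⟩ : ∃ r, r = 1 / (8 * δ) + 1 := ⟨_, rfl⟩
  have hrmax0 : 0 < rmax := by rw [hrmax]; positivity
  obtain ⟨c₁, hc₁⟩ : ∃ c, c = bmin * σ ^ 2 / (8 * B ^ 2 * (B + rmax)) := ⟨_, rfl⟩
  have hc₁0 : 0 < c₁ := by rw [hc₁]; positivity
  obtain ⟨C₁, hC₁⟩ : ∃ C, C = tmax + 2 / σ + σ + 1 := ⟨_, rfl⟩
  have hC₁0 : 0 < C₁ := by rw [hC₁]; positivity
  obtain ⟨κ, hκ, hprec⟩ := exists_precision (C₁ := C₁ * tmax + C₁ ^ 2 + 1) (C₂ := tmax * C₁ + 1)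
    hδ hB0 hc₁0 (by positivity) (by positivity)
  obtain ⟨c₃, hc₃⟩ : ∃ c, c = c₁ / (4 * δ) := ⟨_, rfl⟩
  have hc₃0 : 0 < c₃ := by rw [hc₃]; positivity
  have ha : 0 < 1 / 2 + 1 / p := by positivity
  obtain ⟨C, c, hC, hc, htail⟩ := exists_tail_bound (C₁ := 4 * Ct) (c₁ := ct)
    (C₂ := 2 * Ce) (c₂ := ce) (by positivity) hct (by positivity) hce hκ ha
  refine ⟨C, c, c₃ / 4, hC, hc, by positivity, ?_⟩
  intro N n hN hn lam hlam θs hθs β τ hSE ε ⟨hε0, hε2⟩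
  have hN' : (0 : ℝ) < N := by exact_mod_cast hN
  have hn0 : 0 < n := by
    have : (0 : ℝ) < n := by rw [hn]; positivity
    exact_mod_cast this
  have hlam0 : 0 < lam := hl.trans_le hlam.1
  obtain ⟨hβ, hτm⟩ := hbounds N hN lam hlam θs hθs β τ hSE
  have hβ0 := hSE.1
  have hτ0 := hSE.2.1
  obtain ⟨m, hm⟩ := htyp N n hN hn lam hlam0 hlam.2 θs β τ hSE hβ hτm
  obtain ⟨k1, k2, k3, k4, k5⟩ := hprec ε hε0 hε2
  rw [← hc₃] at k4 k5
  have hPt := hm (κ * ε) (by positivity) (k1.trans (by norm_num)) k2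
  obtain ⟨E, hE, hcE⟩ := hcoup N hN θs hθs ε hε0 hε2
  have hr0 : 0 < √(ε / (4 * δ)) := Real.sqrt_pos.2 (by positivity)
  have hr2 : √(ε / (4 * δ)) ^ 2 = ε / (4 * δ) := Real.sq_sqrt (by positivity)
  have hrm : √(ε / (4 * δ)) ≤ rmax := hrmax ▸ sqrt_div_le hδ hε2
  have hS : ∀ h ∉ E, ∀ w ∈ {w : Fin N → ℝ |
      ε ≤ W2sq (empDist2 (fun j => w j + θs j) θs) (muStar (empDist θs) τ (lam / β))},
      n * √(ε / (4 * δ)) ^ 2 ≤ ∑ j, (w j - denoiseErr θs τ (τ * lam / β) h j) ^ 2 := by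
    intro h hh w hw
    have h1 := hw.trans (hcE τ (lam / β) hτ0 hτm (by positivity) h hh _)
    have h2 : lam / β * τ = τ * lam / β := by ring
    have h3 : ∀ j, w j + θs j - eta (θs j + τ * h j) (τ * lam / β)
        = w j - denoiseErr θs τ (τ * lam / β) h j := fun j => by unfold denoiseErr; ring
    simp only [h2, h3] at h1
    rw [hr2, hn]
    have h4 : ε / 2 ≤ 2 / N * ∑ j, (w j - denoiseErr θs τ (τ * lam / β) h j) ^ 2 := by linarith
    rw [div_mul_eq_mul_div, le_div_iff₀ hN'] at h4
    have h5 : δ * N * (ε / (4 * δ)) = ε / 2 * N / 2 := by field_simp; norm_num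
    rw [h5]
    linarith
  subst hB hC₁
  have hmain := near_min_prob (m := m) (g := c₃ * ε) hn0 hσ (hSE.sigma_le_tau hδ hN hlam0) hτm
    hbmin hβ (hSE.beta_le_tau hδ hN) hlam0 k1 hr0 hrm (by rw [← hc₁]; exact k3)
    (by rw [← hc₁, hr2, hc₃]; ring) (by positivity) k4 k5 hS
  simp only [Set.mem_ofPred_eq, sub_add_cancel, ← div_mul_eq_mul_div c₃] at hmain
  have hP1 : (Pmodel n N {ω | ∃ θ : Fin N → ℝ,
      ε ≤ W2sq (empDist2 θ θs) (muStar (empDist θs) τ (lam / β)) ∧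
      lassoCost ω.1 (yvec σ θs ω.1 ω.2) lam θ ≤
        sInf (Set.range (lassoCost ω.1 (yvec σ θs ω.1 ω.2) lam)) + c₃ / 4 * ε}).toReal ≤ 1 :=
    ENNReal.toReal_le_of_le_ofReal zero_le_one (by rw [ENNReal.ofReal_one]; exact prob_le_one)
  refine (ENNReal.le_ofReal_iff_toReal_le (measure_ne_top _ _) (by positivity)).2
    (htail N ε _ hN'.le hε0 hε2 hP1 ?_)
  refine ENNReal.toReal_le_of_le_ofReal (by positivity) (hmain.trans ?_)
  refine (add_le_add (mul_le_mul_right hPt 4) (mul_le_mul_right hE 2)).trans ?_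
  rw [ENNReal.ofReal_add (by positivity) (by positivity), mul_assoc 4, mul_assoc 2,
    ENNReal.ofReal_mul (by norm_num : (0:ℝ) ≤ 4), ENNReal.ofReal_mul (by norm_num : (0:ℝ) ≤ 2),
    ENNReal.ofReal_ofNat, ENNReal.ofReal_ofNat]
  have hεa : 0 < ε ^ (-(1 / 2 + 1 / p)) := Real.rpow_pos_of_pos hε0 _
  rw [mul_assoc ce]
  gcongr
  exact le_mul_of_one_le_left hCe.le one_le_two
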